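/- arXiv:1205.5869 — 2 statements merged into one kernel-verified Lean document; each statement's English description precedes it below -/
import Mathlib

section
/- Let f ∈ Lip(1,p) with p > 1, let (p_k) be positive, P_n = p_0 + ... + p_n, and suppose ∑_{k=0}^{n−1} |P_k/(k+1) − P_{k+1}/(k+2)| = O(P_n/n). Then ‖R_n(f) − f‖_{L^p} = O(n^{−1}). -/
open MeasureTheory Finset Real

/-- The Dirichlet kernel `D_n(u) = 1/2 + ∑_{k=1}^n cos(k u)`. -/
noncomputable def dirichletKernel (n : ℕ) (u : ℝ) : ℝ :=
  1 / 2 + ∑ k ∈ Finset.Icc 1 n, Real.cos (k * u)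

/-- The `n`-th partial sum of the Fourier series of a `2π`-periodic function `f`,
`S_n(f;x) = (1/π) ∫_0^{2π} f(t) D_n(x - t) dt`. -/
noncomputable def partialFourierSum (f : ℝ → ℝ) (n : ℕ) (x : ℝ) : ℝ :=
  (1 / Real.pi) * ∫ t in (0 : ℝ)..(2 * Real.pi), f t * dirichletKernel n (x - t)

/-- The normalized `L^p` norm `‖f‖_{L^p} = ((1/2π) ∫_0^{2π} |f(x)|^p dx)^{1/p}`. -/
noncomputable def lpNorm (p : ℝ) (f : ℝ → ℝ) : ℝ :=
  ((1 / (2 * Real.pi)) * ∫ x in (0 : ℝ)..(2 * Real.pi), |f x| ^ p) ^ (1 / p)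

/-- The integral modulus of continuity
`ω_p(f;δ) = sup_{0<|h|≤δ} ((1/2π) ∫_0^{2π} |f(x+h) - f(x)|^p dx)^{1/p}`. -/
noncomputable def intModulus (p : ℝ) (f : ℝ → ℝ) (δ : ℝ) : ℝ :=
  sSup {y : ℝ | ∃ h : ℝ, 0 < |h| ∧ |h| ≤ δ ∧
    y = ((1 / (2 * Real.pi)) * ∫ x in (0 : ℝ)..(2 * Real.pi), |f (x + h) - f x| ^ p) ^ (1 / p)}

/-- `f ∈ Lip(α,p)`: `f` is `2π`-periodic, belongs to `L^p[0,2π]`, and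
`ω_p(f;δ) = O(δ^α)`. -/
def LipClass (α p : ℝ) (f : ℝ → ℝ) : Prop :=
  Function.Periodic f (2 * Real.pi) ∧
  IntervalIntegrable f MeasureTheory.volume 0 (2 * Real.pi) ∧
  IntervalIntegrable (fun x => |f x| ^ p) MeasureTheory.volume 0 (2 * Real.pi) ∧
  ∃ C : ℝ, 0 < C ∧ ∀ δ : ℝ, 0 < δ → intModulus p f δ ≤ C * δ ^ α

/-- The matrix transform `T_n(f;x) = ∑_{k=0}^n a_{n,k} S_k(f;x)`. -/
noncomputable def matrixMeans (a : ℕ → ℕ → ℝ) (f : ℝ → ℝ) (n : ℕ) (x : ℝ) : ℝ :=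
  ∑ k ∈ Finset.range (n + 1), a n k * partialFourierSum f k x

/-- `A_{n,m} = (1/(m+1)) ∑_{k=0}^m a_{n,k}`, the Cesàro mean of the `n`-th row. -/
noncomputable def rowMean (a : ℕ → ℕ → ℝ) (n m : ℕ) : ℝ :=
  (1 / ((m : ℝ) + 1)) * ∑ k ∈ Finset.range (m + 1), a n k

/-- The Riesz means `R_n(f;x) = (1/P_n) ∑_{k=0}^n p_k S_k(f;x)` with weights `w`. -/
noncomputable def rieszMeans (w : ℕ → ℝ) (f : ℝ → ℝ) (n : ℕ) (x : ℝ) : ℝ :=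
  (1 / (∑ k ∈ Finset.range (n + 1), w k)) *
    ∑ k ∈ Finset.range (n + 1), w k * partialFourierSum f k x

/-- The kernel `K_n(u) = ∑_{k=0}^n a_{n,k} sin((k+1/2)u)/(2 sin(u/2))`. -/
noncomputable def matrixKernel (a : ℕ → ℕ → ℝ) (n : ℕ) (u : ℝ) : ℝ :=
  ∑ k ∈ Finset.range (n + 1),
    a n k * (Real.sin (((k : ℝ) + 1 / 2) * u) / (2 * Real.sin (u / 2)))

/-- Cesàro means in terms of partial sums: `σ_m = S_m - T_m / (m + 1)` where
`T_m = ∑_{j < m} (j + 1) (S_{j+1} - S_j)`. -/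
lemma cesaro_eq_sub {E : Type*} [NormedAddCommGroup E] [NormedSpace ℝ E] (S : ℕ → E) (m : ℕ) :
    (1 / ((m : ℝ) + 1)) • ∑ k ∈ range (m + 1), S k =
      S m - (1 / ((m : ℝ) + 1)) • ∑ j ∈ range m, ((j : ℝ) + 1) • (S (j + 1) - S j) := by
  have hm : (m : ℝ) + 1 ≠ 0 := by positivity
  have key : ∑ k ∈ range (m + 1), S k =
      ((m : ℝ) + 1) • S m - ∑ j ∈ range m, ((j : ℝ) + 1) • (S (j + 1) - S j) := by
    clear hm
    induction m with
    | zero => simp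
    | succ m ih =>
      rw [sum_range_succ, ih, sum_range_succ _ m]
      push_cast
      module
  rw [key, smul_sub, smul_smul, one_div_mul_cancel hm, one_smul]

/-- If `T_k = ∑_{j < k} (j + 1) (S_{j+1} - S_j)` is bounded and the Cesàro means of `S` tend
to `F`, then `S_n` tends to `F` at rate `1 / (n + 1)`. -/
lemma norm_sub_le_of_cesaro_tendsto {E : Type*} [NormedAddCommGroup E] [NormedSpace ℝ E]
    (S : ℕ → E) (F : E) (M : ℝ)
    (hT : ∀ k, ‖∑ j ∈ range k, ((j : ℝ) + 1) • (S (j + 1) - S j)‖ ≤ M)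
    (hσ : Filter.Tendsto (fun m : ℕ => (1 / ((m : ℝ) + 1)) • ∑ k ∈ range (m + 1), S k)
      Filter.atTop (nhds F)) (n : ℕ) :
    ‖S n - F‖ ≤ 2 * M / ((n : ℝ) + 1) := by
  set T : ℕ → E := fun k => ∑ j ∈ range k, ((j : ℝ) + 1) • (S (j + 1) - S j) with hTdef
  set V : ℕ → E := fun m => S m - (1 / ((m : ℝ) + 1)) • T m with hV
  have hlim : Filter.Tendsto V Filter.atTop (nhds F) := by
    refine hσ.congr fun m => ?_
    rw [cesaro_eq_sub]
  have hM : 0 ≤ M := (norm_nonneg _).trans (hT 0)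
  have hstep : ∀ m, V (m + 1) - V m =
      (1 / ((m : ℝ) + 1) - 1 / ((m : ℝ) + 2)) • T (m + 1) := by
    intro m
    have h1 : (m : ℝ) + 1 ≠ 0 := by positivity
    have hS : S (m + 1) - S m = (1 / ((m : ℝ) + 1)) • (T (m + 1) - T m) := by
      simp only [hTdef, sum_range_succ, add_sub_cancel_left, smul_smul]
      rw [one_div_mul_cancel h1, one_smul]
    have : S (m + 1) = S m + (1 / ((m : ℝ) + 1)) • (T (m + 1) - T m) := by rw [← hS]; abel
    simp only [hV]
    rw [this]
    push_cast
    rw [show (m : ℝ) + 1 + 1 = m + 2 by ring]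
    module
  have hdiff : ∀ d, ‖V (n + d) - V n‖ ≤ M * (1 / ((n : ℝ) + 1) - 1 / ((n : ℝ) + d + 1)) := by
    intro d
    induction d with
    | zero => simp
    | succ d ih =>
      have h0 : 0 ≤ 1 / (((n + d : ℕ) : ℝ) + 1) - 1 / (((n + d : ℕ) : ℝ) + 2) := by
        rw [sub_nonneg]; gcongr; norm_num
      have : ‖V (n + d + 1) - V (n + d)‖ ≤
          (1 / (((n + d : ℕ) : ℝ) + 1) - 1 / (((n + d : ℕ) : ℝ) + 2)) * M := by
        rw [hstep, norm_smul, Real.norm_of_nonneg h0]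
        gcongr
        exact hT _
      calc ‖V (n + (d + 1)) - V n‖
          = ‖(V (n + d + 1) - V (n + d)) + (V (n + d) - V n)‖ := by
            rw [sub_add_sub_cancel, add_assoc]
        _ ≤ _ := norm_add_le _ _
        _ ≤ _ := add_le_add this ih
        _ = _ := by push_cast; ring
  have hVF : ‖F - V n‖ ≤ M / ((n : ℝ) + 1) := by
    have h1 : Filter.Tendsto (fun d => ‖V (d + n) - V n‖) Filter.atTop (nhds ‖F - V n‖) :=
      (((Filter.tendsto_add_atTop_iff_nat n).2 hlim).sub_const _).norm
    refine le_of_tendsto' h1 fun d => ?_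
    rw [add_comm d n]
    refine (hdiff d).trans ?_
    rw [div_eq_mul_one_div M]
    gcongr
    have : 0 ≤ 1 / ((n : ℝ) + d + 1) := by positivity
    linarith
  have hSV : ‖S n - V n‖ ≤ M / ((n : ℝ) + 1) := by
    simp only [hV, sub_sub_cancel]
    rw [norm_smul, Real.norm_of_nonneg (by positivity), div_eq_mul_one_div M, mul_comm]
    gcongr
    exact hT n
  calc ‖S n - F‖ = ‖(S n - V n) - (F - V n)‖ := by rw [sub_sub_sub_cancel_right]
    _ ≤ _ := norm_sub_le _ _
    _ ≤ _ := add_le_add hSV hVF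
    _ = _ := by ring

/-- Double summation by parts for weighted means. -/
lemma sum_smul_eq_sub_sum_smul {E : Type*} [NormedAddCommGroup E] [NormedSpace ℝ E]
    (S : ℕ → E) (w : ℕ → ℝ) (n : ℕ) :
    ∑ k ∈ range (n + 1), w k • S k =
      (∑ i ∈ range (n + 1), w i) • S n
      - ((∑ i ∈ range (n + 1), w i) / ((n : ℝ) + 1)) •
          ∑ j ∈ range n, ((j : ℝ) + 1) • (S (j + 1) - S j)
      - ∑ k ∈ range n, ((∑ i ∈ range (k + 1), w i) / ((k : ℝ) + 1) -
          (∑ i ∈ range (k + 2), w i) / ((k : ℝ) + 2)) •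
          ∑ j ∈ range (k + 1), ((j : ℝ) + 1) • (S (j + 1) - S j) := by
  induction n with
  | zero => simp
  | succ n ih =>
    have h1 : (n : ℝ) + 1 ≠ 0 := by positivity
    rw [sum_range_succ (fun k => w k • S k), ih,
      sum_range_succ (fun k => ((∑ i ∈ range (k + 1), w i) / ((k : ℝ) + 1) -
          (∑ i ∈ range (k + 2), w i) / ((k : ℝ) + 2)) •
          ∑ j ∈ range (k + 1), ((j : ℝ) + 1) • (S (j + 1) - S j)),
      sum_range_succ (fun j : ℕ => ((j : ℝ) + 1) • (S (j + 1) - S j)),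
      sum_range_succ w (n + 1)]
    set P := ∑ i ∈ range (n + 1), w i
    set T := ∑ j ∈ range n, ((j : ℝ) + 1) • (S (j + 1) - S j)
    push_cast
    rw [show (n : ℝ) + 1 + 1 = n + 2 by ring]
    have h2 : (P / ((n : ℝ) + 1)) • ((n : ℝ) + 1) • (S (n + 1) - S n) = P • (S (n + 1) - S n) := by
      rw [smul_smul, div_mul_cancel₀ _ h1]
    simp only [sub_smul, smul_add] at *
    rw [h2]
    module

/-- Weighted means of a sequence whose weighted increments are bounded approximate the Cesàro
limit at rate `1 / n`, when the averaged weights have small variation. -/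
lemma exists_norm_weighted_mean_sub_le {E : Type*} [NormedAddCommGroup E] [NormedSpace ℝ E]
    (S : ℕ → E) (F : E) (M : ℝ)
    (hT : ∀ k, ‖∑ j ∈ range k, ((j : ℝ) + 1) • (S (j + 1) - S j)‖ ≤ M)
    (hσ : Filter.Tendsto (fun m : ℕ => (1 / ((m : ℝ) + 1)) • ∑ k ∈ range (m + 1), S k)
      Filter.atTop (nhds F))
    (w : ℕ → ℝ) (hw : ∀ k, 0 < w k)
    (hvar : ∃ C : ℝ, ∀ n : ℕ, 1 ≤ n →
      ∑ k ∈ Finset.range n,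
        |(∑ i ∈ Finset.range (k + 1), w i) / ((k : ℝ) + 1) -
          (∑ i ∈ Finset.range (k + 2), w i) / ((k : ℝ) + 2)| ≤
        C * (∑ i ∈ Finset.range (n + 1), w i) / (n : ℝ)) :
    ∃ C : ℝ, ∀ n : ℕ, 1 ≤ n →
      ‖(1 / ∑ k ∈ range (n + 1), w k) • ∑ k ∈ range (n + 1), w k • S k - F‖ ≤ C / (n : ℝ) := by
  obtain ⟨C, hC⟩ := hvar
  have hM : 0 ≤ M := (norm_nonneg _).trans (hT 0)
  refine ⟨M + C * M + 2 * M, fun n hn => ?_⟩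
  have hn' : (0 : ℝ) < n := by exact_mod_cast hn
  have hP : 0 < ∑ k ∈ range (n + 1), w k := sum_pos (fun k _ => hw k) (by simp)
  have hvn := hC n hn
  rw [sum_smul_eq_sub_sum_smul]
  set P := ∑ k ∈ range (n + 1), w k
  set T : ℕ → E := fun k => ∑ j ∈ range k, ((j : ℝ) + 1) • (S (j + 1) - S j) with hTdef
  set D : ℕ → ℝ := fun k => (∑ i ∈ range (k + 1), w i) / ((k : ℝ) + 1) -
          (∑ i ∈ range (k + 2), w i) / ((k : ℝ) + 2)
  change ‖(1 / P) • (P • S n - (P / ((n : ℝ) + 1)) • T n - ∑ k ∈ range n, D k • T (k + 1)) - F‖ ≤ _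
  have e : (1 / P) • (P • S n - (P / ((n : ℝ) + 1)) • T n - ∑ k ∈ range n, D k • T (k + 1)) - F
      = (S n - F) - (1 / ((n : ℝ) + 1)) • T n - (1 / P) • ∑ k ∈ range n, D k • T (k + 1) := by
    rw [smul_sub, smul_sub, smul_smul, smul_smul, one_div_mul_cancel hP.ne', one_smul,
      show 1 / P * (P / ((n : ℝ) + 1)) = 1 / ((n : ℝ) + 1) by field_simp]
    abel
  rw [e]
  have a1 := norm_sub_le_of_cesaro_tendsto S F M hT hσ n
  have a2 : ‖(1 / ((n : ℝ) + 1)) • T n‖ ≤ M / n := by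
    rw [norm_smul, Real.norm_of_nonneg (by positivity), div_eq_mul_one_div M, mul_comm]
    gcongr
    · exact hT n
    · linarith
  have a3 : ‖(1 / P) • ∑ k ∈ range n, D k • T (k + 1)‖ ≤ C * M / n := by
    rw [norm_smul, Real.norm_of_nonneg (by positivity)]
    have : ‖∑ k ∈ range n, D k • T (k + 1)‖ ≤ (C * P / n) * M := by
      calc _ ≤ ∑ k ∈ range n, ‖D k • T (k + 1)‖ := norm_sum_le _ _
        _ ≤ ∑ k ∈ range n, |D k| * M := by
          refine sum_le_sum fun k _ => ?_
          rw [norm_smul, Real.norm_eq_abs]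
          gcongr
          exact hT _
        _ = (∑ k ∈ range n, |D k|) * M := by rw [sum_mul]
        _ ≤ _ := by gcongr
    calc _ ≤ 1 / P * ((C * P / n) * M) := by gcongr
      _ = _ := by field_simp
  have a4 : 2 * M / ((n : ℝ) + 1) ≤ 2 * M / n := by gcongr; linarith
  calc _ ≤ _ := norm_sub_le _ _
    _ ≤ _ := add_le_add_left (norm_sub_le _ _) _
    _ ≤ (2 * M / n + M / n) + C * M / n := by gcongr; exact a1.trans a4
    _ = _ := by ring

/-- Lebesgue measure on one period. -/
noncomputable abbrev periodMeasure : Measure ℝ := volume.restrict (Set.Ioc 0 (2 * π))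

lemma lintegral_Ioc_eq_of_periodic {φ : ℝ → ENNReal} (hφ : Function.Periodic φ (2 * π)) (a b : ℝ) :
    ∫⁻ x in Set.Ioc a (a + 2 * π), φ x = ∫⁻ x in Set.Ioc b (b + 2 * π), φ x := by
  refine (isAddFundamentalDomain_Ioc two_pi_pos a).setLIntegral_eq
    (isAddFundamentalDomain_Ioc two_pi_pos b) φ ?_
  rintro ⟨_, n, rfl⟩ x
  change φ (n • (2 * π) + x) = φ x
  rw [add_comm]
  exact hφ.zsmul n x

lemma lintegral_periodMeasure_add {φ : ℝ → ENNReal} (hφ : Function.Periodic φ (2 * π)) (a : ℝ) :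
    ∫⁻ x, φ (x + a) ∂periodMeasure = ∫⁻ x, φ x ∂periodMeasure := by
  have h := (measurePreserving_add_right (volume : Measure ℝ) a).setLIntegral_comp_preimage_emb
    (measurableEmbedding_addRight a) φ (Set.Ioc a (a + 2 * π))
  have hs : (fun x => x + a) ⁻¹' Set.Ioc a (a + 2 * π) = Set.Ioc 0 (2 * π) := by
    ext x; simp only [Set.mem_preimage, Set.mem_Ioc]
    constructor <;> rintro ⟨h1, h2⟩ <;> constructor <;> linarith
  rw [hs] at h
  rw [periodMeasure, h, lintegral_Ioc_eq_of_periodic hφ a 0, zero_add]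

lemma lintegral_periodMeasure_sub {φ : ℝ → ENNReal} (hφ : Function.Periodic φ (2 * π)) (a : ℝ) :
    ∫⁻ x, φ (a - x) ∂periodMeasure = ∫⁻ x, φ x ∂periodMeasure := by
  have h := (Measure.measurePreserving_sub_left
    (volume : Measure ℝ) a).setLIntegral_comp_preimage_emb
    (MeasurableEquiv.subLeft a).measurableEmbedding φ (Set.Ico (a - 2 * π) (a - 2 * π + 2 * π))
  have hs : (fun x => a - x) ⁻¹' Set.Ico (a - 2 * π) (a - 2 * π + 2 * π) = Set.Ioc 0 (2 * π) := by
    ext x; simp only [Set.mem_preimage, Set.mem_Ioc, Set.mem_Ico]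
    constructor <;> rintro ⟨h1, h2⟩ <;> constructor <;> linarith
  rw [hs] at h
  rw [periodMeasure, h, restrict_Ico_eq_restrict_Ioc, lintegral_Ioc_eq_of_periodic hφ _ 0,
    zero_add]

/-- Jensen's inequality for a weight `k` of arbitrary mass. -/
lemma lintegral_mul_rpow_le {α : Type*} [MeasurableSpace α] {ν : Measure α} {p : ℝ} (hp : 1 < p)
    {φ k : α → ENNReal} (hφ : AEMeasurable φ ν) (hk : AEMeasurable k ν) :
    (∫⁻ t, φ t * k t ∂ν) ^ p ≤ (∫⁻ t, k t ∂ν) ^ (p - 1) * ∫⁻ t, φ t ^ p * k t ∂ν := by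
  have hp0 : 0 < p := by linarith
  have hpq := Real.HolderConjugate.conjExponent hp
  set q := p.conjExponent
  have hq0 : 0 < q := hpq.symm.pos
  have h := ENNReal.lintegral_mul_le_Lp_mul_Lq ν hpq
    (hφ.mul (hk.pow_const (1 / p))) (hk.pow_const (1 / q))
  have e1 : ∀ t, ((φ * fun x => k x ^ (1 / p)) * fun x => k x ^ (1 / q)) t = φ t * k t := by
    intro t
    simp only [Pi.mul_apply]
    rw [mul_assoc, ← ENNReal.rpow_add_of_nonneg _ _ (by positivity) (by positivity),
      one_div, one_div, hpq.inv_add_inv_eq_one, ENNReal.rpow_one]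
  have e2 : ∀ t, (φ * fun x => k x ^ (1 / p)) t ^ p = φ t ^ p * k t := by
    intro t
    simp only [Pi.mul_apply]
    rw [ENNReal.mul_rpow_of_nonneg _ _ hp0.le, ← ENNReal.rpow_mul, one_div_mul_cancel hp0.ne',
      ENNReal.rpow_one]
  have e3 : ∀ t, (k t ^ (1 / q)) ^ q = k t := by
    intro t
    rw [← ENNReal.rpow_mul, one_div_mul_cancel hq0.ne', ENNReal.rpow_one]
  simp only [e1, e2, e3] at h
  calc _ ≤ _ := ENNReal.rpow_le_rpow h hp0.le
    _ = _ := by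
      rw [ENNReal.mul_rpow_of_nonneg _ _ hp0.le, ← ENNReal.rpow_mul, ← ENNReal.rpow_mul,
        one_div_mul_cancel hp0.ne', ENNReal.rpow_one, mul_comm]
      congr 2
      have : (p - 1) * q = p := hpq.sub_one_mul_conj
      field_simp
      linarith

lemma eLpNorm_ofReal_eq {α : Type*} [MeasurableSpace α] {ν : Measure α} {p : ℝ} (hp : 0 < p)
    (g : α → ℝ) :
    eLpNorm g (ENNReal.ofReal p) ν = (∫⁻ x, ‖g x‖ₑ ^ p ∂ν) ^ (1 / p) := by
  rw [eLpNorm_eq_lintegral_rpow_enorm_toReal (by simpa using hp) ENNReal.ofReal_ne_top,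
    ENNReal.toReal_ofReal hp.le]

/-- Schur's test. -/
lemma eLpNorm_integral_kernel_le {α β : Type*} [MeasurableSpace α] [MeasurableSpace β]
    {μ : Measure α} {ν : Measure β} [SFinite μ] [SFinite ν] {p : ℝ} (hp : 1 < p)
    {K : α → β → ℝ} (hK : Measurable (Function.uncurry K)) {m : ENNReal}
    (h₁ : ∀ x, ∫⁻ t, ‖K x t‖ₑ ∂ν ≤ m) (h₂ : ∀ t, ∫⁻ x, ‖K x t‖ₑ ∂μ ≤ m)
    {g : β → ℝ} (hg : AEStronglyMeasurable g ν) :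
    eLpNorm (fun x => ∫ t, K x t * g t ∂ν) (ENNReal.ofReal p) μ ≤
      m * eLpNorm g (ENNReal.ofReal p) ν := by
  have hp0 : 0 < p := by linarith
  rw [eLpNorm_ofReal_eq hp0, eLpNorm_ofReal_eq hp0]
  have hKx : ∀ x, Measurable (K x) := fun x => hK.comp measurable_prodMk_left
  have step : ∫⁻ x, ‖∫ t, K x t * g t ∂ν‖ₑ ^ p ∂μ ≤ m ^ p * ∫⁻ t, ‖g t‖ₑ ^ p ∂ν := by
    calc ∫⁻ x, ‖∫ t, K x t * g t ∂ν‖ₑ ^ p ∂μ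
        ≤ ∫⁻ x, m ^ (p - 1) * ∫⁻ t, ‖g t‖ₑ ^ p * ‖K x t‖ₑ ∂ν ∂μ := by
          refine lintegral_mono fun x => ?_
          calc ‖∫ t, K x t * g t ∂ν‖ₑ ^ p ≤ (∫⁻ t, ‖g t‖ₑ * ‖K x t‖ₑ ∂ν) ^ p := by
                gcongr
                refine (enorm_integral_le_lintegral_enorm _).trans_eq ?_
                simp only [enorm_mul, mul_comm]
            _ ≤ _ := lintegral_mul_rpow_le hp hg.enorm (hKx x).enorm.aemeasurable
            _ ≤ _ := by
                gcongr
                exact h₁ x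
      _ ≤ m ^ (p - 1) * ∫⁻ x, ∫⁻ t, ‖g t‖ₑ ^ p * ‖K x t‖ₑ ∂ν ∂μ := by
          rw [lintegral_const_mul'']
          refine AEMeasurable.lintegral_prod_right'
            (f := fun z : α × β => ‖g z.2‖ₑ ^ p * ‖K z.1 z.2‖ₑ) ?_
          exact ((hg.enorm.pow_const p).comp_snd).mul hK.enorm.aemeasurable
      _ = m ^ (p - 1) * ∫⁻ t, ∫⁻ x, ‖g t‖ₑ ^ p * ‖K x t‖ₑ ∂μ ∂ν := by
          rw [lintegral_lintegral_swap]
          exact ((hg.enorm.pow_const p).comp_snd).mul hK.enorm.aemeasurable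
      _ ≤ m ^ (p - 1) * ∫⁻ t, ‖g t‖ₑ ^ p * m ∂ν := by
          gcongr with t
          have hKt : Measurable fun x => K x t := hK.comp measurable_prodMk_right
          rw [lintegral_const_mul _ hKt.enorm]
          gcongr
          exact h₂ t
      _ = _ := by
          rw [lintegral_mul_const'' _ (hg.enorm.pow_const p)]
          have : m ^ p = m ^ (p - 1) * m := by
            conv_rhs => rw [← ENNReal.rpow_one m, ← ENNReal.rpow_mul,
              ← ENNReal.rpow_add_of_nonneg _ _ (by linarith) (by norm_num)]
            simp
          rw [this]; ring
  calc _ ≤ _ := ENNReal.rpow_le_rpow step (by positivity)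
    _ = _ := by
      rw [ENNReal.mul_rpow_of_nonneg _ _ (by positivity), ← ENNReal.rpow_mul,
        mul_one_div_cancel hp0.ne', ENNReal.rpow_one]

/-- Convolution over one period. -/
noncomputable def periodConv (k g : ℝ → ℝ) (x : ℝ) : ℝ := ∫ t, k (x - t) * g t ∂periodMeasure

/-- Young's inequality over one period. -/
lemma eLpNorm_periodConv_le {p : ℝ} (hp : 1 < p) {k : ℝ → ℝ} (hk : Measurable k)
    (hper : Function.Periodic k (2 * π)) {g : ℝ → ℝ} (hg : AEStronglyMeasurable g periodMeasure) :
    eLpNorm (periodConv k g) (ENNReal.ofReal p) periodMeasure ≤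
      (∫⁻ x, ‖k x‖ₑ ∂periodMeasure) * eLpNorm g (ENNReal.ofReal p) periodMeasure := by
  have hper' : Function.Periodic (fun x => ‖k x‖ₑ) (2 * π) := fun x => by simp only [hper x]
  refine eLpNorm_integral_kernel_le hp (K := fun x t => k (x - t))
    (hk.comp (measurable_fst.sub measurable_snd)) (fun x => ?_) (fun t => ?_) hg
  · exact (lintegral_periodMeasure_sub hper' x).le
  · simpa only [sub_eq_add_neg] using (lintegral_periodMeasure_add hper' (-t)).le

lemma aestronglyMeasurable_periodConv {k : ℝ → ℝ} (hk : Measurable k)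
    {g : ℝ → ℝ} (hg : AEStronglyMeasurable g periodMeasure) (μ : Measure ℝ) [SFinite μ] :
    AEStronglyMeasurable (periodConv k g) μ := by
  refine AEStronglyMeasurable.integral_prod_right' (f := fun z : ℝ × ℝ => k (z.1 - z.2) * g z.2) ?_
  exact (hk.comp (measurable_fst.sub measurable_snd)).aestronglyMeasurable.mul hg.comp_snd

lemma exists_one_le_cos_rpow_sub_cos_mul {p : ℝ} (hp : 1 < p) (hp2 : p ≤ 2) :
    ∃ A B : ℝ, 0 ≤ A ∧ 0 ≤ B ∧ ∀ θ : ℝ, |θ| < π / 2 →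
      1 ≤ A * cos θ ^ p - B * cos (θ * p) := by
  have hpi := pi_pos
  have hp0 : 0 < p := by linarith
  set θ₀ : ℝ := π / 4 * (1 + 1 / p) with hθ₀
  have hpθ : p * θ₀ = π / 4 * (p + 1) := by rw [hθ₀]; field_simp
  have hinv : 1 / p < 1 := by rw [div_lt_one hp0]; exact hp
  have hinv0 : 0 < 1 / p := by positivity
  have hθ₀pos : 0 < θ₀ := by positivity
  have hθ₀lt : θ₀ < π / 2 := by rw [hθ₀]; nlinarith
  have hc : cos (p * θ₀) < 0 := by
    apply cos_neg_of_pi_div_two_lt_of_lt <;> rw [hpθ] <;> nlinarith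
  have hm : 0 < cos θ₀ := cos_pos_of_mem_Ioo ⟨by linarith, hθ₀lt⟩
  set B : ℝ := 1 / (-cos (p * θ₀)) with hB
  have hB0 : 0 ≤ B := by
    have : 0 < -cos (p * θ₀) := by linarith
    positivity
  refine ⟨(1 + B) / cos θ₀ ^ p, B, by positivity, hB0, fun θ hθ => ?_⟩
  have hcθ : 0 < cos θ := cos_pos_of_mem_Ioo (abs_lt.1 hθ)
  have habs : cos (θ * p) = cos (p * |θ|) := by
    rw [← cos_abs (θ * p), abs_mul, abs_of_pos hp0, mul_comm]
  rcases le_total θ₀ |θ| with h | h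
  · have h1 : cos (θ * p) ≤ cos (p * θ₀) := by
      rw [habs]
      apply cos_le_cos_of_nonneg_of_le_pi (by positivity)
      · nlinarith
      · gcongr
    have h2 : 1 = B * (-cos (p * θ₀)) := by
      rw [hB, one_div_mul_cancel (by linarith)]
    have h3 : B * (-cos (p * θ₀)) ≤ B * (-cos (θ * p)) := by gcongr
    have h4 : 0 ≤ (1 + B) / cos θ₀ ^ p * cos θ ^ p := by positivity
    linarith
  · have h1 : cos θ₀ ≤ cos θ := by
      rw [← cos_abs θ]
      exact cos_le_cos_of_nonneg_of_le_pi (abs_nonneg _) (by linarith) h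
    have h2 : 1 + B ≤ (1 + B) / cos θ₀ ^ p * cos θ ^ p := by
      rw [div_mul_eq_mul_div, le_div_iff₀ (by positivity)]
      gcongr
    have h3 : B * cos (θ * p) ≤ B := by
      have := cos_le_one (θ * p)
      nlinarith
    linarith

/-- The pointwise inequality behind the theorem of M. Riesz on conjugate functions. -/
lemma exists_norm_rpow_le_re_rpow_sub {p : ℝ} (hp : 1 < p) (hp2 : p ≤ 2) :
    ∃ A B : ℝ, 0 ≤ A ∧ 0 ≤ B ∧ ∀ z : ℂ, 0 < z.re →
      ‖z‖ ^ p ≤ A * z.re ^ p - B * (z ^ (p : ℂ)).re := by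
  obtain ⟨A, B, hA, hB, h⟩ := exists_one_le_cos_rpow_sub_cos_mul hp hp2
  refine ⟨A, B, hA, hB, fun z hz => ?_⟩
  have hθ : |z.arg| < π / 2 := Complex.abs_arg_lt_pi_div_two_iff.2 (Or.inl hz)
  have hcos : 0 ≤ cos z.arg := (cos_pos_of_mem_Ioo (abs_lt.1 hθ)).le
  rw [Complex.cpow_ofReal_re]
  have hre : z.re ^ p = ‖z‖ ^ p * cos z.arg ^ p := by
    rw [← Real.mul_rpow (norm_nonneg _) hcos, Complex.norm_mul_cos_arg]
  rw [hre]
  have h1 := mul_le_mul_of_nonneg_left (h _ hθ) (by positivity : 0 ≤ ‖z‖ ^ p)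
  linarith

/-- The Poisson kernel of the unit disc. -/
noncomputable def poissonKer (r u : ℝ) : ℝ := (1 - r ^ 2) / (1 - 2 * r * cos u + r ^ 2)

/-- The conjugate Poisson kernel of the unit disc. -/
noncomputable def conjPoissonKer (r u : ℝ) : ℝ := 2 * r * sin u / (1 - 2 * r * cos u + r ^ 2)

lemma poisson_denom_pos {r : ℝ} (hr0 : 0 ≤ r) (hr1 : r < 1) (u : ℝ) :
    0 < 1 - 2 * r * cos u + r ^ 2 := by
  nlinarith [cos_le_one u, sq_nonneg (1 - r), mul_nonneg hr0 (sub_nonneg.2 (cos_le_one u)),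
    mul_pos (sub_pos.2 hr1) (sub_pos.2 hr1)]

lemma continuous_poissonKer {r : ℝ} (hr0 : 0 ≤ r) (hr1 : r < 1) : Continuous (poissonKer r) :=
  Continuous.div (by fun_prop) (by fun_prop) fun u => (poisson_denom_pos hr0 hr1 u).ne'

lemma continuous_conjPoissonKer {r : ℝ} (hr0 : 0 ≤ r) (hr1 : r < 1) :
    Continuous (conjPoissonKer r) :=
  Continuous.div (by fun_prop) (by fun_prop) fun u => (poisson_denom_pos hr0 hr1 u).ne'

lemma periodic_poissonKer (r : ℝ) : Function.Periodic (poissonKer r) (2 * π) := fun u => by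
  simp [poissonKer]

lemma periodic_conjPoissonKer (r : ℝ) : Function.Periodic (conjPoissonKer r) (2 * π) := fun u => by
  simp [conjPoissonKer]

lemma one_add_div_one_sub_eq {r : ℝ} (hr0 : 0 ≤ r) (hr1 : r < 1) (u : ℝ) :
    (1 + r * Complex.exp (u * Complex.I)) / (1 - r * Complex.exp (u * Complex.I)) =
      (poissonKer r u : ℂ) + conjPoissonKer r u * Complex.I := by
  have hd := poisson_denom_pos hr0 hr1 u
  have hd' : ((1 - 2 * r * cos u + r ^ 2 : ℝ) : ℂ) ≠ 0 := by exact_mod_cast hd.ne'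
  have hexp : Complex.exp (u * Complex.I) = (cos u : ℂ) + (sin u : ℂ) * Complex.I := by
    rw [Complex.exp_mul_I]; simp
  have hs : ((sin u : ℝ) : ℂ) ^ 2 + ((cos u : ℝ) : ℂ) ^ 2 = 1 := by
    exact_mod_cast sin_sq_add_cos_sq u
  have hprod : (1 - r * Complex.exp (u * Complex.I)) *
      (1 - r * ((cos u : ℂ) - (sin u : ℂ) * Complex.I)) =
        ((1 - 2 * r * cos u + r ^ 2 : ℝ) : ℂ) := by
    rw [hexp]; push_cast at hs ⊢
    linear_combination (r : ℂ) ^ 2 * hs - (r : ℂ) ^ 2 * Complex.sin u ^ 2 * Complex.I_sq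
  have hne : 1 - r * Complex.exp (u * Complex.I) ≠ 0 := by
    intro h0; rw [h0, zero_mul] at hprod; exact hd' hprod.symm
  rw [div_eq_iff hne]
  have hk : (poissonKer r u : ℂ) + conjPoissonKer r u * Complex.I =
      (((1 - r ^ 2 : ℝ) : ℂ) + ((2 * r * sin u : ℝ) : ℂ) * Complex.I) /
        ((1 - 2 * r * cos u + r ^ 2 : ℝ) : ℂ) := by
    simp only [poissonKer, conjPoissonKer, Complex.ofReal_div]
    ring
  rw [hk, div_mul_eq_mul_div, eq_div_iff hd', hexp]
  push_cast at hs ⊢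
  linear_combination (-2 * (r : ℂ) ^ 2) * hs + 2 * (r : ℂ) ^ 2 * Complex.sin u ^ 2 * Complex.I_sq

/-- The Herglotz integral of `g`, an analytic function on the unit disc. -/
noncomputable def herglotzInt (g : ℝ → ℝ) (z : ℂ) : ℂ :=
  ∫ t, (g t : ℂ) * ((1 + z * Complex.exp ((-t : ℝ) * Complex.I)) /
    (1 - z * Complex.exp ((-t : ℝ) * Complex.I))) ∂periodMeasure

lemma one_sub_norm_le_norm_one_sub_mul_exp (z : ℂ) (t : ℝ) :
    1 - ‖z‖ ≤ ‖1 - z * Complex.exp (t * Complex.I)‖ := by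
  have := norm_sub_norm_le (1 : ℂ) (z * Complex.exp (t * Complex.I))
  rwa [norm_one, norm_mul, Complex.norm_exp_ofReal_mul_I, mul_one] at this

lemma one_sub_mul_exp_ne_zero {z : ℂ} (hz : ‖z‖ < 1) (t : ℝ) :
    1 - z * Complex.exp (t * Complex.I) ≠ 0 := by
  rw [← norm_pos_iff]
  exact lt_of_lt_of_le (by linarith) (one_sub_norm_le_norm_one_sub_mul_exp z t)

lemma continuous_herglotz_kernel {z : ℂ} (hz : ‖z‖ < 1) :
    Continuous fun t : ℝ => (1 + z * Complex.exp ((-t : ℝ) * Complex.I)) /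
      (1 - z * Complex.exp ((-t : ℝ) * Complex.I)) :=
  Continuous.div (by fun_prop) (by fun_prop) fun _ => one_sub_mul_exp_ne_zero hz _

lemma norm_herglotz_kernel_le {z : ℂ} (hz : ‖z‖ < 1) (t : ℝ) :
    ‖(1 + z * Complex.exp (t * Complex.I)) / (1 - z * Complex.exp (t * Complex.I))‖ ≤
      2 / (1 - ‖z‖) := by
  rw [norm_div]
  have h1 : ‖1 + z * Complex.exp (t * Complex.I)‖ ≤ 2 := by
    refine (norm_add_le _ _).trans ?_
    rw [norm_one, norm_mul, Complex.norm_exp_ofReal_mul_I, mul_one]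
    linarith
  have h2 := one_sub_norm_le_norm_one_sub_mul_exp z t
  have h3 : 0 < 1 - ‖z‖ := by linarith
  gcongr

lemma integrable_herglotz {g : ℝ → ℝ} (hg : Integrable g periodMeasure) {z : ℂ} (hz : ‖z‖ < 1) :
    Integrable (fun t => (g t : ℂ) * ((1 + z * Complex.exp ((-t : ℝ) * Complex.I)) /
      (1 - z * Complex.exp ((-t : ℝ) * Complex.I)))) periodMeasure :=
  hg.ofReal.mul_bdd (continuous_herglotz_kernel hz).aestronglyMeasurable
    (Filter.Eventually.of_forall fun _ => norm_herglotz_kernel_le hz _)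

lemma differentiableAt_herglotzInt {g : ℝ → ℝ} (hg : Integrable g periodMeasure) {z₀ : ℂ}
    (hz₀ : ‖z₀‖ < 1) : DifferentiableAt ℂ (herglotzInt g) z₀ := by
  set ρ := (1 + ‖z₀‖) / 2 with hρ
  have hρ1 : ρ < 1 := by rw [hρ]; linarith
  have hmem : Metric.ball (0 : ℂ) ρ ∈ nhds z₀ :=
    Metric.isOpen_ball.mem_nhds (by rw [mem_ball_zero_iff, hρ]; linarith)
  have hball : ∀ z ∈ Metric.ball (0 : ℂ) ρ, ‖z‖ < ρ := fun z hz => by simpa using hz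
  refine (hasDerivAt_integral_of_dominated_loc_of_deriv_le (μ := periodMeasure) hmem
    (F := fun z t => (g t : ℂ) * ((1 + z * Complex.exp ((-t : ℝ) * Complex.I)) /
      (1 - z * Complex.exp ((-t : ℝ) * Complex.I))))
    (F' := fun z t => (g t : ℂ) * (2 * Complex.exp ((-t : ℝ) * Complex.I) /
      (1 - z * Complex.exp ((-t : ℝ) * Complex.I)) ^ 2))
    (bound := fun t => |g t| * (2 / (1 - ρ) ^ 2)) ?_ ?_ ?_ ?_ ?_ ?_).2.differentiableAt
  · filter_upwards [hmem] with z hz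
    exact (integrable_herglotz hg ((hball z hz).trans hρ1)).aestronglyMeasurable
  · exact integrable_herglotz hg hz₀
  · refine hg.ofReal.aestronglyMeasurable.mul (Continuous.aestronglyMeasurable ?_)
    exact Continuous.div (by fun_prop) (by fun_prop)
      fun t => pow_ne_zero _ (one_sub_mul_exp_ne_zero hz₀ _)
  · refine Filter.Eventually.of_forall fun t z hz => ?_
    have hz' := hball z hz
    have h2 := one_sub_norm_le_norm_one_sub_mul_exp z (-t)
    have h3 : 0 < 1 - ρ := by linarith
    rw [norm_mul, norm_div, norm_mul, norm_pow, Complex.norm_exp_ofReal_mul_I, Complex.norm_real,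
      Real.norm_eq_abs, mul_one, Complex.norm_ofNat]
    gcongr
    linarith
  · exact hg.abs.mul_const _
  · refine Filter.Eventually.of_forall fun t z hz => ?_
    have hne := one_sub_mul_exp_ne_zero ((hball z hz).trans hρ1) (-t)
    refine HasDerivAt.const_mul _ ?_
    set e := Complex.exp ((-t : ℝ) * Complex.I)
    have h1 : HasDerivAt (fun z : ℂ => 1 + z * e) e z := by
      simpa using ((hasDerivAt_id z).mul_const e).const_add 1
    have h2 : HasDerivAt (fun z : ℂ => 1 - z * e) (-e) z := by
      simpa using ((hasDerivAt_id z).mul_const e).const_sub 1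
    refine (h1.div h2 hne).congr_deriv ?_
    congr 1
    ring

lemma herglotzInt_zero (g : ℝ → ℝ) : herglotzInt g 0 = ((∫ t, g t ∂periodMeasure : ℝ) : ℂ) := by
  simp only [herglotzInt, zero_mul, add_zero, sub_zero, div_one, mul_one]
  exact integral_ofReal

lemma herglotzInt_circle {g : ℝ → ℝ} (hg : Integrable g periodMeasure) {r : ℝ} (hr0 : 0 ≤ r)
    (hr1 : r < 1) (x : ℝ) :
    herglotzInt g (r * Complex.exp (x * Complex.I)) =
      (periodConv (poissonKer r) g x : ℂ) + periodConv (conjPoissonKer r) g x * Complex.I := by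
  have hker : ∀ t : ℝ, (g t : ℂ) * ((1 + r * Complex.exp (x * Complex.I) *
      Complex.exp ((-t : ℝ) * Complex.I)) / (1 - r * Complex.exp (x * Complex.I) *
        Complex.exp ((-t : ℝ) * Complex.I))) =
      ((poissonKer r (x - t) * g t : ℝ) : ℂ) +
        ((conjPoissonKer r (x - t) * g t : ℝ) : ℂ) * Complex.I := by
    intro t
    rw [mul_assoc, ← Complex.exp_add, ← add_mul, ← Complex.ofReal_add, ← sub_eq_add_neg,
      one_add_div_one_sub_eq hr0 hr1]
    push_cast
    ring
  have hz : ‖(r : ℂ) * Complex.exp (x * Complex.I)‖ < 1 := by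
    rw [norm_mul, Complex.norm_exp_ofReal_mul_I, mul_one, Complex.norm_real,
      Real.norm_of_nonneg hr0]
    exact hr1
  have hint := integrable_herglotz hg hz
  simp only [hker] at hint
  have hre : Integrable (fun t => poissonKer r (x - t) * g t) periodMeasure := by
    simpa using hint.re
  have him : Integrable (fun t => conjPoissonKer r (x - t) * g t) periodMeasure := by
    simpa using hint.im
  simp only [herglotzInt, hker]
  rw [integral_add hre.ofReal (him.ofReal.mul_const _), integral_mul_const]
  simp only [periodConv, integral_complex_ofReal]

lemma herglotzInt_re_pos {g : ℝ → ℝ} (hg : Integrable g periodMeasure) (hg0 : ∀ t, 0 ≤ g t)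
    (hpos : 0 < ∫ t, g t ∂periodMeasure) {z : ℂ} (hz : ‖z‖ < 1) : 0 < (herglotzInt g z).re := by
  have hint := integrable_herglotz hg hz
  have hre : (herglotzInt g z).re = ∫ t, g t * ((1 + z * Complex.exp ((-t : ℝ) * Complex.I)) /
      (1 - z * Complex.exp ((-t : ℝ) * Complex.I))).re ∂periodMeasure := by
    rw [herglotzInt, ← RCLike.re_eq_complex_re, ← integral_re hint]
    refine integral_congr_ae (Filter.Eventually.of_forall fun t => ?_)
    exact Complex.re_ofReal_mul _ _
  have hint' : Integrable (fun t => g t * ((1 + z * Complex.exp ((-t : ℝ) * Complex.I)) /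
      (1 - z * Complex.exp ((-t : ℝ) * Complex.I))).re) periodMeasure := by
    refine hint.re.congr (Filter.Eventually.of_forall fun t => ?_)
    exact Complex.re_ofReal_mul _ _
  have hker : ∀ t : ℝ, (1 - ‖z‖ ^ 2) / 4 ≤ ((1 + z * Complex.exp ((-t : ℝ) * Complex.I)) /
      (1 - z * Complex.exp ((-t : ℝ) * Complex.I))).re := by
    intro t
    have hne := one_sub_mul_exp_ne_zero hz (-t)
    have hnw : ‖z * Complex.exp ((-t : ℝ) * Complex.I)‖ = ‖z‖ := by
      rw [norm_mul, Complex.norm_exp_ofReal_mul_I, mul_one]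
    set v := z * Complex.exp ((-t : ℝ) * Complex.I)
    have hle : Complex.normSq (1 - v) ≤ 4 := by
      rw [Complex.normSq_eq_norm_sq]
      have : ‖1 - v‖ ≤ 2 := by
        refine (norm_sub_le _ _).trans ?_
        rw [norm_one, hnw]; linarith
      nlinarith [norm_nonneg (1 - v)]
    have hp : 0 < Complex.normSq (1 - v) := Complex.normSq_pos.2 hne
    have : ((1 + v) / (1 - v)).re = (1 - ‖z‖ ^ 2) / Complex.normSq (1 - v) := by
      rw [← hnw, ← Complex.normSq_eq_norm_sq, Complex.div_re, ← add_div]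
      congr 1
      simp [Complex.normSq_apply]
      ring
    rw [this]
    have : 0 ≤ 1 - ‖z‖ ^ 2 := by nlinarith [norm_nonneg z]
    gcongr
  rw [hre]
  calc 0 < (∫ t, g t ∂periodMeasure) * ((1 - ‖z‖ ^ 2) / 4) := by
        have : 0 < 1 - ‖z‖ ^ 2 := by nlinarith [norm_nonneg z]
        positivity
    _ = ∫ t, g t * ((1 - ‖z‖ ^ 2) / 4) ∂periodMeasure := by rw [integral_mul_const]
    _ ≤ _ := integral_mono (hg.mul_const _) hint'
        fun t => mul_le_mul_of_nonneg_left (hker t) (hg0 t)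

lemma integrable_periodMeasure_of_continuous {E : Type*} [NormedAddCommGroup E] {φ : ℝ → E}
    (hφ : Continuous φ) : Integrable φ periodMeasure :=
  hφ.integrableOn_Ioc

lemma memLp_periodMeasure_of_continuous {φ : ℝ → ℝ} (hφ : Continuous φ) (q : ENNReal) :
    MemLp φ q periodMeasure := by
  obtain ⟨C, hC⟩ := isCompact_Icc.exists_bound_of_continuousOn
    (hφ.continuousOn (s := Set.Icc 0 (2 * π)))
  refine MemLp.of_bound hφ.aestronglyMeasurable C ?_
  filter_upwards [ae_restrict_mem measurableSet_Ioc] with x hx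
  exact hC x (Set.Ioc_subset_Icc_self hx)

lemma MeasureTheory.MemLp.integrable_periodMeasure {p : ℝ} (hp : 1 < p) {g : ℝ → ℝ}
    (hg : MemLp g (ENNReal.ofReal p) periodMeasure) : Integrable g periodMeasure :=
  hg.integrable (by rw [← ENNReal.ofReal_one]; exact ENNReal.ofReal_le_ofReal hp.le)

lemma integrable_continuous_mul {k g : ℝ → ℝ} (hk : Continuous k)
    (hg : Integrable g periodMeasure) : Integrable (fun t => k t * g t) periodMeasure := by
  obtain ⟨C, hC⟩ := isCompact_Icc.exists_bound_of_continuousOn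
    (hk.continuousOn (s := Set.Icc 0 (2 * π)))
  refine hg.bdd_mul (c := C) hk.aestronglyMeasurable ?_
  filter_upwards [ae_restrict_mem measurableSet_Ioc] with x hx
  exact hC x (Set.Ioc_subset_Icc_self hx)

lemma integral_circle_eq {H : ℂ → ℂ} (hH : ∀ z, ‖z‖ < 1 → DifferentiableAt ℂ H z) {r : ℝ}
    (hr0 : 0 ≤ r) (hr1 : r < 1) :
    ∫ x : ℝ, H (r * Complex.exp (x * Complex.I)) ∂periodMeasure = (2 * π : ℝ) * H 0 := by
  have hball : ∀ z ∈ closure (Metric.ball (0 : ℂ) |r|), ‖z‖ < 1 := fun z hz => by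
    have := Metric.closure_ball_subset_closedBall hz
    rw [mem_closedBall_zero_iff, abs_of_nonneg hr0] at this
    linarith
  have hd : DiffContOnCl ℂ H (Metric.ball 0 |r|) :=
    DifferentiableOn.diffContOnCl fun z hz => (hH z (hball z hz)).differentiableWithinAt
  have h := hd.circleAverage
  rw [circleAverage_def, intervalIntegral.integral_of_le two_pi_pos.le,
    inv_smul_eq_iff₀ two_pi_pos.ne'] at h
  simpa [circleMap, Complex.real_smul] using h

lemma poissonKer_nonneg {r : ℝ} (hr0 : 0 ≤ r) (hr1 : r < 1) (u : ℝ) : 0 ≤ poissonKer r u :=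
  div_nonneg (by nlinarith) (poisson_denom_pos hr0 hr1 u).le

lemma lintegral_enorm_poissonKer {r : ℝ} (hr0 : 0 ≤ r) (hr1 : r < 1) :
    ∫⁻ x, ‖poissonKer r x‖ₑ ∂periodMeasure = ENNReal.ofReal (2 * π) := by
  have hint := integrable_periodMeasure_of_continuous (continuous_poissonKer hr0 hr1)
  have hint' := integrable_periodMeasure_of_continuous (continuous_conjPoissonKer hr0 hr1)
  have h := integral_circle_eq (H := fun z => (1 + z) / (1 - z)) (fun z hz => by
    refine DifferentiableAt.div (by fun_prop) (by fun_prop) fun h => ?_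
    rw [sub_eq_zero] at h
    rw [← h, norm_one] at hz
    exact lt_irrefl _ hz) hr0 hr1
  simp only [one_add_div_one_sub_eq hr0 hr1] at h
  rw [integral_add hint.ofReal (hint'.ofReal.mul_const _), integral_mul_const,
    integral_complex_ofReal, integral_complex_ofReal] at h
  have h' := congrArg Complex.re h
  simp at h'
  rw [← ofReal_integral_norm_eq_lintegral_enorm hint]
  simp only [Real.norm_of_nonneg (poissonKer_nonneg hr0 hr1 _), h']

lemma eLpNorm_conjPoisson_le_of_nonneg {p A B : ℝ} (hp : 1 < p) (hA : 0 ≤ A) (hB : 0 ≤ B)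
    (hAB : ∀ z : ℂ, 0 < z.re → ‖z‖ ^ p ≤ A * z.re ^ p - B * (z ^ (p : ℂ)).re)
    {r : ℝ} (hr0 : 0 ≤ r) (hr1 : r < 1) {g : ℝ → ℝ}
    (hg : MemLp g (ENNReal.ofReal p) periodMeasure) (hg0 : ∀ t, 0 ≤ g t) :
    eLpNorm (periodConv (conjPoissonKer r) g) (ENNReal.ofReal p) periodMeasure ≤
      ENNReal.ofReal (A ^ (1 / p)) * ENNReal.ofReal (2 * π) *
        eLpNorm g (ENNReal.ofReal p) periodMeasure := by
  have hp0 : 0 < p := by linarith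
  have hgi := hg.integrable_periodMeasure hp
  rcases (integral_nonneg hg0 : 0 ≤ ∫ t, g t ∂periodMeasure).eq_or_lt with h0 | hpos
  · have hz : g =ᵐ[periodMeasure] 0 := (integral_eq_zero_iff_of_nonneg hg0 hgi).1 h0.symm
    have : periodConv (conjPoissonKer r) g = 0 := by
      funext x
      refine integral_eq_zero_of_ae ?_
      filter_upwards [hz] with t ht
      simp [ht]
    simp [this]
  set z : ℝ → ℂ := fun x => r * Complex.exp (x * Complex.I)
  have hz : ∀ x, ‖z x‖ < 1 := fun x => by
    simp only [z]
    rw [norm_mul, Complex.norm_exp_ofReal_mul_I, mul_one, Complex.norm_real,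
      Real.norm_of_nonneg hr0]
    exact hr1
  have hzc : Continuous z := by fun_prop
  have hre : ∀ {w : ℂ}, ‖w‖ < 1 → 0 < (herglotzInt g w).re := herglotzInt_re_pos hgi hg0 hpos
  have hd : ∀ w : ℂ, ‖w‖ < 1 →
      DifferentiableAt ℂ (fun w => herglotzInt g w ^ (p : ℂ)) w := fun w hw =>
    (differentiableAt_herglotzInt hgi hw).cpow_const (Or.inl (hre hw))
  have hmv := integral_circle_eq hd hr0 hr1
  have hHc : Continuous fun x => herglotzInt g (z x) ^ (p : ℂ) :=
    continuous_iff_continuousAt.2 fun x =>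
      (hd _ (hz x)).continuousAt.comp hzc.continuousAt
  have hGc : Continuous fun x => herglotzInt g (z x) :=
    continuous_iff_continuousAt.2 fun x =>
      (differentiableAt_herglotzInt hgi (hz x)).continuousAt.comp hzc.continuousAt
  have hG : ∀ x, herglotzInt g (z x) = (periodConv (poissonKer r) g x : ℂ) +
      periodConv (conjPoissonKer r) g x * Complex.I := herglotzInt_circle hgi hr0 hr1
  have hP : ∀ x, (herglotzInt g (z x)).re = periodConv (poissonKer r) g x := fun x => by
    simp [hG x]
  have hQ : ∀ x, (herglotzInt g (z x)).im = periodConv (conjPoissonKer r) g x := fun x => by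
    simp [hG x]
  have hPc : Continuous (periodConv (poissonKer r) g) :=
    (Complex.continuous_re.comp hGc).congr hP
  have hQc : Continuous (periodConv (conjPoissonKer r) g) :=
    (Complex.continuous_im.comp hGc).congr hQ
  have hnonneg : 0 ≤ ∫ x, (herglotzInt g (z x) ^ (p : ℂ)).re ∂periodMeasure := by
    have h1 := integral_re (integrable_periodMeasure_of_continuous hHc)
    simp only [RCLike.re_eq_complex_re] at h1
    rw [h1, hmv, herglotzInt_zero, Complex.re_ofReal_mul, ← Complex.ofReal_cpow hpos.le,
      Complex.ofReal_re]
    positivity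
  have hcp : ∀ {φ : ℝ → ℝ}, Continuous φ → Integrable (fun x => |φ x| ^ p) periodMeasure :=
    fun hφ => integrable_periodMeasure_of_continuous
      (hφ.abs.rpow_const fun _ => Or.inr hp0.le)
  have hHi : Integrable (fun x => (herglotzInt g (z x) ^ (p : ℂ)).re) periodMeasure :=
    integrable_periodMeasure_of_continuous (Complex.continuous_re.comp hHc)
  have hkey : ∫ x, |periodConv (conjPoissonKer r) g x| ^ p ∂periodMeasure ≤
      A * ∫ x, |periodConv (poissonKer r) g x| ^ p ∂periodMeasure := by
    calc ∫ x, |periodConv (conjPoissonKer r) g x| ^ p ∂periodMeasure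
        ≤ ∫ x, (A * |periodConv (poissonKer r) g x| ^ p -
            B * (herglotzInt g (z x) ^ (p : ℂ)).re) ∂periodMeasure := by
          refine integral_mono (hcp hQc) (((hcp hPc).const_mul A).sub (hHi.const_mul B))
            fun x => ?_
          refine le_trans ?_ ((hAB _ (hre (hz x))).trans_eq ?_)
          · simp only [← hQ]
            exact rpow_le_rpow (abs_nonneg _) (Complex.abs_im_le_norm _) hp0.le
          · simp only [← hP, abs_of_pos (hre (hz x))]
      _ = A * ∫ x, |periodConv (poissonKer r) g x| ^ p ∂periodMeasure -
            B * ∫ x, (herglotzInt g (z x) ^ (p : ℂ)).re ∂periodMeasure := by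
          rw [integral_sub ((hcp hPc).const_mul A) (hHi.const_mul B), integral_const_mul,
            integral_const_mul]
      _ ≤ _ := by nlinarith [mul_nonneg hB hnonneg]
  have hPY := eLpNorm_periodConv_le hp (continuous_poissonKer hr0 hr1).measurable
    (periodic_poissonKer r) hg.aestronglyMeasurable
  rw [lintegral_enorm_poissonKer hr0 hr1] at hPY
  rw [mul_assoc]
  refine le_trans ?_ (mul_le_mul_right hPY _)
  have hne : ENNReal.ofReal p ≠ 0 := by simpa using hp0
  rw [(memLp_periodMeasure_of_continuous hPc _).eLpNorm_eq_integral_rpow_norm hne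
    ENNReal.ofReal_ne_top, (memLp_periodMeasure_of_continuous hQc _).eLpNorm_eq_integral_rpow_norm
    hne ENNReal.ofReal_ne_top, ENNReal.toReal_ofReal hp0.le, ← ENNReal.ofReal_mul (by positivity)]
  refine ENNReal.ofReal_le_ofReal ?_
  simp only [Real.norm_eq_abs, ← one_div]
  rw [← Real.mul_rpow hA (integral_nonneg fun _ => by positivity)]
  exact rpow_le_rpow (integral_nonneg fun _ => by positivity) hkey (by positivity)

lemma periodConv_sub {k : ℝ → ℝ} (hk : Continuous k) {g₁ g₂ : ℝ → ℝ}
    (h₁ : Integrable g₁ periodMeasure) (h₂ : Integrable g₂ periodMeasure) :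
    periodConv k (fun t => g₁ t - g₂ t) = periodConv k g₁ - periodConv k g₂ := by
  funext x
  have hkx : Continuous fun t => k (x - t) := by fun_prop
  simp only [periodConv, Pi.sub_apply, mul_sub]
  exact integral_sub (integrable_continuous_mul hkx h₁) (integrable_continuous_mul hkx h₂)

lemma one_le_ennreal_ofReal {p : ℝ} (hp : 1 < p) : 1 ≤ ENNReal.ofReal p := by
  rw [← ENNReal.ofReal_one]; exact ENNReal.ofReal_le_ofReal hp.le

lemma exists_eLpNorm_conjPoisson_le_of_le_two {p : ℝ} (hp : 1 < p) (hp2 : p ≤ 2) :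
    ∃ K : NNReal, ∀ r, 0 ≤ r → r < 1 → ∀ g : ℝ → ℝ, MemLp g (ENNReal.ofReal p) periodMeasure →
      eLpNorm (periodConv (conjPoissonKer r) g) (ENNReal.ofReal p) periodMeasure ≤
        K * eLpNorm g (ENNReal.ofReal p) periodMeasure := by
  obtain ⟨A, B, hA, hB, hAB⟩ := exists_norm_rpow_le_re_rpow_sub hp hp2
  set K : NNReal := (A ^ (1 / p)).toNNReal * (2 * π).toNNReal
  refine ⟨2 * K, fun r hr0 hr1 g hg => ?_⟩
  have hnorm : ∀ φ : ℝ → ℝ, AEStronglyMeasurable φ periodMeasure → (∀ t, 0 ≤ φ t) →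
      (∀ t, φ t ≤ |g t|) → MemLp φ (ENNReal.ofReal p) periodMeasure ∧
      eLpNorm (periodConv (conjPoissonKer r) φ) (ENNReal.ofReal p) periodMeasure ≤
        K * eLpNorm g (ENNReal.ofReal p) periodMeasure := fun φ hm h0 hle => by
    have hle' : ∀ t, ‖φ t‖ ≤ ‖g t‖ := fun t => by
      rw [Real.norm_of_nonneg (h0 t), Real.norm_eq_abs]; exact hle t
    have hφ : MemLp φ (ENNReal.ofReal p) periodMeasure :=
      hg.mono hm (Filter.Eventually.of_forall hle')
    refine ⟨hφ, (eLpNorm_conjPoisson_le_of_nonneg hp hA hB hAB hr0 hr1 hφ h0).trans ?_⟩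
    rw [ENNReal.coe_mul]
    exact mul_le_mul_right (eLpNorm_mono hle') _
  have hm := hg.aestronglyMeasurable
  obtain ⟨hp1, hp2⟩ := hnorm (fun t => max (g t) 0) (hm.sup aestronglyMeasurable_const)
    (fun t => le_max_right _ _) (fun t => max_le (le_abs_self _) (abs_nonneg _))
  obtain ⟨hn1, hn2⟩ := hnorm (fun t => max (-g t) 0) (hm.neg.sup aestronglyMeasurable_const)
    (fun t => le_max_right _ _) (fun t => max_le (neg_le_abs _) (abs_nonneg _))
  have hgeq : g = fun t => max (g t) 0 - max (-g t) 0 := by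
    funext t
    exact (posPart_sub_negPart (g t)).symm
  have hc := continuous_conjPoissonKer hr0 hr1
  rw [hgeq, periodConv_sub hc (hp1.integrable_periodMeasure hp) (hn1.integrable_periodMeasure hp),
    ← hgeq]
  refine (eLpNorm_sub_le (aestronglyMeasurable_periodConv hc.measurable hp1.1 _)
    (aestronglyMeasurable_periodConv hc.measurable hn1.1 _) (one_le_ennreal_ofReal hp)).trans
    ((add_le_add hp2 hn2).trans_eq ?_)
  push_cast
  ring

lemma eLpNorm_eq_ofReal_integral {p : ℝ} (hp : 0 < p) {φ : ℝ → ℝ}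
    (hφ : MemLp φ (ENNReal.ofReal p) periodMeasure) :
    eLpNorm φ (ENNReal.ofReal p) periodMeasure =
      ENNReal.ofReal ((∫ x, |φ x| ^ p ∂periodMeasure) ^ (1 / p)) := by
  rw [hφ.eLpNorm_eq_integral_rpow_norm (by simpa using hp) ENNReal.ofReal_ne_top,
    ENNReal.toReal_ofReal hp.le]
  simp only [Real.norm_eq_abs, one_div]

lemma exists_abs_le_of_periodic {k : ℝ → ℝ} (hk : Continuous k)
    (hper : Function.Periodic k (2 * π)) : ∃ C, ∀ u, |k u| ≤ C := by
  obtain ⟨C, hC⟩ := (hper.isBounded_of_continuous two_pi_pos.ne' hk).exists_norm_le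
  exact ⟨C, fun u => hC _ ⟨u, rfl⟩⟩

lemma continuous_periodConv {k : ℝ → ℝ} (hk : Continuous k) (hper : Function.Periodic k (2 * π))
    {g : ℝ → ℝ} (hg : Integrable g periodMeasure) : Continuous (periodConv k g) := by
  obtain ⟨C, hC⟩ := exists_abs_le_of_periodic hk hper
  refine continuous_of_dominated (bound := fun t => C * |g t|) (fun x => ?_) (fun x => ?_)
    (hg.abs.const_mul C) ?_
  · exact (hk.comp (by fun_prop : Continuous fun t => x - t)).aestronglyMeasurable.mul
      hg.aestronglyMeasurable
  · refine Filter.Eventually.of_forall fun t => ?_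
    rw [norm_mul, Real.norm_eq_abs, Real.norm_eq_abs]
    exact mul_le_mul_of_nonneg_right (hC _) (abs_nonneg _)
  · exact Filter.Eventually.of_forall fun t => by fun_prop

lemma integral_periodConv_mul {k : ℝ → ℝ} (hk : Continuous k)
    (hper : Function.Periodic k (2 * π)) (hodd : ∀ u, k (-u) = -k u) {g h : ℝ → ℝ}
    (hg : Integrable g periodMeasure) (hh : Integrable h periodMeasure) :
    ∫ x, periodConv k g x * h x ∂periodMeasure =
      -∫ t, g t * periodConv k h t ∂periodMeasure := by
  obtain ⟨C, hC⟩ := exists_abs_le_of_periodic hk hper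
  have hint : Integrable (Function.uncurry fun x t => k (x - t) * (h x * g t))
      (periodMeasure.prod periodMeasure) := by
    refine (hh.mul_prod hg).bdd_mul (c := C) ?_ (Filter.Eventually.of_forall fun z => hC _)
    exact (hk.comp (by fun_prop : Continuous fun z : ℝ × ℝ => z.1 - z.2)).aestronglyMeasurable
  have hl : ∀ x, periodConv k g x * h x = ∫ t, k (x - t) * (h x * g t) ∂periodMeasure := by
    intro x
    rw [periodConv, ← integral_mul_const]
    congr 1; funext t; ring
  have hr : ∀ t, g t * periodConv k h t = -∫ x, k (x - t) * (h x * g t) ∂periodMeasure := by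
    intro t
    rw [periodConv, ← integral_const_mul, ← integral_neg]
    congr 1; funext x
    rw [← neg_sub x t, hodd]; ring
  simp only [hl, hr, integral_neg, neg_neg]
  exact integral_integral_swap hint

lemma eLpNorm_periodConv_le_of_dual {p q : ℝ} (hpq : p.HolderConjugate q) (hp2 : 2 ≤ p)
    {k : ℝ → ℝ} (hk : Continuous k)
    (hper : Function.Periodic k (2 * π)) (hodd : ∀ u, k (-u) = -k u) {K : NNReal}
    (hK : ∀ g : ℝ → ℝ, MemLp g (ENNReal.ofReal q) periodMeasure →
      eLpNorm (periodConv k g) (ENNReal.ofReal q) periodMeasure ≤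
        K * eLpNorm g (ENNReal.ofReal q) periodMeasure) {g : ℝ → ℝ}
    (hg : MemLp g (ENNReal.ofReal p) periodMeasure) :
    eLpNorm (periodConv k g) (ENNReal.ofReal p) periodMeasure ≤
        K * eLpNorm g (ENNReal.ofReal p) periodMeasure := by
  have hp0 := hpq.pos
  have hq0 := hpq.symm.pos
  have hgi := hg.integrable_periodMeasure hpq.lt
  set u := periodConv k g with hu
  have huc : Continuous u := continuous_periodConv hk hper hgi
  set h : ℝ → ℝ := fun x => |u x| ^ (p - 2) * u x with hh
  have hhc : Continuous h := (huc.abs.rpow_const fun _ => Or.inr (by linarith)).mul huc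
  have hhi := integrable_periodMeasure_of_continuous hhc
  have hvc : Continuous (periodConv k h) := continuous_periodConv hk hper hhi
  have huh : ∀ x, u x * h x = |u x| ^ p := fun x => by
    rcases eq_or_ne (u x) 0 with h0 | h0
    · simp [h0, Real.zero_rpow hp0.ne']
    · have : |u x| ^ p = |u x| ^ (p - 2) * |u x| ^ (2 : ℝ) := by
        rw [← Real.rpow_add (abs_pos.2 h0)]; congr 1; ring
      rw [this, Real.rpow_two, sq_abs, hh]; ring
  have habsh : ∀ x, |h x| ^ q = |u x| ^ p := fun x => by
    rcases eq_or_ne (u x) 0 with h0 | h0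
    · simp [hh, h0, Real.zero_rpow hp0.ne', Real.zero_rpow hq0.ne']
    · have : |h x| = |u x| ^ (p - 1) := by
        rw [hh, abs_mul, abs_of_nonneg (Real.rpow_nonneg (abs_nonneg _) _),
          ← Real.rpow_add_one (abs_pos.2 h0).ne']
        congr 1; ring
      rw [this, ← Real.rpow_mul (abs_nonneg _), hpq.sub_one_mul_conj]
  set N := ∫ x, |u x| ^ p ∂periodMeasure with hN
  have hN0 : 0 ≤ N := integral_nonneg fun _ => by positivity
  set G := (∫ x, |g x| ^ p ∂periodMeasure) ^ (1 / p) with hG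
  have hG0 : 0 ≤ G := Real.rpow_nonneg (integral_nonneg fun _ => by positivity) _
  have hvm := memLp_periodMeasure_of_continuous hvc (ENNReal.ofReal q)
  have hhm := memLp_periodMeasure_of_continuous hhc (ENNReal.ofReal q)
  have hV : (∫ x, |periodConv k h x| ^ q ∂periodMeasure) ^ (1 / q) ≤ K * N ^ (1 / q) := by
    have := hK h hhm
    rw [eLpNorm_eq_ofReal_integral hq0 hvm, eLpNorm_eq_ofReal_integral hq0 hhm,
      ← ENNReal.ofReal_coe_nnreal, ← ENNReal.ofReal_mul (by positivity),
      ENNReal.ofReal_le_ofReal_iff (by positivity)] at this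
    simpa only [habsh] using this
  have hmain : N ≤ G * (K * N ^ (1 / q)) := by
    calc N = |∫ x, u x * h x ∂periodMeasure| := by
          simp only [huh]; exact (abs_of_nonneg hN0).symm
      _ = |∫ t, g t * periodConv k h t ∂periodMeasure| := by
          rw [integral_periodConv_mul hk hper hodd hgi hhi, abs_neg]
      _ ≤ ∫ t, ‖g t‖ * ‖periodConv k h t‖ ∂periodMeasure := by
          rw [← Real.norm_eq_abs]
          refine (norm_integral_le_integral_norm _).trans_eq ?_
          simp only [norm_mul]
      _ ≤ G * (∫ x, |periodConv k h x| ^ q ∂periodMeasure) ^ (1 / q) :=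
          integral_mul_norm_le_Lp_mul_Lq hpq hg hvm
      _ ≤ _ := mul_le_mul_of_nonneg_left hV hG0
  rw [eLpNorm_eq_ofReal_integral hp0 hg,
    eLpNorm_eq_ofReal_integral hp0 (memLp_periodMeasure_of_continuous huc _),
    ← ENNReal.ofReal_coe_nnreal, ← ENNReal.ofReal_mul (by positivity)]
  refine ENNReal.ofReal_le_ofReal ?_
  change N ^ (1 / p) ≤ K * G
  rcases hN0.eq_or_lt with h0 | hpos
  · rw [← h0, Real.zero_rpow (by positivity)]
    positivity
  · have hsplit : N = N ^ (1 / p) * N ^ (1 / q) := by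
      rw [← Real.rpow_add hpos, one_div, one_div, hpq.inv_add_inv_eq_one, Real.rpow_one]
    have hNq : 0 < N ^ (1 / q) := Real.rpow_pos_of_pos hpos _
    refine le_of_mul_le_mul_right ?_ hNq
    rw [← hsplit]
    linarith

lemma conjPoissonKer_neg (r u : ℝ) : conjPoissonKer r (-u) = -conjPoissonKer r u := by
  simp [conjPoissonKer, neg_div]

/-- The theorem of M. Riesz: convolution with the conjugate Poisson kernels is bounded on `L^p`,
uniformly in the radius. -/
theorem exists_eLpNorm_conjPoisson_le {p : ℝ} (hp : 1 < p) :
    ∃ K : NNReal, ∀ r, 0 ≤ r → r < 1 → ∀ g : ℝ → ℝ, MemLp g (ENNReal.ofReal p) periodMeasure →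
      eLpNorm (periodConv (conjPoissonKer r) g) (ENNReal.ofReal p) periodMeasure ≤
        K * eLpNorm g (ENNReal.ofReal p) periodMeasure := by
  rcases le_total p 2 with hp2 | hp2
  · exact exists_eLpNorm_conjPoisson_le_of_le_two hp hp2
  · have hpq := Real.HolderConjugate.conjExponent hp
    have hq2 : p.conjExponent ≤ 2 := by
      rw [Real.conjExponent, div_le_iff₀ (by linarith)]; linarith
    obtain ⟨K, hK⟩ := exists_eLpNorm_conjPoisson_le_of_le_two hpq.symm.lt hq2
    exact ⟨K, fun r hr0 hr1 g hg => eLpNorm_periodConv_le_of_dual hpq hp2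
      (continuous_conjPoissonKer hr0 hr1) (periodic_conjPoissonKer r) (conjPoissonKer_neg r)
      (hK r hr0 hr1) hg⟩

/-- The conjugate Dirichlet kernel `∑_{k=1}^n sin (k u)`. -/
noncomputable def conjDirichlet (n : ℕ) (u : ℝ) : ℝ := ∑ k ∈ range n, sin (((k : ℝ) + 1) * u)

/-- The modified conjugate Dirichlet kernel, twice the conjugate Dirichlet kernel with its last
term halved. -/
noncomputable def modConjDirichlet (n : ℕ) (u : ℝ) : ℝ :=
  ∑ k ∈ range n, (sin ((k : ℝ) * u) + sin (((k : ℝ) + 1) * u))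

lemma continuous_conjDirichlet (n : ℕ) : Continuous (conjDirichlet n) := by
  unfold conjDirichlet; fun_prop

lemma continuous_modConjDirichlet (n : ℕ) : Continuous (modConjDirichlet n) := by
  unfold modConjDirichlet; fun_prop

lemma sin_natCast_mul_add_two_pi (k : ℕ) (u : ℝ) : sin (k * (u + 2 * π)) = sin (k * u) := by
  rw [mul_add]; exact sin_add_nat_mul_two_pi _ _

lemma cos_natCast_mul_add_two_pi (k : ℕ) (u : ℝ) : cos (k * (u + 2 * π)) = cos (k * u) := by
  rw [mul_add]; exact cos_add_nat_mul_two_pi _ _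

lemma periodic_conjDirichlet (n : ℕ) : Function.Periodic (conjDirichlet n) (2 * π) := fun u => by
  refine sum_congr rfl fun k _ => ?_
  exact_mod_cast sin_natCast_mul_add_two_pi (k + 1) u

lemma modConjDirichlet_eq (n : ℕ) (u : ℝ) :
    modConjDirichlet n u = 2 * conjDirichlet n u - sin (n * u) := by
  induction n with
  | zero => simp [modConjDirichlet, conjDirichlet]
  | succ n ih =>
    simp only [modConjDirichlet, conjDirichlet, sum_range_succ] at ih ⊢
    rw [ih]; push_cast; ring

lemma one_sub_cos_mul_modConjDirichlet (n : ℕ) (u : ℝ) :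
    (1 - cos u) * modConjDirichlet n u = (1 - cos (n * u)) * sin u := by
  induction n with
  | zero => simp [modConjDirichlet]
  | succ n ih =>
    simp only [modConjDirichlet, sum_range_succ] at ih ⊢
    rw [mul_add, ih]
    push_cast
    rw [add_mul, one_mul, sin_add, cos_add]
    linear_combination (-sin (n * u)) * (sin_sq_add_cos_sq u)

lemma modConjDirichlet_eq_zero_of_cos_eq_one (n : ℕ) {u : ℝ} (hu : cos u = 1) :
    modConjDirichlet n u = 0 := by
  obtain ⟨m, rfl⟩ := (cos_eq_one_iff u).1 hu
  have h : ∀ k : ℕ, sin (k * (m * (2 * π))) = 0 := fun k => by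
    have := sin_int_mul_pi (k * m * 2)
    push_cast at this
    rwa [show (k : ℝ) * (m * (2 * π)) = k * m * 2 * π by ring]
  refine sum_eq_zero fun k _ => ?_
  have h1 := h (k + 1)
  push_cast at h1
  rw [h k, h1, add_zero]

lemma one_sub_cos_mul_conjPoissonKer (n : ℕ) (r u : ℝ) :
    (1 - cos (n * u)) * conjPoissonKer r u =
      modConjDirichlet n u * (2 * r * (1 - cos u) / (1 - 2 * r * cos u + r ^ 2)) := by
  rw [conjPoissonKer, ← mul_div_assoc, ← mul_div_assoc]
  congr 1
  linear_combination (-2 * r) * one_sub_cos_mul_modConjDirichlet n u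

lemma abs_one_sub_cos_mul_conjPoissonKer_le (n : ℕ) {r : ℝ} (hr0 : 0 ≤ r) (hr1 : r < 1) (u : ℝ) :
    |(1 - cos (n * u)) * conjPoissonKer r u| ≤ |modConjDirichlet n u| := by
  have hd := poisson_denom_pos hr0 hr1 u
  have hc : 0 ≤ 1 - cos u := sub_nonneg.2 (cos_le_one u)
  rw [one_sub_cos_mul_conjPoissonKer, abs_mul]
  refine mul_le_of_le_one_right (abs_nonneg _) ?_
  rw [abs_of_nonneg (by positivity), div_le_one hd]
  nlinarith [sq_nonneg (1 - r)]

lemma tendsto_one_sub_cos_mul_conjPoissonKer (n : ℕ) (u : ℝ) :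
    Filter.Tendsto (fun r => (1 - cos (n * u)) * conjPoissonKer r u) (nhdsWithin 1 (Set.Iio 1))
      (nhds (modConjDirichlet n u)) := by
  simp only [one_sub_cos_mul_conjPoissonKer]
  by_cases hu : cos u = 1
  · simp [modConjDirichlet_eq_zero_of_cos_eq_one n hu]
  · have hne : 1 - 2 * 1 * cos u + (1 : ℝ) ^ 2 ≠ 0 := fun h => hu (by linarith)
    have hcont : ContinuousAt
        (fun r : ℝ => modConjDirichlet n u * (2 * r * (1 - cos u) / (1 - 2 * r * cos u + r ^ 2)))
        1 :=
      continuousAt_const.mul (ContinuousAt.div (by fun_prop) (by fun_prop) hne)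
    have h1 : modConjDirichlet n u * (2 * 1 * (1 - cos u) / (1 - 2 * 1 * cos u + (1 : ℝ) ^ 2)) =
        modConjDirichlet n u := by
      rw [show 2 * 1 * (1 - cos u) = 1 - 2 * 1 * cos u + (1 : ℝ) ^ 2 by ring, div_self hne, mul_one]
    have := hcont.tendsto
    rw [h1] at this
    exact this.mono_left nhdsWithin_le_nhds

lemma memLp_mul_of_abs_le_one {p : ENNReal} {c g : ℝ → ℝ} (hc : Continuous c)
    (hc1 : ∀ x, |c x| ≤ 1) (hg : MemLp g p periodMeasure) :
    MemLp (fun t => c t * g t) p periodMeasure ∧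
      eLpNorm (fun t => c t * g t) p periodMeasure ≤ eLpNorm g p periodMeasure := by
  have hle : ∀ t, ‖c t * g t‖ ≤ ‖g t‖ := fun t => by
    rw [norm_mul]; exact mul_le_of_le_one_left (norm_nonneg _) (hc1 t)
  exact ⟨hg.mono (hc.aestronglyMeasurable.mul hg.1) (Filter.Eventually.of_forall hle),
    eLpNorm_mono hle⟩

lemma periodConv_one_sub_cos_mul (n : ℕ) {k : ℝ → ℝ} (hk : Continuous k) {g : ℝ → ℝ}
    (hg : Integrable g periodMeasure) (x : ℝ) :
    periodConv (fun u => (1 - cos (n * u)) * k u) g x = periodConv k g x -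
      (cos (n * x) * periodConv k (fun t => cos (n * t) * g t) x +
        sin (n * x) * periodConv k (fun t => sin (n * t) * g t) x) := by
  have hkx : Continuous fun t => k (x - t) := by fun_prop
  have hc := integrable_continuous_mul (k := fun t => cos (n * t)) (by fun_prop) hg
  have hs := integrable_continuous_mul (k := fun t => sin (n * t)) (by fun_prop) hg
  have h0 := integrable_continuous_mul hkx hg
  have h1 := (integrable_continuous_mul hkx hc).const_mul (cos (n * x))
  have h2 := (integrable_continuous_mul hkx hs).const_mul (sin (n * x))
  simp only [periodConv]
  rw [← integral_const_mul, ← integral_const_mul, ← integral_add h1 h2]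
  refine Eq.trans ?_ (integral_sub h0 (h1.add h2))
  congr 1
  funext t
  rw [mul_sub, cos_sub]
  ring

lemma eLpNorm_periodConv_one_sub_cos_mul_le {p : ℝ} (hp : 1 < p) (n : ℕ) {k : ℝ → ℝ}
    (hk : Continuous k) {K : NNReal}
    (hK : ∀ g : ℝ → ℝ, MemLp g (ENNReal.ofReal p) periodMeasure →
      eLpNorm (periodConv k g) (ENNReal.ofReal p) periodMeasure ≤
        K * eLpNorm g (ENNReal.ofReal p) periodMeasure) {g : ℝ → ℝ}
    (hg : MemLp g (ENNReal.ofReal p) periodMeasure) :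
    eLpNorm (periodConv (fun u => (1 - cos (n * u)) * k u) g) (ENNReal.ofReal p) periodMeasure ≤
      3 * K * eLpNorm g (ENNReal.ofReal p) periodMeasure := by
  have hp1 := one_le_ennreal_ofReal hp
  have hcc : Continuous fun t : ℝ => cos (n * t) := by fun_prop
  have hcs : Continuous fun t : ℝ => sin (n * t) := by fun_prop
  have key : ∀ c : ℝ → ℝ, Continuous c → (∀ x, |c x| ≤ 1) →
      AEStronglyMeasurable (fun x => c x * periodConv k (fun t => c t * g t) x) periodMeasure ∧
      eLpNorm (fun x => c x * periodConv k (fun t => c t * g t) x) (ENNReal.ofReal p)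
        periodMeasure ≤ K * eLpNorm g (ENNReal.ofReal p) periodMeasure := fun c hc hc1 => by
    obtain ⟨hm, hle⟩ := memLp_mul_of_abs_le_one hc hc1 hg
    refine ⟨hc.aestronglyMeasurable.mul (aestronglyMeasurable_periodConv hk.measurable hm.1 _), ?_⟩
    refine (eLpNorm_mono fun x => ?_).trans ((hK _ hm).trans (mul_le_mul_right hle _))
    rw [norm_mul]
    exact mul_le_of_le_one_left (norm_nonneg _) (hc1 x)
  obtain ⟨hm1, h1⟩ := key _ hcc fun x => abs_cos_le_one _
  obtain ⟨hm2, h2⟩ := key _ hcs fun x => abs_sin_le_one _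
  rw [funext (periodConv_one_sub_cos_mul n hk (hg.integrable_periodMeasure hp))]
  refine (eLpNorm_sub_le (aestronglyMeasurable_periodConv hk.measurable hg.1 _) (hm1.add hm2)
    hp1).trans ((add_le_add (hK g hg)
      ((eLpNorm_add_le hm1 hm2 hp1).trans (add_le_add h1 h2))).trans_eq ?_)
  ring

lemma eLpNorm_periodConv_modConjDirichlet_le {p : ℝ} (hp : 1 < p) {K : NNReal}
    (hK : ∀ r, 0 ≤ r → r < 1 → ∀ g : ℝ → ℝ, MemLp g (ENNReal.ofReal p) periodMeasure →
      eLpNorm (periodConv (conjPoissonKer r) g) (ENNReal.ofReal p) periodMeasure ≤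
        K * eLpNorm g (ENNReal.ofReal p) periodMeasure) (n : ℕ) {g : ℝ → ℝ}
    (hg : MemLp g (ENNReal.ofReal p) periodMeasure) :
    eLpNorm (periodConv (modConjDirichlet n) g) (ENNReal.ofReal p) periodMeasure ≤
      3 * K * eLpNorm g (ENNReal.ofReal p) periodMeasure := by
  have hgi := hg.integrable_periodMeasure hp
  have hmeas : ∀ r, Measurable fun u => (1 - cos (n * u)) * conjPoissonKer r u := fun r => by
    unfold conjPoissonKer; fun_prop
  have hev : ∀ᶠ r in nhdsWithin (1 : ℝ) (Set.Iio 1), 0 ≤ r ∧ r < 1 := by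
    filter_upwards [self_mem_nhdsWithin,
      nhdsWithin_le_nhds (Ioi_mem_nhds (zero_lt_one' ℝ))] with r h1 h0
    exact ⟨le_of_lt h0, h1⟩
  refine Lp.eLpNorm_le_of_ae_tendsto (u := nhdsWithin (1 : ℝ) (Set.Iio 1))
    (f := fun r => periodConv (fun u => (1 - cos (n * u)) * conjPoissonKer r u) g) ?_
    (fun r => aestronglyMeasurable_periodConv (hmeas r) hg.1 _)
    (Filter.Eventually.of_forall fun x => ?_)
  · filter_upwards [hev] with r hr
    exact eLpNorm_periodConv_one_sub_cos_mul_le hp n (continuous_conjPoissonKer hr.1 hr.2)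
      (hK r hr.1 hr.2) hg
  · have hcx : Continuous fun t => modConjDirichlet n (x - t) :=
      (continuous_modConjDirichlet n).comp (by fun_prop)
    refine tendsto_integral_filter_of_dominated_convergence
      (fun t => |modConjDirichlet n (x - t) * g t|) ?_ ?_
      (integrable_continuous_mul hcx hgi).abs ?_
    · exact Filter.Eventually.of_forall fun r =>
        ((hmeas r).comp (by fun_prop : Measurable fun t => x - t)).aestronglyMeasurable.mul hg.1
    · filter_upwards [hev] with r hr
      refine Filter.Eventually.of_forall fun t => ?_
      rw [norm_mul, abs_mul]
      exact mul_le_mul_of_nonneg_right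
        (abs_one_sub_cos_mul_conjPoissonKer_le n hr.1 hr.2 _) (abs_nonneg _)
    · exact Filter.Eventually.of_forall fun t =>
        (tendsto_one_sub_cos_mul_conjPoissonKer n _).mul_const _

/-- Convolution with the conjugate Dirichlet kernels is bounded on `L^p`, uniformly in the
order. -/
theorem exists_eLpNorm_conjDirichlet_le {p : ℝ} (hp : 1 < p) :
    ∃ K : NNReal, ∀ (n : ℕ) (g : ℝ → ℝ), MemLp g (ENNReal.ofReal p) periodMeasure →
      eLpNorm (periodConv (conjDirichlet n) g) (ENNReal.ofReal p) periodMeasure ≤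
        K * eLpNorm g (ENNReal.ofReal p) periodMeasure := by
  obtain ⟨K, hK⟩ := exists_eLpNorm_conjPoisson_le hp
  refine ⟨3 * K + (2 * π).toNNReal, fun n g hg => ?_⟩
  have hgi := hg.integrable_periodMeasure hp
  have hsc : Continuous fun u : ℝ => sin (n * u) := by fun_prop
  have hmc := continuous_modConjDirichlet n
  have hmass : ∫⁻ x, ‖sin (n * x)‖ₑ ∂periodMeasure ≤ ENNReal.ofReal (2 * π) := by
    calc ∫⁻ x, ‖sin (n * x)‖ₑ ∂periodMeasure ≤ ∫⁻ _, 1 ∂periodMeasure := by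
          refine lintegral_mono fun x => ?_
          rw [← ofReal_norm, ← ENNReal.ofReal_one]
          exact ENNReal.ofReal_le_ofReal (abs_sin_le_one _)
      _ = ENNReal.ofReal (2 * π) := by simp
  have hsplit : ∀ x, periodConv (conjDirichlet n) g x = 1 / 2 *
      (periodConv (modConjDirichlet n) g + periodConv (fun u => sin (n * u)) g) x := fun x => by
    simp only [periodConv, Pi.add_apply]
    have h1 : Integrable (fun t => modConjDirichlet n (x - t) * g t) periodMeasure :=
      integrable_continuous_mul (hmc.comp (by fun_prop : Continuous fun t => x - t)) hgi
    have h2 : Integrable (fun t => sin (n * (x - t)) * g t) periodMeasure :=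
      integrable_continuous_mul (hsc.comp (by fun_prop : Continuous fun t => x - t)) hgi
    rw [← integral_add h1 h2, ← integral_const_mul]
    congr 1
    funext t
    rw [modConjDirichlet_eq]
    ring
  have hhalf : ∀ x, ‖periodConv (conjDirichlet n) g x‖ ≤
      ‖(periodConv (modConjDirichlet n) g + periodConv (fun u => sin (n * u)) g) x‖ := fun x => by
    rw [hsplit, norm_mul]
    exact mul_le_of_le_one_left (norm_nonneg _) (by norm_num)
  refine (eLpNorm_mono hhalf).trans ((eLpNorm_add_le
    (aestronglyMeasurable_periodConv hmc.measurable hg.1 _)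
    (aestronglyMeasurable_periodConv hsc.measurable hg.1 _) (one_le_ennreal_ofReal hp)).trans ?_)
  push_cast
  rw [add_mul]
  refine add_le_add (eLpNorm_periodConv_modConjDirichlet_le hp hK n hg) ?_
  exact (eLpNorm_periodConv_le hp hsc.measurable (sin_natCast_mul_add_two_pi n) hg.1).trans
    (mul_le_mul_left hmass _)

lemma integral_periodMeasure_eq (φ : ℝ → ℝ) :
    ∫ x, φ x ∂periodMeasure = ∫ x in (0 : ℝ)..(2 * π), φ x :=
  (intervalIntegral.integral_of_le two_pi_pos.le).symm

lemma integral_periodMeasure_add {φ : ℝ → ℝ} (hφ : Function.Periodic φ (2 * π)) (a : ℝ) :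
    ∫ x, φ (x + a) ∂periodMeasure = ∫ x, φ x ∂periodMeasure := by
  rw [integral_periodMeasure_eq, integral_periodMeasure_eq,
    intervalIntegral.integral_comp_add_right, zero_add, add_comm]
  simpa using hφ.intervalIntegral_add_eq a 0

lemma aestronglyMeasurable_of_periodic {f : ℝ → ℝ} (hper : Function.Periodic f (2 * π))
    (hf : AEStronglyMeasurable f periodMeasure) : AEStronglyMeasurable f volume := by
  rw [← Measure.restrict_univ (μ := volume), ← iUnion_Ioc_zsmul two_pi_pos,
    aestronglyMeasurable_iUnion_iff]
  intro n
  have hmp := (measurePreserving_add_right (volume : Measure ℝ) (-(n • (2 * π)))).restrict_preimage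
    (s := Set.Ioc 0 (2 * π)) measurableSet_Ioc
  have hs : (fun x => x + -(n • (2 * π))) ⁻¹' Set.Ioc 0 (2 * π) =
      Set.Ioc (n • (2 * π)) ((n + 1) • (2 * π)) := by
    ext x
    rw [add_smul, one_smul]
    simp only [Set.mem_preimage, Set.mem_Ioc]
    constructor <;> rintro ⟨h1, h2⟩ <;> constructor <;> linarith
  rw [hs] at hmp
  refine (hf.comp_measurePreserving hmp).congr (Filter.Eventually.of_forall fun x => ?_)
  have := hper.zsmul n (x + -(n • (2 * π)))
  simpa using this.symm

lemma memLp_comp_add {p : ℝ} (hp : 0 < p) {f : ℝ → ℝ} (hper : Function.Periodic f (2 * π))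
    (hf : MemLp f (ENNReal.ofReal p) periodMeasure) (h : ℝ) :
    MemLp (fun x => f (x + h)) (ENNReal.ofReal p) periodMeasure := by
  refine ⟨((aestronglyMeasurable_of_periodic hper hf.1).comp_measurePreserving
    (measurePreserving_add_right volume h)).restrict, ?_⟩
  have := hf.2
  rw [eLpNorm_ofReal_eq hp] at this ⊢
  rwa [lintegral_periodMeasure_add (φ := fun x => ‖f x‖ₑ ^ p) (fun x => by simp only [hper x]) h]

lemma periodConv_comp_add {k f : ℝ → ℝ} (hk : Function.Periodic k (2 * π))
    (hf : Function.Periodic f (2 * π)) (h x : ℝ) :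
    periodConv k (fun t => f (t + h)) x = periodConv k f (x + h) := by
  have hper : Function.Periodic (fun t => k (x + h - t) * f t) (2 * π) := fun t => by
    simp only [hf t, ← sub_sub, hk.sub_eq]
  rw [periodConv, periodConv, ← integral_periodMeasure_add hper h]
  congr 1
  funext t
  rw [add_sub_add_right_eq_sub]

lemma hasDerivAt_periodConv_sin {f : ℝ → ℝ} (hf : Integrable f periodMeasure) (c x : ℝ) :
    HasDerivAt (periodConv (fun u => sin (c * u)) f)
      (c * periodConv (fun u => cos (c * u)) f x) x := by
  have h1 := integrable_continuous_mul (k := fun t => cos (c * t)) (by fun_prop) hf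
  have h2 := integrable_continuous_mul (k := fun t => sin (c * t)) (by fun_prop) hf
  set a := ∫ t, cos (c * t) * f t ∂periodMeasure
  set b := ∫ t, sin (c * t) * f t ∂periodMeasure
  have hs : periodConv (fun u => sin (c * u)) f = fun x => sin (c * x) * a - cos (c * x) * b := by
    funext x
    rw [periodConv, ← integral_const_mul, ← integral_const_mul,
      ← integral_sub (h1.const_mul _) (h2.const_mul _)]
    congr 1
    funext t
    rw [mul_sub, sin_sub]
    ring
  have hc : periodConv (fun u => cos (c * u)) f x = cos (c * x) * a + sin (c * x) * b := by
    rw [periodConv, ← integral_const_mul, ← integral_const_mul,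
      ← integral_add (h1.const_mul _) (h2.const_mul _)]
    congr 1
    funext t
    rw [mul_sub, cos_sub]
    ring
  have hlin : HasDerivAt (fun x => c * x) c x := by simpa using (hasDerivAt_id x).const_mul c
  rw [hs, hc]
  refine ((hlin.sin.mul_const a).sub (hlin.cos.mul_const b)).congr_deriv ?_
  ring

lemma hasDerivAt_periodConv_conjDirichlet {f : ℝ → ℝ} (hf : Integrable f periodMeasure) (n : ℕ)
    (x : ℝ) : HasDerivAt (periodConv (conjDirichlet n) f)
      (∑ j ∈ range n, ((j : ℝ) + 1) * periodConv (fun u => cos (((j : ℝ) + 1) * u)) f x) x := by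
  have hs : periodConv (conjDirichlet n) f =
      fun x => ∑ j ∈ range n, periodConv (fun u => sin (((j : ℝ) + 1) * u)) f x := by
    funext x
    simp only [periodConv, conjDirichlet, sum_mul]
    exact integral_finsetSum _ fun j _ =>
      integrable_continuous_mul (k := fun t => sin (((j : ℝ) + 1) * (x - t))) (by fun_prop) hf
  rw [hs]
  exact HasDerivAt.fun_sum fun j _ => hasDerivAt_periodConv_sin hf _ x

/-- `f` is Lipschitz in the `L^p` mean over a period. -/
def LipMean (p : ℝ) (C : NNReal) (f : ℝ → ℝ) : Prop :=
  ∀ h : ℝ, eLpNorm (fun x => f (x + h) - f x) (ENNReal.ofReal p) periodMeasure ≤ C * ‖h‖ₑ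

lemma exists_eLpNorm_sum_mul_periodConv_cos_le {p : ℝ} (hp : 1 < p) {f : ℝ → ℝ}
    (hper : Function.Periodic f (2 * π)) (hf : MemLp f (ENNReal.ofReal p) periodMeasure)
    {C : NNReal} (hLip : LipMean p C f) :
    ∃ M : NNReal, ∀ n : ℕ, eLpNorm (fun x => ∑ j ∈ range n,
      ((j : ℝ) + 1) * periodConv (fun u => cos (((j : ℝ) + 1) * u)) f x)
        (ENNReal.ofReal p) periodMeasure ≤ M := by
  obtain ⟨K, hK⟩ := exists_eLpNorm_conjDirichlet_le hp
  have hp0 : 0 < p := by linarith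
  refine ⟨K * C, fun n => ?_⟩
  have hfi := hf.integrable_periodMeasure hp
  have hkc := continuous_conjDirichlet n
  have hdiff : ∀ h, MemLp (h⁻¹ • fun x => f (x + h) - f x) (ENNReal.ofReal p) periodMeasure :=
    fun h => ((memLp_comp_add hp0 hper hf h).sub hf).const_smul _
  have hquot : ∀ h x, periodConv (conjDirichlet n) (h⁻¹ • fun x => f (x + h) - f x) x =
      h⁻¹ • (periodConv (conjDirichlet n) f (x + h) - periodConv (conjDirichlet n) f x) := by
    intro h x
    rw [← periodConv_comp_add (periodic_conjDirichlet n) hper, ← Pi.sub_apply,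
      ← periodConv_sub hkc ((memLp_comp_add hp0 hper hf h).integrable_periodMeasure hp) hfi,
      periodConv, periodConv, ← integral_smul]
    congr 1
    funext t
    simp only [Pi.smul_apply, smul_eq_mul]
    ring
  refine Lp.eLpNorm_le_of_ae_tendsto (u := nhdsWithin (0 : ℝ) {0}ᶜ)
    (f := fun h => periodConv (conjDirichlet n) (h⁻¹ • fun x => f (x + h) - f x)) ?_
    (fun h => aestronglyMeasurable_periodConv hkc.measurable (hdiff h).1 _)
    (Filter.Eventually.of_forall fun x => ?_)
  · filter_upwards [self_mem_nhdsWithin] with h hh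
    refine (hK n _ (hdiff h)).trans ?_
    rw [eLpNorm_const_smul, ENNReal.coe_mul]
    refine mul_le_mul_right ((mul_le_mul_right (hLip h) _).trans_eq ?_) _
    rw [mul_left_comm, enorm_inv hh, ENNReal.inv_mul_cancel (by simpa using hh) enorm_ne_top,
      mul_one]
  · simp only [hquot]
    exact hasDerivAt_iff_tendsto_slope_zero.1 (hasDerivAt_periodConv_conjDirichlet hfi n x)

lemma continuous_dirichletKernel (n : ℕ) : Continuous (dirichletKernel n) := by
  unfold dirichletKernel; fun_prop

lemma periodic_dirichletKernel (n : ℕ) : Function.Periodic (dirichletKernel n) (2 * π) :=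
  fun u => by simp only [dirichletKernel, cos_natCast_mul_add_two_pi]

lemma partialFourierSum_eq (f : ℝ → ℝ) (n : ℕ) (x : ℝ) :
    partialFourierSum f n x = 1 / π * periodConv (dirichletKernel n) f x := by
  rw [partialFourierSum, periodConv, integral_periodMeasure_eq]
  simp only [mul_comm]

lemma partialFourierSum_succ_sub {f : ℝ → ℝ} (hf : Integrable f periodMeasure) (n : ℕ) (x : ℝ) :
    partialFourierSum f (n + 1) x - partialFourierSum f n x =
      1 / π * periodConv (fun u => cos (((n : ℝ) + 1) * u)) f x := by
  have hint : ∀ m, Integrable (fun t => dirichletKernel m (x - t) * f t) periodMeasure := fun m =>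
    integrable_continuous_mul
      ((continuous_dirichletKernel m).comp (by fun_prop : Continuous fun t => x - t)) hf
  rw [partialFourierSum_eq, partialFourierSum_eq, ← mul_sub, periodConv, periodConv, periodConv,
    ← integral_sub (hint _) (hint _)]
  congr 2
  funext t
  rw [dirichletKernel, dirichletKernel, sum_Icc_succ_top (by omega)]
  push_cast
  ring

lemma continuous_partialFourierSum {f : ℝ → ℝ} (hf : Integrable f periodMeasure) (n : ℕ) :
    Continuous (partialFourierSum f n) := by
  rw [funext (partialFourierSum_eq f n)]
  exact (continuous_periodConv (continuous_dirichletKernel n) (periodic_dirichletKernel n)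
    hf).const_mul _

lemma exists_eLpNorm_sum_mul_partialFourierSum_le {p : ℝ} (hp : 1 < p) {f : ℝ → ℝ}
    (hper : Function.Periodic f (2 * π)) (hf : MemLp f (ENNReal.ofReal p) periodMeasure)
    {C : NNReal} (hLip : LipMean p C f) :
    ∃ M : NNReal, ∀ n : ℕ, eLpNorm (fun x => ∑ j ∈ range n,
      ((j : ℝ) + 1) * (partialFourierSum f (j + 1) x - partialFourierSum f j x))
        (ENNReal.ofReal p) periodMeasure ≤ M := by
  obtain ⟨M, hM⟩ := exists_eLpNorm_sum_mul_periodConv_cos_le hp hper hf hLip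
  refine ⟨‖1 / π‖₊ * M, fun n => ?_⟩
  have heq : (fun x => ∑ j ∈ range n,
      ((j : ℝ) + 1) * (partialFourierSum f (j + 1) x - partialFourierSum f j x)) =
      (1 / π) • fun x => ∑ j ∈ range n,
        ((j : ℝ) + 1) * periodConv (fun u => cos (((j : ℝ) + 1) * u)) f x := by
    funext x
    rw [Pi.smul_apply, smul_eq_mul, mul_sum]
    refine sum_congr rfl fun j _ => ?_
    rw [partialFourierSum_succ_sub (hf.integrable_periodMeasure hp)]
    ring
  rw [heq, eLpNorm_const_smul, ENNReal.coe_mul]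
  exact mul_le_mul_right (hM n) _

/-- The Fejér kernel, with total mass `π` over a period. -/
noncomputable def fejerKer (m : ℕ) (u : ℝ) : ℝ :=
  1 / ((m : ℝ) + 1) * ∑ k ∈ range (m + 1), dirichletKernel k u

lemma two_mul_one_sub_cos_mul_dirichletKernel (k : ℕ) (u : ℝ) :
    2 * (1 - cos u) * dirichletKernel k u = cos (k * u) - cos (((k : ℝ) + 1) * u) := by
  induction k with
  | zero =>
    simp only [dirichletKernel, Icc_eq_empty_of_lt zero_lt_one, sum_empty, CharP.cast_eq_zero,
      zero_mul, cos_zero, zero_add, one_mul]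
    ring
  | succ k ih =>
    have hsucc : dirichletKernel (k + 1) u = dirichletKernel k u + cos (((k : ℝ) + 1) * u) := by
      rw [dirichletKernel, dirichletKernel, sum_Icc_succ_top (by omega)]
      push_cast; ring
    rw [hsucc, mul_add, ih]
    push_cast
    have h1 : cos (((k : ℝ) + 1 + 1) * u) = cos (((k : ℝ) + 1) * u) * cos u -
        sin (((k : ℝ) + 1) * u) * sin u := by rw [← cos_add]; congr 1; ring
    have h2 : cos ((k : ℝ) * u) = cos (((k : ℝ) + 1) * u) * cos u +
        sin (((k : ℝ) + 1) * u) * sin u := by rw [← cos_sub]; congr 1; ring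
    rw [h1, h2]; ring

lemma one_sub_cos_mul_fejerKer (m : ℕ) (u : ℝ) :
    (1 - cos u) * fejerKer m u = (1 - cos (((m : ℝ) + 1) * u)) / (2 * ((m : ℝ) + 1)) := by
  have h : 2 * (1 - cos u) * ∑ k ∈ range (m + 1), dirichletKernel k u =
      1 - cos (((m : ℝ) + 1) * u) := by
    rw [mul_sum, sum_congr rfl fun k _ => two_mul_one_sub_cos_mul_dirichletKernel k u]
    have := sum_range_sub' (fun k : ℕ => cos (k * u)) (m + 1)
    push_cast at this
    rw [this]; simp
  rw [fejerKer, ← h]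
  field_simp

lemma fejerKer_nonneg (m : ℕ) (u : ℝ) : 0 ≤ fejerKer m u := by
  have hc : 0 ≤ 1 - cos u := sub_nonneg.2 (cos_le_one u)
  rcases hc.eq_or_lt with h | h
  · have hu : cos u = 1 := by linarith
    obtain ⟨l, rfl⟩ := (cos_eq_one_iff u).1 hu
    refine mul_nonneg (by positivity) (sum_nonneg fun k _ => ?_)
    refine add_nonneg (by norm_num) (sum_nonneg fun j _ => ?_)
    have := cos_int_mul_two_pi (j * l)
    push_cast at this
    rw [← mul_assoc, this]
    norm_num
  · refine nonneg_of_mul_nonneg_right ?_ h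
    rw [one_sub_cos_mul_fejerKer]
    exact div_nonneg (sub_nonneg.2 (cos_le_one _)) (by positivity)

lemma one_sub_cos_mul_fejerKer_le (m : ℕ) (u : ℝ) :
    (1 - cos u) * fejerKer m u ≤ 1 / ((m : ℝ) + 1) := by
  rw [one_sub_cos_mul_fejerKer, div_le_div_iff₀ (by positivity) (by positivity)]
  nlinarith [neg_one_le_cos (((m : ℝ) + 1) * u), (Nat.cast_nonneg m : (0 : ℝ) ≤ m)]

lemma continuous_fejerKer (m : ℕ) : Continuous (fejerKer m) := by
  unfold fejerKer
  exact continuous_const.mul (continuous_finsetSum _ fun k _ => continuous_dirichletKernel k)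

lemma periodic_fejerKer (m : ℕ) : Function.Periodic (fejerKer m) (2 * π) := fun u => by
  simp only [fejerKer, periodic_dirichletKernel _ u]

lemma fejerKer_neg (m : ℕ) (u : ℝ) : fejerKer m (-u) = fejerKer m u := by
  simp only [fejerKer, dirichletKernel, mul_neg, cos_neg]

lemma integral_dirichletKernel (k : ℕ) : ∫ u, dirichletKernel k u ∂periodMeasure = π := by
  have hcos : ∀ j ∈ Icc 1 k, ∫ u, cos ((j : ℝ) * u) ∂periodMeasure = 0 := fun j hj => by
    have hj0 : (j : ℝ) ≠ 0 := by
      have := (mem_Icc.1 hj).1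
      exact_mod_cast (by omega : j ≠ 0)
    rw [integral_periodMeasure_eq, intervalIntegral.integral_comp_mul_left _ hj0, integral_cos]
    have := sin_nat_mul_pi (j * 2)
    push_cast at this
    rw [← mul_assoc, this]
    simp
  simp only [dirichletKernel]
  rw [integral_add (integrable_const _) (integrable_finsetSum _ fun j _ =>
    integrable_periodMeasure_of_continuous (by fun_prop)), integral_finsetSum _ fun j _ =>
    integrable_periodMeasure_of_continuous (by fun_prop), sum_eq_zero hcos]
  simp [two_pi_pos.le]
  ring

lemma integral_fejerKer (m : ℕ) : ∫ u, fejerKer m u ∂periodMeasure = π := by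
  simp only [fejerKer]
  rw [integral_const_mul, integral_finsetSum _ fun k _ =>
    integrable_periodMeasure_of_continuous (continuous_dirichletKernel k)]
  simp only [integral_dirichletKernel, sum_const, card_range, nsmul_eq_mul]
  push_cast
  field_simp

lemma cesaro_partialFourierSum_sub_eq {p : ℝ} (hp : 1 < p) {f : ℝ → ℝ}
    (hper : Function.Periodic f (2 * π)) (hf : MemLp f (ENNReal.ofReal p) periodMeasure)
    (m : ℕ) (x : ℝ) :
    1 / ((m : ℝ) + 1) * ∑ k ∈ range (m + 1), partialFourierSum f k x - f x =
      ∫ s, (f (s + x) - f x) * (fejerKer m s / π) ∂periodMeasure := by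
  have hfi := hf.integrable_periodMeasure hp
  have hfx := (memLp_comp_add (by linarith) hper hf x).integrable_periodMeasure hp
  have hsum : 1 / ((m : ℝ) + 1) * ∑ k ∈ range (m + 1), partialFourierSum f k x =
      1 / π * periodConv (fejerKer m) f x := by
    simp only [partialFourierSum_eq, ← mul_sum]
    have : periodConv (fejerKer m) f x = 1 / ((m : ℝ) + 1) *
        ∑ k ∈ range (m + 1), periodConv (dirichletKernel k) f x := by
      simp only [periodConv]
      rw [← integral_finsetSum _ fun k _ => integrable_continuous_mul
        (k := fun t => dirichletKernel k (x - t))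
        ((continuous_dirichletKernel k).comp (by fun_prop)) hfi, ← integral_const_mul]
      congr 1
      funext t
      rw [fejerKer, mul_assoc, sum_mul]
    rw [this]; ring
  have hshift : periodConv (fejerKer m) f x = ∫ s, fejerKer m s * f (s + x) ∂periodMeasure := by
    have hφ : Function.Periodic (fun t => fejerKer m (x - t) * f t) (2 * π) := fun t => by
      simp only [hper t, ← sub_sub, (periodic_fejerKer m).sub_eq]
    rw [periodConv, ← integral_periodMeasure_add hφ x]
    congr 1
    funext t
    rw [sub_add_cancel_right, fejerKer_neg]
  have hfx' : f x = 1 / π * ∫ s, fejerKer m s * f x ∂periodMeasure := by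
    rw [integral_mul_const, integral_fejerKer]
    field_simp
  rw [hsum, hshift]
  conv_lhs => rw [hfx']
  rw [← mul_sub, ← integral_sub (integrable_continuous_mul (continuous_fejerKer m) hfx)
    ((integrable_periodMeasure_of_continuous (continuous_fejerKer m)).mul_const _),
    ← integral_const_mul]
  congr 1
  funext s
  ring

lemma lintegral_translate_sub_le {p : ℝ} (hp : 1 < p) {f : ℝ → ℝ}
    (hper : Function.Periodic f (2 * π)) {C : NNReal} (hLip : LipMean p C f) {δ : ℝ} (hδ : 0 < δ)
    {s : ℝ} (hs : s ∈ Set.Ioc 0 (2 * π)) :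
    ∫⁻ x, ‖f (s + x) - f x‖ₑ ^ p ∂periodMeasure ≤
      ENNReal.ofReal (C ^ p * π ^ (p - 1) * (δ + π ^ 2 / 2 * (1 - cos s) / δ)) := by
  have hp0 : 0 < p := by linarith
  obtain ⟨h, hh, hfh, hcos⟩ : ∃ h : ℝ, |h| ≤ π ∧ (∀ x, f (s + x) = f (x + h)) ∧ cos s = cos h := by
    rcases le_total s π with hsπ | hsπ
    · exact ⟨s, by rwa [abs_of_pos hs.1], fun x => by rw [add_comm], rfl⟩
    · refine ⟨s - 2 * π, abs_le.2 ⟨by linarith, by linarith [hs.2, pi_pos]⟩, fun x => ?_,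
        (cos_sub_two_pi s).symm⟩
      rw [← hper (x + (s - 2 * π))]
      congr 1; ring
  have hint : ∫⁻ x, ‖f (s + x) - f x‖ₑ ^ p ∂periodMeasure ≤ (C * ‖h‖ₑ) ^ p := by
    have := ENNReal.rpow_le_rpow (hLip h) hp0.le
    rw [eLpNorm_ofReal_eq hp0, ← ENNReal.rpow_mul, one_div_mul_cancel hp0.ne',
      ENNReal.rpow_one] at this
    simpa only [hfh] using this
  refine hint.trans ?_
  have hC : (C : ENNReal) * ‖h‖ₑ = ENNReal.ofReal (C * |h|) := by
    rw [ENNReal.ofReal_mul C.coe_nonneg, ENNReal.ofReal_coe_nnreal, Real.enorm_eq_ofReal_abs]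
  rw [hC, ENNReal.ofReal_rpow_of_nonneg (by positivity) hp0.le]
  refine ENNReal.ofReal_le_ofReal ?_
  rw [mul_rpow C.coe_nonneg (abs_nonneg h), mul_assoc]
  refine mul_le_mul_of_nonneg_left ?_ (by positivity)
  have h1 : |h| ^ p ≤ π ^ (p - 1) * |h| := by
    rcases (abs_nonneg h).eq_or_lt with h0 | h0
    · rw [← h0, zero_rpow hp0.ne', mul_zero]
    · calc |h| ^ p = |h| ^ (p - 1) * |h| := by rw [rpow_sub_one h0.ne', div_mul_cancel₀ _ h0.ne']
        _ ≤ _ := by gcongr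
  have h2 : |h| ^ 2 ≤ π ^ 2 / 2 * (1 - cos s) := by
    have := cos_le_one_sub_mul_cos_sq hh
    rw [hcos, sq_abs]
    have : 2 / π ^ 2 * h ^ 2 ≤ 1 - cos h := by linarith
    calc h ^ 2 = π ^ 2 / 2 * (2 / π ^ 2 * h ^ 2) := by field_simp
      _ ≤ _ := by gcongr
  have h3 : |h| ≤ δ + |h| ^ 2 / δ := by
    rw [← sub_le_iff_le_add', le_div_iff₀ hδ]
    nlinarith [sq_nonneg (|h| - δ), mul_nonneg (abs_nonneg h) hδ.le]
  calc |h| ^ p ≤ π ^ (p - 1) * |h| := h1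
    _ ≤ π ^ (p - 1) * (δ + |h| ^ 2 / δ) := by gcongr
    _ ≤ _ := by gcongr

lemma aestronglyMeasurable_translate_prod {f : ℝ → ℝ} (hper : Function.Periodic f (2 * π))
    (hf : AEStronglyMeasurable f periodMeasure) :
    AEStronglyMeasurable (fun z : ℝ × ℝ => f (z.2 + z.1)) (periodMeasure.prod periodMeasure) := by
  have hq : Measure.QuasiMeasurePreserving (fun z : ℝ × ℝ => z.2 + z.1)
      ((volume : Measure ℝ).prod volume) volume := by
    have := (Measure.quasiMeasurePreserving_snd (μ := (volume : Measure ℝ)) (ν := volume)).comp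
      (measurePreserving_prod_add (volume : Measure ℝ) volume).quasiMeasurePreserving
    simpa only [Function.comp_def, add_comm] using this
  have := (aestronglyMeasurable_of_periodic hper hf).comp_quasiMeasurePreserving hq
  rw [Measure.prod_restrict]
  exact this.restrict

lemma lintegral_cesaro_partialFourierSum_sub_le {p : ℝ} (hp : 1 < p) {f : ℝ → ℝ}
    (hper : Function.Periodic f (2 * π)) (hf : MemLp f (ENNReal.ofReal p) periodMeasure)
    {C : NNReal} (hLip : LipMean p C f) (m : ℕ) {δ : ℝ} (hδ : 0 < δ) :
    ∫⁻ x, ‖1 / ((m : ℝ) + 1) * ∑ k ∈ range (m + 1), partialFourierSum f k x - f x‖ₑ ^ p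
        ∂periodMeasure ≤
      ENNReal.ofReal (C ^ p * π ^ (p - 1) * (δ + π ^ 2 / (δ * ((m : ℝ) + 1)))) := by
  set k : ℝ → ENNReal := fun s => ENNReal.ofReal (fejerKer m s / π)
  have hkc : Continuous fun s => fejerKer m s / π := (continuous_fejerKer m).div_const π
  have hk0 : ∀ s, 0 ≤ fejerKer m s / π := fun s => div_nonneg (fejerKer_nonneg m s) pi_pos.le
  have hkm : Measurable k := hkc.measurable.ennreal_ofReal
  have hk1 : ∫⁻ s, k s ∂periodMeasure = 1 := by
    rw [← ofReal_integral_eq_lintegral_ofReal (integrable_periodMeasure_of_continuous hkc)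
      (Filter.Eventually.of_forall hk0), integral_div, integral_fejerKer, div_self pi_ne_zero,
      ENNReal.ofReal_one]
  have hjoint : AEStronglyMeasurable (fun z : ℝ × ℝ => f (z.2 + z.1) - f z.1)
      (periodMeasure.prod periodMeasure) :=
    (aestronglyMeasurable_translate_prod hper hf.1).sub hf.1.comp_fst
  have hslice : ∀ x, AEStronglyMeasurable (fun s => f (s + x) - f x) periodMeasure := fun x =>
    (memLp_comp_add (by linarith) hper hf x).1.sub aestronglyMeasurable_const
  have hslice' : ∀ s, AEStronglyMeasurable (fun x => f (s + x) - f x) periodMeasure := fun s => by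
    simp only [add_comm s]
    exact (memLp_comp_add (by linarith) hper hf s).1.sub hf.1
  calc _ ≤ ∫⁻ x, ∫⁻ s, ‖f (s + x) - f x‖ₑ ^ p * k s ∂periodMeasure ∂periodMeasure := by
        refine lintegral_mono fun x => ?_
        rw [cesaro_partialFourierSum_sub_eq hp hper hf]
        calc _ ≤ (∫⁻ s, ‖f (s + x) - f x‖ₑ * k s ∂periodMeasure) ^ p := by
              refine ENNReal.rpow_le_rpow ?_ (by linarith)
              refine (enorm_integral_le_lintegral_enorm _).trans_eq ?_
              simp only [enorm_mul, Real.enorm_of_nonneg (hk0 _), k]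
          _ ≤ _ := lintegral_mul_rpow_le hp (hslice x).enorm hkm.aemeasurable
          _ = _ := by rw [hk1, ENNReal.one_rpow, one_mul]
    _ = ∫⁻ s, (∫⁻ x, ‖f (s + x) - f x‖ₑ ^ p ∂periodMeasure) * k s ∂periodMeasure := by
        rw [lintegral_lintegral_swap ((hjoint.enorm.pow_const p).mul
          (hkm.comp measurable_snd).aemeasurable)]
        refine lintegral_congr fun s => ?_
        rw [lintegral_mul_const'' _ ((hslice' s).enorm.pow_const p)]
    _ ≤ ∫⁻ s, ENNReal.ofReal (C ^ p * π ^ (p - 1) * δ * (fejerKer m s / π) +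
          C ^ p * π ^ (p - 1) * (π / 2 / (δ * ((m : ℝ) + 1)))) ∂periodMeasure := by
        refine setLIntegral_mono' measurableSet_Ioc fun s hs => ?_
        have hc : 0 ≤ 1 - cos s := sub_nonneg.2 (cos_le_one s)
        refine (mul_le_mul_left (lintegral_translate_sub_le hp hper hLip hδ hs) _).trans ?_
        rw [← ENNReal.ofReal_mul (by positivity)]
        refine ENNReal.ofReal_le_ofReal ?_
        have := one_sub_cos_mul_fejerKer_le m s
        calc _ = C ^ p * π ^ (p - 1) * δ * (fejerKer m s / π) +
              C ^ p * π ^ (p - 1) * (π / 2 / δ * ((1 - cos s) * fejerKer m s)) := by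
              field_simp
          _ ≤ C ^ p * π ^ (p - 1) * δ * (fejerKer m s / π) +
              C ^ p * π ^ (p - 1) * (π / 2 / δ * (1 / ((m : ℝ) + 1))) := by gcongr
          _ = _ := by field_simp
    _ = _ := by
        rw [← ofReal_integral_eq_lintegral_ofReal
          (integrable_periodMeasure_of_continuous (by fun_prop))
          (Filter.Eventually.of_forall fun s => by have := hk0 s; positivity),
          integral_add (integrable_periodMeasure_of_continuous (by fun_prop)) (integrable_const _),
          integral_const_mul, integral_div, integral_fejerKer, integral_const]
        congr 1
        simp [two_pi_pos.le]
        field_simp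

/-- The Cesàro means of the Fourier series converge in `L^p`. -/
lemma tendsto_eLpNorm_cesaro_partialFourierSum_sub {p : ℝ} (hp : 1 < p) {f : ℝ → ℝ}
    (hper : Function.Periodic f (2 * π)) (hf : MemLp f (ENNReal.ofReal p) periodMeasure)
    {C : NNReal} (hLip : LipMean p C f) :
    Filter.Tendsto (fun m : ℕ => eLpNorm (fun x => 1 / ((m : ℝ) + 1) *
      ∑ k ∈ range (m + 1), partialFourierSum f k x - f x) (ENNReal.ofReal p) periodMeasure)
      Filter.atTop (nhds 0) := by
  have hp0 : 0 < p := by linarith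
  have hsqrt : Filter.Tendsto (fun m : ℕ => 1 / √((m : ℝ) + 1)) Filter.atTop (nhds 0) := by
    simp only [one_div]
    exact (tendsto_sqrt_atTop.comp
      (Filter.tendsto_atTop_add_const_right _ 1 tendsto_natCast_atTop_atTop)).inv_tendsto_atTop
  have hreal := hsqrt.const_mul ((C : ℝ) ^ p * π ^ (p - 1) * (1 + π ^ 2))
  rw [mul_zero] at hreal
  have hbound := (ENNReal.tendsto_ofReal hreal).ennrpow_const (1 / p)
  rw [ENNReal.ofReal_zero, ENNReal.zero_rpow_of_pos (by positivity)] at hbound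
  refine tendsto_of_tendsto_of_tendsto_of_le_of_le tendsto_const_nhds hbound
    (fun _ => zero_le) fun m => ?_
  rw [eLpNorm_ofReal_eq hp0]
  refine ENNReal.rpow_le_rpow ?_ (by positivity)
  refine (lintegral_cesaro_partialFourierSum_sub_le hp hper hf hLip m
    (δ := 1 / √((m : ℝ) + 1)) (by positivity)).trans_eq ?_
  congr 1
  have h : √((m : ℝ) + 1) ^ 2 = m + 1 := sq_sqrt (by positivity)
  rw [← h]
  have : √(√((m : ℝ) + 1) ^ 2) = √((m : ℝ) + 1) := by rw [h]
  rw [this]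
  field_simp

lemma lpNorm_eq {p : ℝ} (hp : 0 < p) {φ : ℝ → ℝ} (hφ : MemLp φ (ENNReal.ofReal p) periodMeasure) :
    _root_.lpNorm p φ =
      (1 / (2 * π)) ^ (1 / p) * (eLpNorm φ (ENNReal.ofReal p) periodMeasure).toReal := by
  have h0 : 0 ≤ ∫ x, |φ x| ^ p ∂periodMeasure := integral_nonneg fun x => by positivity
  rw [eLpNorm_eq_ofReal_integral hp hφ, ENNReal.toReal_ofReal (by positivity), _root_.lpNorm,
    ← integral_periodMeasure_eq, mul_rpow (by positivity) h0]

lemma LipClass.memLp {α p : ℝ} (hp : 0 < p) {f : ℝ → ℝ} (hf : LipClass α p f) :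
    MemLp f (ENNReal.ofReal p) periodMeasure := by
  have h1 := (intervalIntegrable_iff_integrableOn_Ioc_of_le two_pi_pos.le).1 hf.2.1
  have h2 := (intervalIntegrable_iff_integrableOn_Ioc_of_le two_pi_pos.le).1 hf.2.2.1
  refine (integrable_norm_rpow_iff h1.1 (by simpa using hp) ENNReal.ofReal_ne_top).1 ?_
  rw [ENNReal.toReal_ofReal hp.le]
  exact h2

lemma LipClass.exists_lipMean {p : ℝ} (hp : 1 < p) {f : ℝ → ℝ} (hf : LipClass 1 p f) :
    ∃ C : NNReal, LipMean p C f := by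
  have hp0 : 0 < p := by linarith
  have hmem := hf.memLp hp0
  obtain ⟨hper, -, -, C, hC, hmod⟩ := hf
  have htr : ∀ h, MemLp (fun x => f (x + h)) (ENNReal.ofReal p) periodMeasure :=
    memLp_comp_add hp0 hper hmem
  have hnorm : ∀ h, eLpNorm (fun x => f (x + h)) (ENNReal.ofReal p) periodMeasure =
      eLpNorm f (ENNReal.ofReal p) periodMeasure := fun h => by
    rw [eLpNorm_ofReal_eq hp0, eLpNorm_ofReal_eq hp0,
      lintegral_periodMeasure_add (φ := fun x => ‖f x‖ₑ ^ p) (fun x => by simp only [hper x]) h]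
  have hdiff : ∀ h, MemLp (fun x => f (x + h) - f x) (ENNReal.ofReal p) periodMeasure :=
    fun h => (htr h).sub hmem
  have hle : ∀ h, h ≠ 0 → _root_.lpNorm p (fun x => f (x + h) - f x) ≤ C * |h| := fun h hh => by
    have hbdd : BddAbove {y : ℝ | ∃ h' : ℝ, 0 < |h'| ∧ |h'| ≤ |h| ∧
        y = ((1 / (2 * π)) * ∫ x in (0 : ℝ)..(2 * π), |f (x + h') - f x| ^ p) ^ (1 / p)} := by
      refine ⟨(1 / (2 * π)) ^ (1 / p) * (eLpNorm f (ENNReal.ofReal p) periodMeasure +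
        eLpNorm f (ENNReal.ofReal p) periodMeasure).toReal, ?_⟩
      rintro _ ⟨h', -, -, rfl⟩
      refine (lpNorm_eq hp0 (hdiff h')).trans_le ?_
      refine mul_le_mul_of_nonneg_left (ENNReal.toReal_mono (by simp [hmem.2.ne]) ?_)
        (by positivity)
      refine (eLpNorm_sub_le (htr h').1 hmem.1 (one_le_ennreal_ofReal hp)).trans ?_
      rw [hnorm]
    have := hmod |h| (abs_pos.2 hh)
    rw [rpow_one] at this
    exact (le_csSup hbdd ⟨h, abs_pos.2 hh, le_rfl, rfl⟩).trans this
  refine ⟨(C * (2 * π) ^ (1 / p)).toNNReal, fun h => ?_⟩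
  rcases eq_or_ne h 0 with rfl | hh
  · simp
  · have h1 := hle h hh
    rw [lpNorm_eq hp0 (hdiff h)] at h1
    rw [← ENNReal.ofReal_toReal (hdiff h).2.ne, Real.enorm_eq_ofReal_abs]
    change _ ≤ ENNReal.ofReal _ * _
    rw [← ENNReal.ofReal_mul (by positivity)]
    refine ENNReal.ofReal_le_ofReal ?_
    have hpow : (2 * π) ^ (1 / p) * (1 / (2 * π)) ^ (1 / p) = 1 := by
      rw [← mul_rpow (by positivity) (by positivity), mul_one_div_cancel two_pi_pos.ne', one_rpow]
    calc _ = (2 * π) ^ (1 / p) * ((1 / (2 * π)) ^ (1 / p) *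
          (eLpNorm (fun x => f (x + h) - f x) (ENNReal.ofReal p) periodMeasure).toReal) := by
          rw [← mul_assoc, hpow, one_mul]
      _ ≤ (2 * π) ^ (1 / p) * (C * |h|) := by gcongr
      _ = _ := by ring

lemma coeFn_sum_smul_toLp {q : ENNReal} {μ : Measure ℝ} {g : ℕ → ℝ → ℝ} (hg : ∀ k, MemLp (g k) q μ)
    (s : Finset ℕ) (c : ℕ → ℝ) :
    ⇑(∑ k ∈ s, c k • (hg k).toLp (g k)) =ᵐ[μ] fun x => ∑ k ∈ s, c k * g k x := by
  have h : ∀ᵐ x ∂μ, ∀ k, (c k • (hg k).toLp (g k)) x = c k * g k x := ae_all_iff.2 fun k => by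
    filter_upwards [Lp.coeFn_smul (c k) ((hg k).toLp (g k)), (hg k).coeFn_toLp] with x h1 h2
    rw [h1, Pi.smul_apply, h2, smul_eq_mul]
  filter_upwards [Lp.coeFn_finsetSum s fun k => c k • (hg k).toLp (g k), h] with x h1 h2
  rw [h1, Finset.sum_apply]
  exact sum_congr rfl fun k _ => h2 k

/-- Corollary 1 (iii): if `f ∈ Lip(1,p)`, `p > 1`, the weights `(p_k)`
are positive and `∑_{k=0}^{n-1} |P_k/(k+1) - P_{k+1}/(k+2)| = O(P_n/n)`, then
`‖R_n(f) - f‖_{L^p} = O(n^{-1})`. -/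
theorem riesz_approx_mean_variation (p : ℝ) (hp : 1 < p)
    (f : ℝ → ℝ) (hf : LipClass 1 p f)
    (w : ℕ → ℝ) (hw : ∀ k, 0 < w k)
    (hvar : ∃ C : ℝ, ∀ n : ℕ, 1 ≤ n →
      ∑ k ∈ Finset.range n,
        |(∑ i ∈ Finset.range (k + 1), w i) / ((k : ℝ) + 1) -
          (∑ i ∈ Finset.range (k + 2), w i) / ((k : ℝ) + 2)| ≤
        C * (∑ i ∈ Finset.range (n + 1), w i) / (n : ℝ)) :
    ∃ C : ℝ, ∀ n : ℕ, 1 ≤ n →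
      lpNorm p (fun x => rieszMeans w f n x - f x) ≤ C / (n : ℝ) := by
  have hp0 : 0 < p := by linarith
  have : Fact (1 ≤ ENNReal.ofReal p) := ⟨one_le_ennreal_ofReal hp⟩
  have hmem := hf.memLp hp0
  obtain ⟨C₀, hLip⟩ := hf.exists_lipMean hp
  have hper := hf.1
  have hS : ∀ k, MemLp (partialFourierSum f k) (ENNReal.ofReal p) periodMeasure := fun k =>
    memLp_periodMeasure_of_continuous
      (continuous_partialFourierSum (hmem.integrable_periodMeasure hp) k) _
  set S : ℕ → Lp ℝ (ENNReal.ofReal p) periodMeasure := fun k => (hS k).toLp _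
  set F : Lp ℝ (ENNReal.ofReal p) periodMeasure := hmem.toLp f
  obtain ⟨M, hM⟩ := exists_eLpNorm_sum_mul_partialFourierSum_le hp hper hmem hLip
  have hmean : ∀ (s : Finset ℕ) (a : ℝ) (c : ℕ → ℝ),
      ‖a • ∑ k ∈ s, c k • S k - F‖ = (eLpNorm (fun x =>
        a * ∑ k ∈ s, c k * partialFourierSum f k x - f x) (ENNReal.ofReal p)
          periodMeasure).toReal := fun s a c => by
    rw [Lp.norm_def]
    congr 1
    refine eLpNorm_congr_ae ?_
    filter_upwards [Lp.coeFn_sub (a • ∑ k ∈ s, c k • S k) F,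
      Lp.coeFn_smul a (∑ k ∈ s, c k • S k), coeFn_sum_smul_toLp hS s c, hmem.coeFn_toLp]
      with x h1 h2 h3 h4
    rw [h1, Pi.sub_apply, h2, Pi.smul_apply, h3, h4, smul_eq_mul]
  have hT : ∀ k, ‖∑ j ∈ range k, ((j : ℝ) + 1) • (S (j + 1) - S j)‖ ≤ M := fun k => by
    have hd : ∀ j, MemLp (fun x => partialFourierSum f (j + 1) x - partialFourierSum f j x)
        (ENNReal.ofReal p) periodMeasure := fun j => (hS (j + 1)).sub (hS j)
    have hsub : ∀ j, S (j + 1) - S j = (hd j).toLp _ := fun _ => rfl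
    simp only [hsub]
    rw [Lp.norm_def, eLpNorm_congr_ae (coeFn_sum_smul_toLp hd (range k) fun j => (j : ℝ) + 1)]
    exact ENNReal.toReal_le_coe_of_le_coe (hM k)
  have hσ : Filter.Tendsto (fun m : ℕ => (1 / ((m : ℝ) + 1)) • ∑ k ∈ range (m + 1), S k)
      Filter.atTop (nhds F) := by
    rw [tendsto_iff_norm_sub_tendsto_zero]
    have h := (ENNReal.tendsto_toReal ENNReal.zero_ne_top).comp
      (tendsto_eLpNorm_cesaro_partialFourierSum_sub hp hper hmem hLip)
    rw [ENNReal.toReal_zero] at h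
    refine h.congr fun m => ?_
    simpa only [one_smul, one_mul, Function.comp_apply] using
      (hmean (range (m + 1)) (1 / ((m : ℝ) + 1)) fun _ => 1).symm
  obtain ⟨C, hC⟩ := exists_norm_weighted_mean_sub_le S F M hT hσ w hw hvar
  refine ⟨(1 / (2 * π)) ^ (1 / p) * C, fun n hn => ?_⟩
  have hR : MemLp (fun x => rieszMeans w f n x - f x) (ENNReal.ofReal p) periodMeasure :=
    ((memLp_finsetSum _ fun k _ => (hS k).const_mul (w k)).const_mul _).sub hmem
  rw [lpNorm_eq hp0 hR, mul_div_assoc]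
  refine mul_le_mul_of_nonneg_left ?_ (by positivity)
  have := hC n hn
  rwa [hmean] at this
end

section
/- Let f ∈ Lip(1,1), let (p_k) be positive, P_n = p_0 + ... + p_n, and suppose that for some β > 0 the sequence ((k+1)^{−β} p_k) belongs to HBVS and (n+1)p_n = O(P_n). Then ‖R_n(f) − f‖_{L^1} = O(n^{−1}). -/
open MeasureTheory Finset Real

/-- The antiderivative `∫_u^π D_n` of the Dirichlet kernel, in closed form. -/
noncomputable def dirichletTail (n : ℕ) (u : ℝ) : ℝ :=
  (π - u) / 2 - ∑ j ∈ Finset.Icc 1 n, sin (j * u) / j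

lemma continuous_dirichletTail (n : ℕ) : Continuous (dirichletTail n) := by
  unfold dirichletTail
  fun_prop

lemma hasDerivAt_dirichletTail (n : ℕ) (u : ℝ) :
    HasDerivAt (dirichletTail n) (-dirichletKernel n u) u := by
  have hsum : HasDerivAt (fun u : ℝ => ∑ j ∈ Finset.Icc 1 n, sin (j * u) / j)
      (∑ j ∈ Finset.Icc 1 n, cos (j * u)) u := by
    refine HasDerivAt.fun_sum fun j hj => ?_
    have hj0 : (j : ℝ) ≠ 0 := by
      have := (Finset.mem_Icc.mp hj).1
      positivity
    have h := (((hasDerivAt_id u).const_mul (j : ℝ)).sin).div_const (j : ℝ)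
    simp only [id, mul_one] at h
    rwa [mul_div_assoc, div_self hj0, mul_one] at h
  refine ((((hasDerivAt_const u π).fun_sub (hasDerivAt_id u)).div_const 2).fun_sub
    hsum).congr_deriv ?_
  simp only [dirichletKernel]
  ring

lemma dirichletTail_pi (n : ℕ) : dirichletTail n π = 0 := by
  simp [dirichletTail, sin_nat_mul_pi]

lemma dirichletTail_two_pi_sub (n : ℕ) (u : ℝ) :
    dirichletTail n (2 * π - u) = -dirichletTail n u := by
  have h (j : ℕ) : sin (j * (2 * π - u)) = -sin (j * u) := by
    rw [mul_sub, sin_nat_mul_two_pi_sub]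
  simp only [dirichletTail, h, neg_div, Finset.sum_neg_distrib]
  ring

lemma abs_dirichletTail_le (n : ℕ) {u : ℝ} (hu : 0 ≤ u) (hu' : u ≤ π) :
    |dirichletTail n u| ≤ 2 + n * u := by
  have hsum : |∑ j ∈ Finset.Icc 1 n, sin (j * u) / j| ≤ n * u := by
    calc |∑ j ∈ Finset.Icc 1 n, sin (j * u) / j|
        ≤ ∑ j ∈ Finset.Icc 1 n, |sin (j * u) / j| := Finset.abs_sum_le_sum_abs _ _
      _ ≤ ∑ _j ∈ Finset.Icc 1 n, u := by
          refine Finset.sum_le_sum fun j hj => ?_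
          have hj0 : (0 : ℝ) < j := by
            have := (Finset.mem_Icc.mp hj).1
            positivity
          rw [abs_div, abs_of_pos hj0, div_le_iff₀ hj0]
          calc |sin (j * u)| ≤ |j * u| := abs_sin_le_abs
            _ = u * j := by rw [abs_of_nonneg (by positivity), mul_comm]
      _ = n * u := by simp
  have hπ : |(π - u) / 2| ≤ 2 := by
    rw [abs_of_nonneg (by linarith)]
    linarith [pi_lt_four]
  exact (abs_sub _ _).trans (add_le_add hπ hsum)

lemma dirichletKernel_mul_sin_sq (n : ℕ) (u : ℝ) :
    dirichletKernel n u * (4 * sin (u / 2) ^ 2) = cos (n * u) - cos ((n + 1) * u) := by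
  have hs : 4 * sin (u / 2) ^ 2 = 2 * (1 - cos u) := by
    have h := cos_two_mul' (u / 2)
    rw [mul_div_cancel₀ u two_ne_zero] at h
    nlinarith [sin_sq_add_cos_sq (u / 2)]
  rw [hs]
  induction n with
  | zero => simp [dirichletKernel]
  | succ n ih =>
    have hrec : dirichletKernel (n + 1) u = dirichletKernel n u + cos ((n + 1) * u) := by
      simp only [dirichletKernel, Finset.sum_Icc_succ_top (Nat.le_add_left 1 n)]
      push_cast
      ring
    have h1 : cos (n * u) = cos ((n + 1) * u - u) := by ring_nf
    have h2 : cos ((n + 1 + 1) * u) = cos ((n + 1) * u + u) := by ring_nf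
    rw [hrec, add_mul, ih]
    push_cast
    rw [h1, h2, cos_sub, cos_add]
    ring

lemma sum_dirichletKernel_mul_sin_sq (m : ℕ) (u : ℝ) :
    (∑ k ∈ Finset.range m, dirichletKernel k u) * (4 * sin (u / 2) ^ 2) = 1 - cos (m * u) := by
  rw [Finset.sum_mul]
  simp only [dirichletKernel_mul_sin_sq]
  have h := Finset.sum_range_sub' (fun k : ℕ => cos (k * u)) m
  simpa using h

/-- A function vanishing at the right end point is controlled by any majorant of its
derivative. -/
lemma abs_le_of_abs_deriv_le {a b : ℝ} (hab : a ≤ b) {Q B Q' B' : ℝ → ℝ}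
    (hQ : ∀ x ∈ Set.Icc a b, HasDerivAt Q (Q' x) x)
    (hB : ∀ x ∈ Set.Icc a b, HasDerivAt B (B' x) x)
    (hle : ∀ x ∈ Set.Icc a b, |Q' x| ≤ -B' x) (hQb : Q b = 0) (hBb : 0 ≤ B b) :
    |Q a| ≤ B a := by
  have key (s : ℝ) (hs : s = 1 ∨ s = -1) : s * Q a ≤ B a := by
    have hderiv (x) (hx : x ∈ Set.Icc a b) :
        HasDerivAt (fun x => B x - s * Q x) (B' x - s * Q' x) x :=
      (hB x hx).sub ((hQ x hx).const_mul s)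
    have hanti : AntitoneOn (fun x => B x - s * Q x) (Set.Icc a b) := by
      refine antitoneOn_of_hasDerivWithinAt_nonpos (convex_Icc a b)
        (fun x hx => (hderiv x hx).continuousAt.continuousWithinAt)
        (fun x hx => (hderiv x (interior_subset hx)).hasDerivWithinAt) fun x hx => ?_
      have h := abs_le.mp (hle x (interior_subset hx))
      rcases hs with rfl | rfl <;> linarith
    have h := hanti (Set.left_mem_Icc.mpr hab) (Set.right_mem_Icc.mpr hab) hab
    simp only [hQb] at h
    linarith
  rw [abs_le]
  constructor <;> linarith [key 1 (Or.inl rfl), key (-1) (Or.inr rfl)]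

/-- The oscillating part of `∑_{k < m} ∫_u^π D_k`, whose non-oscillating part is
`cot (u / 2) / 2`. -/
noncomputable def oscillatingTail (m : ℕ) (u : ℝ) : ℝ :=
  cos (u / 2) / (2 * sin (u / 2)) - ∑ k ∈ Finset.range m, dirichletTail k u

lemma sin_half_pos {u : ℝ} (hu : 0 < u) (hu' : u ≤ π) : 0 < sin (u / 2) :=
  sin_pos_of_pos_of_lt_pi (by linarith) (by linarith [pi_pos])

lemma hasDerivAt_sin_half (u : ℝ) : HasDerivAt (fun u : ℝ => sin (u / 2)) (cos (u / 2) / 2) u := by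
  have h := ((hasDerivAt_id u).div_const 2).sin
  simpa [div_eq_mul_inv] using h

lemma hasDerivAt_cos_half (u : ℝ) :
    HasDerivAt (fun u : ℝ => cos (u / 2)) (-(sin (u / 2) / 2)) u := by
  have h := ((hasDerivAt_id u).div_const 2).cos
  simpa [div_eq_mul_inv] using h

lemma hasDerivAt_half_cot_half {u : ℝ} (hs : 0 < sin (u / 2)) :
    HasDerivAt (fun u : ℝ => cos (u / 2) / (2 * sin (u / 2))) (-(1 / (4 * sin (u / 2) ^ 2))) u := by
  refine ((hasDerivAt_cos_half u).fun_div ((hasDerivAt_sin_half u).const_mul 2)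
    (by positivity)).congr_deriv ?_
  field_simp
  linarith [sin_sq_add_cos_sq (u / 2)]

lemma hasDerivAt_oscillatingTail (m : ℕ) {u : ℝ} (hs : 0 < sin (u / 2)) :
    HasDerivAt (oscillatingTail m) (-(cos (m * u) / (4 * sin (u / 2) ^ 2))) u := by
  have hsum : HasDerivAt (fun u => ∑ k ∈ Finset.range m, dirichletTail k u)
      (∑ k ∈ Finset.range m, -dirichletKernel k u) u :=
    HasDerivAt.fun_sum fun k _ => hasDerivAt_dirichletTail k u
  refine ((hasDerivAt_half_cot_half hs).fun_sub hsum).congr_deriv ?_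
  have h := sum_dirichletKernel_mul_sin_sq m u
  rw [← eq_div_iff (by positivity)] at h
  rw [Finset.sum_neg_distrib, h]
  ring

lemma oscillatingTail_pi (m : ℕ) : oscillatingTail m π = 0 := by
  simp [oscillatingTail, dirichletTail_pi]

lemma abs_oscillatingTail_le_half_cot (m : ℕ) {u : ℝ} (hu : 0 < u) (hu' : u ≤ π) :
    |oscillatingTail m u| ≤ cos (u / 2) / (2 * sin (u / 2)) := by
  have hs (x) (hx : x ∈ Set.Icc u π) : 0 < sin (x / 2) :=
    sin_half_pos (hu.trans_le hx.1) hx.2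
  refine abs_le_of_abs_deriv_le hu' (fun x hx => hasDerivAt_oscillatingTail m (hs x hx))
    (fun x hx => hasDerivAt_half_cot_half (hs x hx)) (fun x hx => ?_)
    (oscillatingTail_pi m) (by simp)
  have := hs x hx
  rw [neg_neg, abs_neg, abs_div, abs_of_pos (a := 4 * sin (x / 2) ^ 2) (by positivity)]
  gcongr
  exact abs_cos_le_one _

lemma abs_oscillatingTail_le_inv_sin_sq {m : ℕ} (hm : 0 < m) {u : ℝ} (hu : 0 < u) (hu' : u ≤ π) :
    |oscillatingTail m u| ≤ 1 / (2 * m * sin (u / 2) ^ 2) := by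
  have hs (x) (hx : x ∈ Set.Icc u π) : 0 < sin (x / 2) :=
    sin_half_pos (hu.trans_le hx.1) hx.2
  have hm0 : (0 : ℝ) < m := by exact_mod_cast hm
  have hQ (x) (hx : x ∈ Set.Icc u π) : HasDerivAt
      (fun x => oscillatingTail m x + sin (m * x) / (4 * m * sin (x / 2) ^ 2))
      (-(sin (m * x) * cos (x / 2) / (4 * m * sin (x / 2) ^ 3))) x := by
    have hs := hs x hx
    have hsin : HasDerivAt (fun x : ℝ => sin (m * x)) (cos (m * x) * m) x := by
      simpa using ((hasDerivAt_id x).const_mul (m : ℝ)).sin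
    refine ((hasDerivAt_oscillatingTail m hs).fun_add
      (hsin.fun_div (((hasDerivAt_sin_half x).fun_pow 2).const_mul (4 * (m : ℝ)))
        (by positivity))).congr_deriv ?_
    field_simp
    ring
  have hB (x) (hx : x ∈ Set.Icc u π) : HasDerivAt
      (fun x => 1 / (4 * m * sin (x / 2) ^ 2))
      (-(cos (x / 2) / (4 * m * sin (x / 2) ^ 3))) x := by
    have hs := hs x hx
    refine ((hasDerivAt_const x (1 : ℝ)).fun_div
      (((hasDerivAt_sin_half x).fun_pow 2).const_mul (4 * (m : ℝ)))
        (by positivity)).congr_deriv ?_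
    field_simp
    ring
  have h := abs_le_of_abs_deriv_le hu' hQ hB (fun x hx => ?_)
    (by simp [oscillatingTail_pi, sin_nat_mul_pi]) (by positivity)
  · have hsu := hs u ⟨le_rfl, hu'⟩
    have hb : |sin (m * u) / (4 * m * sin (u / 2) ^ 2)| ≤ 1 / (4 * m * sin (u / 2) ^ 2) := by
      rw [abs_div, abs_of_pos (a := 4 * m * sin (u / 2) ^ 2) (by positivity)]
      gcongr
      exact abs_sin_le_one _
    have htwo : 1 / (2 * m * sin (u / 2) ^ 2) =
        1 / (4 * m * sin (u / 2) ^ 2) + 1 / (4 * m * sin (u / 2) ^ 2) := by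
      field_simp
      norm_num
    rw [htwo]
    rw [abs_le] at h hb ⊢
    constructor <;> linarith [h.1, h.2, hb.1, hb.2]
  · have hsx := hs x hx
    have hc : 0 ≤ cos (x / 2) :=
      cos_nonneg_of_neg_pi_div_two_le_of_le (by linarith [hx.1, pi_pos]) (by linarith [hx.2])
    rw [neg_neg, abs_neg, abs_div, abs_of_pos (a := 4 * m * sin (x / 2) ^ 3) (by positivity),
      abs_mul, abs_of_nonneg hc]
    gcongr
    exact mul_le_of_le_one_left hc (abs_sin_le_one _)

lemma div_pi_le_sin_half {u : ℝ} (hu : 0 ≤ u) (hu' : u ≤ π) : u / π ≤ sin (u / 2) := by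
  have h := mul_le_sin (x := u / 2) (by linarith) (by linarith)
  calc u / π = 2 / π * (u / 2) := by ring
    _ ≤ _ := h

lemma half_cot_half_le {u : ℝ} (hu : 0 < u) (hu' : u ≤ π) :
    cos (u / 2) / (2 * sin (u / 2)) ≤ π / 2 * u⁻¹ := by
  have hπ := pi_pos
  calc cos (u / 2) / (2 * sin (u / 2)) ≤ 1 / (2 * (u / π)) := by
        gcongr
        · exact cos_le_one _
        · exact div_pi_le_sin_half hu.le hu'
    _ = π / 2 * u⁻¹ := by field_simp

lemma abs_oscillatingTail_le_rpow {γ : ℝ} (hγ : 0 < γ) (hγ' : γ ≤ 1) {m : ℕ} (hm : 0 < m)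
    {u : ℝ} (hu : 0 < u) (hu' : u ≤ π) :
    |oscillatingTail m u| ≤ 5 * ((m : ℝ) ^ (-γ) * u ^ (-1 - γ)) := by
  have hm0 : (0 : ℝ) < m := by exact_mod_cast hm
  have hπ := pi_pos
  have hπ' : π ^ 2 ≤ 10 := by nlinarith [pi_lt_d2]
  have hrw : (m : ℝ) ^ (-γ) * u ^ (-1 - γ) = u⁻¹ * (m * u) ^ (-γ) := by
    rw [mul_rpow hm0.le hu.le, sub_eq_add_neg, rpow_add hu, rpow_neg_one]
    ring
  rw [hrw]
  rcases le_total ((m : ℝ) * u) 1 with h1 | h1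
  · have hone : 1 ≤ ((m : ℝ) * u) ^ (-γ) :=
      one_le_rpow_of_pos_of_le_one_of_nonpos (by positivity) h1 (by linarith)
    calc |oscillatingTail m u| ≤ π / 2 * u⁻¹ :=
          (abs_oscillatingTail_le_half_cot m hu hu').trans (half_cot_half_le hu hu')
      _ ≤ 5 * u⁻¹ := by gcongr; linarith [pi_lt_four]
      _ ≤ 5 * (u⁻¹ * (m * u) ^ (-γ)) := by
          gcongr
          exact le_mul_of_one_le_right (by positivity) hone
  · have hle : ((m : ℝ) * u)⁻¹ ≤ (m * u) ^ (-γ) := by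
      rw [← rpow_neg_one]
      exact rpow_le_rpow_of_exponent_le h1 (by linarith)
    calc |oscillatingTail m u| ≤ 1 / (2 * m * sin (u / 2) ^ 2) :=
          abs_oscillatingTail_le_inv_sin_sq hm hu hu'
      _ ≤ 1 / (2 * m * (u / π) ^ 2) := by
          gcongr
          exact div_pi_le_sin_half hu.le hu'
      _ = π ^ 2 / 2 * (u⁻¹ * (m * u)⁻¹) := by field_simp
      _ ≤ 5 * (u⁻¹ * (m * u) ^ (-γ)) := by
          gcongr
          linarith

section HeadBoundedVariation

variable {c : ℕ → ℝ} {K : ℝ}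

lemma le_of_headBoundedVariation
    (hc : ∀ m, ∑ k ∈ Finset.range m, |c k - c (k + 1)| ≤ K * c m) {k m : ℕ} (hkm : k ≤ m) :
    c k ≤ (K + 1) * c m := by
  have h : c k ≤ c m + ∑ i ∈ Finset.range m, |c i - c (i + 1)| := by
    induction m, hkm using Nat.le_induction with
    | base => linarith [Finset.sum_nonneg fun i (_ : i ∈ Finset.range k) =>
        abs_nonneg (c i - c (i + 1))]
    | succ m _ ih =>
      rw [Finset.sum_range_succ]
      linarith [le_abs_self (c m - c (m + 1))]
  linarith [hc m]

lemma headBoundedVariation_mul (hc0 : ∀ k, 0 ≤ c k)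
    (hc : ∀ m, ∑ k ∈ Finset.range m, |c k - c (k + 1)| ≤ K * c m)
    {a : ℕ → ℝ} (ha : Monotone a) (ha0 : ∀ k, 0 ≤ a k) (hK : 0 ≤ K) (m : ℕ) :
    ∑ k ∈ Finset.range m, |a k * c k - a (k + 1) * c (k + 1)| ≤ (2 * K + 1) * (a m * c m) := by
  have hterm (k) (hk : k ∈ Finset.range m) : |a k * c k - a (k + 1) * c (k + 1)| ≤
      a m * |c k - c (k + 1)| + (a (k + 1) - a k) * ((K + 1) * c m) := by
    have hkm := Finset.mem_range.mp hk
    have hstep : 0 ≤ a (k + 1) - a k := sub_nonneg.mpr (ha k.le_succ)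
    calc |a k * c k - a (k + 1) * c (k + 1)|
        = |a k * (c k - c (k + 1)) - (a (k + 1) - a k) * c (k + 1)| := by ring_nf
      _ ≤ |a k * (c k - c (k + 1))| + |(a (k + 1) - a k) * c (k + 1)| := abs_sub _ _
      _ = a k * |c k - c (k + 1)| + (a (k + 1) - a k) * c (k + 1) := by
          rw [abs_mul, abs_mul, abs_of_nonneg (ha0 k), abs_of_nonneg hstep,
            abs_of_nonneg (hc0 (k + 1))]
      _ ≤ _ := by
          gcongr
          · exact ha hkm.le
          · exact le_of_headBoundedVariation hc hkm
  refine (Finset.sum_le_sum hterm).trans ?_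
  rw [Finset.sum_add_distrib, ← Finset.mul_sum, ← Finset.sum_mul, Finset.sum_range_sub]
  nlinarith [mul_le_mul_of_nonneg_left (hc m) (ha0 m),
    mul_nonneg (ha0 0) (mul_nonneg (by linarith : 0 ≤ K + 1) (hc0 m))]

lemma sum_abs_sub_div_le (hc0 : ∀ k, 0 ≤ c k)
    (hc : ∀ m, ∑ k ∈ Finset.range m, |c k - c (k + 1)| ≤ K * c m)
    {x : ℕ → ℝ} (hx : Monotone x) (hx0 : ∀ k, 0 < x k) (hx2 : ∀ k, x (k + 1) ≤ 2 * x k)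
    (hK : 0 ≤ K) (n : ℕ) :
    ∑ k ∈ Finset.range n, |x k ^ 2 * c k - x (k + 1) ^ 2 * c (k + 1)| / x k ≤
      (4 * K + 3) * (x n * c n) := by
  have hterm (k) (hk : k ∈ Finset.range n) :
      |x k ^ 2 * c k - x (k + 1) ^ 2 * c (k + 1)| / x k ≤
      x n * |c k - c (k + 1)| + (x (k + 1) - x k) * (3 * ((K + 1) * c n)) := by
    have hkn := Finset.mem_range.mp hk
    have hxk := hx0 k
    have hstep : 0 ≤ x (k + 1) - x k := sub_nonneg.mpr (hx k.le_succ)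
    have hsum : 0 ≤ x (k + 1) + x k := by linarith [hx0 (k + 1)]
    rw [div_le_iff₀ hxk]
    calc |x k ^ 2 * c k - x (k + 1) ^ 2 * c (k + 1)|
        = |x k ^ 2 * (c k - c (k + 1)) -
            (x (k + 1) - x k) * (x (k + 1) + x k) * c (k + 1)| := by ring_nf
      _ ≤ |x k ^ 2 * (c k - c (k + 1))| +
            |(x (k + 1) - x k) * (x (k + 1) + x k) * c (k + 1)| := abs_sub _ _
      _ = x k * |c k - c (k + 1)| * x k +
            (x (k + 1) - x k) * (x (k + 1) + x k) * c (k + 1) := by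
          rw [abs_mul, abs_mul, abs_mul, abs_of_nonneg hstep, abs_of_nonneg hsum,
            abs_of_nonneg (hc0 (k + 1)), abs_of_nonneg (by positivity : 0 ≤ x k ^ 2)]
          ring
      _ ≤ x n * |c k - c (k + 1)| * x k +
            (x (k + 1) - x k) * (3 * x k) * ((K + 1) * c n) := by
          have := hc0 (k + 1)
          gcongr
          · exact hx hkn.le
          · linarith [hx2 k]
          · exact le_of_headBoundedVariation hc hkn
      _ = _ := by ring
  refine (Finset.sum_le_sum hterm).trans ?_
  rw [Finset.sum_add_distrib, ← Finset.mul_sum, ← Finset.sum_mul, Finset.sum_range_sub]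
  nlinarith [mul_le_mul_of_nonneg_left (hc n) (hx0 n).le,
    mul_nonneg (hx0 0).le (mul_nonneg (by linarith : 0 ≤ K + 1) (hc0 n))]

end HeadBoundedVariation

/-- If `((k+1)^{-β} w_k)` has head bounded variation, then the weighted total variation of `w`
up to `n` is controlled by its last term. -/
lemma exists_weighted_variation_le {w : ℕ → ℝ} (hw : ∀ k, 0 < w k) {β K : ℝ} (hβ : 0 < β)
    (hHBVS : ∀ m : ℕ, ∑ k ∈ Finset.range m,
        |((k : ℝ) + 1) ^ (-β) * w k - ((k : ℝ) + 2) ^ (-β) * w (k + 1)| ≤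
          K * (((m : ℝ) + 1) ^ (-β) * w m)) :
    ∃ γ : ℝ, 0 < γ ∧ γ ≤ 1 ∧ ∃ M : ℝ, 0 ≤ M ∧ ∀ n : ℕ,
      w 0 + ∑ k ∈ Finset.range n, |w k - w (k + 1)| * ((k : ℝ) + 1) ^ (-γ) +
        w n * ((n : ℝ) + 1) ^ (-γ) ≤ M * (w n * ((n : ℝ) + 1) ^ (-γ)) := by
  have hK : 0 ≤ K := by
    have h := hHBVS 0
    simp only [Finset.range_zero, Finset.sum_empty, Nat.cast_zero, zero_add, one_rpow, one_mul] at h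
    exact nonneg_of_mul_nonneg_left h (hw 0)
  set c : ℕ → ℝ := fun k => ((k : ℝ) + 1) ^ (-β) * w k with hc_def
  have hc0 (k) : 0 ≤ c k := by have := hw k; positivity
  have hc (m) : ∑ k ∈ Finset.range m, |c k - c (k + 1)| ≤ K * c m := by
    have hsucc (k : ℕ) : c (k + 1) = ((k : ℝ) + 2) ^ (-β) * w (k + 1) := by
      rw [hc_def, show (k : ℝ) + 2 = ((k + 1 : ℕ) : ℝ) + 1 by push_cast; ring]
    simp only [hsucc]
    exact hHBVS m
  set γ := min (β / 2) 1
  have hγ : 0 < γ := lt_min (by linarith) one_pos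
  have hγ1 : γ ≤ 1 := min_le_right _ _
  have hγβ : 0 ≤ β - 2 * γ := by linarith [min_le_left (β / 2) 1]
  have hmono {s : ℝ} (hs : 0 ≤ s) : Monotone fun k : ℕ => ((k : ℝ) + 1) ^ s := fun i j hij => by
    have : (i : ℝ) ≤ j := by exact_mod_cast hij
    exact rpow_le_rpow (by positivity) (by linarith) hs
  set e : ℕ → ℝ := fun k => ((k : ℝ) + 1) ^ (β - 2 * γ) * c k with he_def
  have he0 (k) : 0 ≤ e k := by have := hc0 k; positivity
  have he (m) : ∑ k ∈ Finset.range m, |e k - e (k + 1)| ≤ (2 * K + 1) * e m :=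
    headBoundedVariation_mul hc0 hc (hmono hγβ) (fun k => by positivity) hK m
  set x : ℕ → ℝ := fun k => ((k : ℝ) + 1) ^ γ with hx_def
  have hx0 (k) : 0 < x k := by positivity
  have hx2 (k) : x (k + 1) ≤ 2 * x k := by
    calc x (k + 1) ≤ (2 * ((k : ℝ) + 1)) ^ γ := by
          refine rpow_le_rpow (by positivity) ?_ hγ.le
          push_cast
          linarith [k.cast_nonneg (α := ℝ)]
      _ = 2 ^ γ * x k := mul_rpow (by norm_num) (by positivity)
      _ ≤ 2 ^ (1 : ℝ) * x k := by
          have := hx0 k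
          gcongr
          norm_num
      _ = 2 * x k := by rw [rpow_one]
  have hxe (k) : x k ^ 2 * e k = w k := by
    have hk : (0 : ℝ) < (k : ℝ) + 1 := by positivity
    simp only [hx_def, he_def, hc_def]
    rw [← rpow_natCast, ← rpow_mul hk.le, ← mul_assoc, ← mul_assoc, ← rpow_add hk, ← rpow_add hk]
    push_cast
    ring_nf
    simp
  have hxinv (k : ℕ) : ((k : ℝ) + 1) ^ (-γ) = (x k)⁻¹ := rpow_neg (by positivity) γ
  have hwx (k) : w k * (x k)⁻¹ = x k * e k := by
    rw [← hxe k]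
    have := (hx0 k).ne'
    field_simp
  refine ⟨γ, hγ, hγ1, (2 * K + 1 + 1) + (4 * (2 * K + 1) + 3) + 1, by positivity, fun n => ?_⟩
  have hsum := sum_abs_sub_div_le (x := x) he0 he (hmono hγ.le) hx0 hx2 (by positivity) n
  simp only [hxe, div_eq_mul_inv] at hsum
  have hzero : w 0 ≤ (2 * K + 1 + 1) * (x n * e n) := by
    have h0 : w 0 = e 0 := by rw [← hxe 0]; simp [hx_def]
    have hxn : 1 ≤ x n := one_le_rpow (by linarith [n.cast_nonneg (α := ℝ)]) hγ.le
    rw [h0]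
    refine (le_of_headBoundedVariation he n.zero_le).trans ?_
    gcongr
    exact le_mul_of_one_le_left (he0 n) hxn
  simp only [hxinv, hwx]
  linarith

/-- `∫_u^π` of the kernel of the Riesz means with weights `w`. -/
noncomputable def rieszTail (w : ℕ → ℝ) (n : ℕ) (u : ℝ) : ℝ :=
  (1 / ∑ k ∈ Finset.range (n + 1), w k) * ∑ k ∈ Finset.range (n + 1), w k * dirichletTail k u

lemma continuous_rieszTail (w : ℕ → ℝ) (n : ℕ) : Continuous (rieszTail w n) := by
  unfold rieszTail
  have := continuous_dirichletTail
  fun_prop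

lemma rieszTail_two_pi_sub (w : ℕ → ℝ) (n : ℕ) (u : ℝ) :
    rieszTail w n (2 * π - u) = -rieszTail w n u := by
  simp [rieszTail, dirichletTail_two_pi_sub]

lemma abs_rieszTail_le {w : ℕ → ℝ} (hw : ∀ k, 0 < w k) (n : ℕ) {u : ℝ} (hu : 0 ≤ u)
    (hu' : u ≤ π) : |rieszTail w n u| ≤ 2 + n * u := by
  have hP : 0 < ∑ k ∈ Finset.range (n + 1), w k :=
    Finset.sum_pos (fun k _ => hw k) Finset.nonempty_range_add_one
  rw [rieszTail, abs_mul, abs_of_pos (by positivity), one_div, inv_mul_le_iff₀ hP, Finset.sum_mul]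
  refine (Finset.abs_sum_le_sum_abs _ _).trans (Finset.sum_le_sum fun k hk => ?_)
  rw [abs_mul, abs_of_pos (hw k)]
  have hkn : (k : ℝ) ≤ n := by exact_mod_cast Nat.lt_succ_iff.mp (Finset.mem_range.mp hk)
  have := hw k
  gcongr
  exact (abs_dirichletTail_le k hu hu').trans (by gcongr)

lemma sum_mul_dirichletTail (w : ℕ → ℝ) (n : ℕ) (u : ℝ) :
    ∑ k ∈ Finset.range (n + 1), w k * dirichletTail k u =
      w 0 * (cos (u / 2) / (2 * sin (u / 2))) -
        ∑ k ∈ Finset.range n, (w k - w (k + 1)) * oscillatingTail (k + 1) u -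
        w n * oscillatingTail (n + 1) u := by
  induction n with
  | zero =>
    simp only [oscillatingTail, zero_add, Finset.sum_range_one, Finset.range_zero,
      Finset.sum_empty]
    ring
  | succ n ih =>
    have h : oscillatingTail (n + 1 + 1) u =
        oscillatingTail (n + 1) u - dirichletTail (n + 1) u := by
      simp only [oscillatingTail, Finset.sum_range_succ _ (n + 1)]
      ring
    rw [Finset.sum_range_succ, ih, Finset.sum_range_succ _ n, h]
    ring

lemma abs_sum_mul_dirichletTail_le {w : ℕ → ℝ} (hw : ∀ k, 0 < w k) {γ : ℝ} (hγ : 0 < γ)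
    (hγ1 : γ ≤ 1) (n : ℕ) {u : ℝ} (hu : 0 < u) (hu' : u ≤ π) :
    |∑ k ∈ Finset.range (n + 1), w k * dirichletTail k u| ≤
      5 * u ^ (-1 - γ) * (w 0 + ∑ k ∈ Finset.range n, |w k - w (k + 1)| * ((k : ℝ) + 1) ^ (-γ) +
        w n * ((n : ℝ) + 1) ^ (-γ)) := by
  have hosc (k : ℕ) :
      |oscillatingTail (k + 1) u| ≤ 5 * u ^ (-1 - γ) * ((k : ℝ) + 1) ^ (-γ) := by
    have h := abs_oscillatingTail_le_rpow hγ hγ1 k.succ_pos hu hu'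
    push_cast at h
    linarith
  have hcot : |cos (u / 2) / (2 * sin (u / 2))| ≤ 5 * u ^ (-1 - γ) := by
    have h := abs_oscillatingTail_le_half_cot 0 hu hu'
    have hnonneg := (abs_nonneg _).trans h
    rw [abs_of_nonneg hnonneg]
    refine (half_cot_half_le hu hu').trans ?_
    have hπγ : u ^ γ ≤ π :=
      calc u ^ γ ≤ π ^ γ := rpow_le_rpow hu.le hu' hγ.le
        _ ≤ π ^ (1 : ℝ) := rpow_le_rpow_of_exponent_le (by linarith [pi_gt_three]) hγ1
        _ = π := rpow_one π
    have hsplit : u⁻¹ = u ^ (-1 - γ) * u ^ γ := by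
      rw [← rpow_add hu, sub_add_cancel, rpow_neg_one]
    have hpos : 0 < u ^ (-1 - γ) := by positivity
    have hπ := pi_pos
    calc π / 2 * u⁻¹ = π / 2 * (u ^ (-1 - γ) * u ^ γ) := by rw [hsplit]
      _ ≤ π / 2 * (u ^ (-1 - γ) * π) := by gcongr
      _ ≤ 5 * u ^ (-1 - γ) := by
          have hπ2 : π ^ 2 ≤ 10 := by nlinarith [pi_lt_d2]
          nlinarith [mul_le_mul_of_nonneg_right hπ2 hpos.le]
  rw [sum_mul_dirichletTail]
  have hw0 := hw 0
  have hwn := hw n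
  calc _ ≤ |w 0 * (cos (u / 2) / (2 * sin (u / 2)))| +
        |∑ k ∈ Finset.range n, (w k - w (k + 1)) * oscillatingTail (k + 1) u| +
        |w n * oscillatingTail (n + 1) u| :=
        (abs_sub _ _).trans (add_le_add_left (abs_sub _ _) _)
    _ ≤ w 0 * (5 * u ^ (-1 - γ)) +
        ∑ k ∈ Finset.range n, |w k - w (k + 1)| * (5 * u ^ (-1 - γ) * ((k : ℝ) + 1) ^ (-γ)) +
        w n * (5 * u ^ (-1 - γ) * ((n : ℝ) + 1) ^ (-γ)) := by
        rw [abs_mul, abs_mul, abs_of_pos hw0, abs_of_pos hwn]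
        gcongr
        · refine (Finset.abs_sum_le_sum_abs _ _).trans (Finset.sum_le_sum fun k _ => ?_)
          rw [abs_mul]
          gcongr
          exact hosc k
        · exact hosc n
    _ = _ := by
        rw [mul_add, mul_add, Finset.mul_sum]
        congr 1
        · congr 1
          · ring
          · exact Finset.sum_congr rfl fun k _ => by ring
        · ring

lemma integral_abs_le_of_rpow_bound {E : ℝ → ℝ} (hE : Continuous E) {N A B γ : ℝ} (hN : 1 ≤ N)
    (hB : 0 ≤ B) (hγ : 0 < γ) (hsmall : ∀ u, 0 ≤ u → u ≤ 1 / N → |E u| ≤ A)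
    (hlarge : ∀ u, 0 < u → u ≤ π → |E u| ≤ B * N ^ (-1 - γ) * u ^ (-1 - γ)) :
    ∫ u in (0 : ℝ)..π, |E u| ≤ (A + B / γ) / N := by
  have hN0 : 0 < N := by linarith
  have hNinv : 0 < 1 / N := by positivity
  have hNπ : 1 / N ≤ π := ((div_le_one hN0).mpr hN).trans (by linarith [pi_gt_three])
  have hint (a b : ℝ) : IntervalIntegrable (fun u => |E u|) volume a b :=
    hE.abs.intervalIntegrable a b
  rw [← intervalIntegral.integral_add_adjacent_intervals (hint 0 (1 / N)) (hint (1 / N) π)]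
  have h1 : ∫ u in (0 : ℝ)..(1 / N), |E u| ≤ A / N := by
    calc ∫ u in (0 : ℝ)..(1 / N), |E u| ≤ ∫ _u in (0 : ℝ)..(1 / N), A :=
          intervalIntegral.integral_mono_on hNinv.le (hint _ _) (by simp)
            fun u hu => hsmall u hu.1 hu.2
      _ = A / N := by simp; ring
  have hzero : (0 : ℝ) ∉ Set.uIcc (1 / N) π := by
    rw [Set.uIcc_of_le hNπ]
    exact fun h => absurd h.1 (not_le.mpr hNinv)
  have h2 : ∫ u in (1 / N)..π, |E u| ≤ B / γ / N := by
    calc ∫ u in (1 / N)..π, |E u|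
        ≤ ∫ u in (1 / N)..π, B * N ^ (-1 - γ) * u ^ (-1 - γ) := by
          refine intervalIntegral.integral_mono_on hNπ (hint _ _)
            ((intervalIntegral.intervalIntegrable_rpow (Or.inr hzero)).const_mul _)
            fun u hu => hlarge u (hNinv.trans_le hu.1) hu.2
      _ = B * N ^ (-1 - γ) * ((N ^ γ - π ^ (-γ)) / γ) := by
          rw [intervalIntegral.integral_const_mul,
            integral_rpow (Or.inr ⟨by linarith, hzero⟩)]
          have h1N : (1 / N) ^ (-γ) = N ^ γ := by
            rw [one_div, inv_rpow hN0.le, rpow_neg hN0.le, inv_inv]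
          rw [show -1 - γ + 1 = -γ by ring, h1N]
          congr 1
          field_simp
          ring
      _ ≤ B * N ^ (-1 - γ) * (N ^ γ / γ) := by
          have : 0 < π ^ (-γ) := rpow_pos_of_pos pi_pos _
          gcongr
          linarith
      _ = B / γ / N := by
          have : N ^ (-1 - γ) * N ^ γ = N⁻¹ := by
            rw [← rpow_add hN0, sub_add_cancel, rpow_neg_one]
          calc B * N ^ (-1 - γ) * (N ^ γ / γ) = B / γ * (N ^ (-1 - γ) * N ^ γ) := by ring
            _ = B / γ / N := by rw [this]; ring
  calc _ ≤ A / N + B / γ / N := add_le_add h1 h2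
    _ = _ := by ring

lemma integral_two_pi_abs_eq {E : ℝ → ℝ} (hE : Continuous E)
    (hodd : ∀ u, E (2 * π - u) = -E u) :
    ∫ u in (0 : ℝ)..(2 * π), |E u| = 2 * ∫ u in (0 : ℝ)..π, |E u| := by
  have hint (a b : ℝ) : IntervalIntegrable (fun u => |E u|) volume a b :=
    hE.abs.intervalIntegrable a b
  have h := intervalIntegral.integral_comp_sub_left (fun u => |E u|) (a := 0) (b := π) (2 * π)
  simp only [hodd, abs_neg, sub_zero] at h
  rw [show 2 * π - π = π by ring] at h
  rw [← intervalIntegral.integral_add_adjacent_intervals (hint 0 π) (hint π (2 * π)), ← h]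
  ring

lemma exists_integral_abs_rieszTail_le {w : ℕ → ℝ} (hw : ∀ k, 0 < w k) {β K C : ℝ} (hβ : 0 < β)
    (hHBVS : ∀ m : ℕ, ∑ k ∈ Finset.range m,
        |((k : ℝ) + 1) ^ (-β) * w k - ((k : ℝ) + 2) ^ (-β) * w (k + 1)| ≤
          K * (((m : ℝ) + 1) ^ (-β) * w m))
    (hO : ∀ n : ℕ, ((n : ℝ) + 1) * w n ≤ C * ∑ k ∈ Finset.range (n + 1), w k) :
    ∃ D : ℝ, 0 ≤ D ∧ ∀ n : ℕ,
      ∫ u in (0 : ℝ)..(2 * π), |rieszTail w n u| ≤ D / ((n : ℝ) + 1) := by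
  obtain ⟨γ, hγ, hγ1, M, hM, hvar⟩ := exists_weighted_variation_le hw hβ hHBVS
  have hC : 0 ≤ C := by
    have h := hO 0
    simp only [Nat.cast_zero, zero_add, one_mul, Finset.sum_range_one] at h
    exact nonneg_of_mul_nonneg_left ((hw 0).le.trans h) (hw 0)
  refine ⟨2 * (3 + 5 * M * C / γ), by positivity, fun n => ?_⟩
  have hP : 0 < ∑ k ∈ Finset.range (n + 1), w k :=
    Finset.sum_pos (fun k _ => hw k) Finset.nonempty_range_add_one
  have hN : (0 : ℝ) < (n : ℝ) + 1 := by positivity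
  rw [integral_two_pi_abs_eq (continuous_rieszTail w n) (rieszTail_two_pi_sub w n), mul_div_assoc]
  gcongr
  refine integral_abs_le_of_rpow_bound (continuous_rieszTail w n)
    (by linarith [n.cast_nonneg (α := ℝ)]) (by positivity) hγ (fun u hu hu' => ?_)
    fun u hu hu' => ?_
  · have hle : u * ((n : ℝ) + 1) ≤ 1 := (le_div_iff₀ hN).mp hu'
    have huπ : u ≤ π := by nlinarith [pi_gt_three, n.cast_nonneg (α := ℝ)]
    linarith [abs_rieszTail_le hw n hu huπ]
  · have hpow : ((n : ℝ) + 1) ^ (-1 - γ) = ((n : ℝ) + 1)⁻¹ * ((n : ℝ) + 1) ^ (-γ) := by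
      rw [sub_eq_add_neg, rpow_add hN, rpow_neg_one]
    have hwn : w n ≤ C * (∑ k ∈ Finset.range (n + 1), w k) * ((n : ℝ) + 1)⁻¹ := by
      rw [← div_eq_mul_inv, le_div_iff₀ hN]
      linarith [hO n]
    rw [rieszTail, abs_mul, abs_of_pos (by positivity), one_div, inv_mul_le_iff₀ hP]
    calc _ ≤ 5 * u ^ (-1 - γ) * (M * (w n * ((n : ℝ) + 1) ^ (-γ))) :=
          (abs_sum_mul_dirichletTail_le hw hγ hγ1 n hu hu').trans (by gcongr; exact hvar n)
      _ ≤ 5 * u ^ (-1 - γ) * (M * (C * (∑ k ∈ Finset.range (n + 1), w k) * ((n : ℝ) + 1)⁻¹ *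
            ((n : ℝ) + 1) ^ (-γ))) := by gcongr
      _ = _ := by rw [hpow]; ring

section Convolution

variable {f : ℝ → ℝ}

lemma intervalIntegrable_of_periodic (hper : Function.Periodic f (2 * π))
    (hint : IntervalIntegrable f volume 0 (2 * π)) (a b : ℝ) : IntervalIntegrable f volume a b :=
  hper.intervalIntegrable (t := 0) (by positivity) (by simpa using hint) a b

lemma locallyIntegrable_of_intervalIntegrable (hf : ∀ a b : ℝ, IntervalIntegrable f volume a b) :
    LocallyIntegrable f volume := by
  intro x
  refine ⟨Set.Ioc (x - 1) (x + 1), Ioc_mem_nhds (by linarith) (by linarith), ?_⟩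
  exact (intervalIntegrable_iff_integrableOn_Ioc_of_le (by linarith)).mp (hf _ _)

lemma intervalIntegrable_comp_const_sub (hf : ∀ a b : ℝ, IntervalIntegrable f volume a b)
    (x a b : ℝ) : IntervalIntegrable (fun u => f (x - u)) volume a b := by
  simpa using (hf (x - a) (x - b)).comp_sub_left x

lemma integral_sub_two_pi_eq {g : ℝ → ℝ} (hg : Function.Periodic g (2 * π)) (x : ℝ) :
    ∫ y in (x - 2 * π)..x, g y = ∫ y in (0 : ℝ)..(2 * π), g y := by
  simpa using hg.intervalIntegral_add_eq (x - 2 * π) 0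

lemma periodic_mul_cos (hper : Function.Periodic f (2 * π)) (j : ℕ) :
    Function.Periodic (fun y => f y * cos (j * y)) (2 * π) := fun y => by
  simp only [hper y, mul_add, cos_add_nat_mul_two_pi]

lemma periodic_mul_sin (hper : Function.Periodic f (2 * π)) (j : ℕ) :
    Function.Periodic (fun y => f y * sin (j * y)) (2 * π) := fun y => by
  simp only [hper y, mul_add, sin_add_nat_mul_two_pi]

lemma pi_mul_partialFourierSum (hf : ∀ a b : ℝ, IntervalIntegrable f volume a b)
    (n : ℕ) (x : ℝ) :
    π * partialFourierSum f n x = (∫ y in (0 : ℝ)..(2 * π), f y) / 2 +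
      ∑ j ∈ Finset.Icc 1 n, (cos (j * x) * (∫ y in (0 : ℝ)..(2 * π), f y * cos (j * y)) +
        sin (j * x) * ∫ y in (0 : ℝ)..(2 * π), f y * sin (j * y)) := by
  have hc (j : ℕ) : IntervalIntegrable (fun y => f y * cos (j * y)) volume 0 (2 * π) :=
    (hf _ _).mul_continuousOn (by fun_prop)
  have hs (j : ℕ) : IntervalIntegrable (fun y => f y * sin (j * y)) volume 0 (2 * π) :=
    (hf _ _).mul_continuousOn (by fun_prop)
  have hexp (y : ℝ) : f y * dirichletKernel n (x - y) = f y * (1 / 2) +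
      ∑ j ∈ Finset.Icc 1 n,
        (cos (j * x) * (f y * cos (j * y)) + sin (j * x) * (f y * sin (j * y))) := by
    simp only [dirichletKernel, mul_sub, cos_sub, mul_add, Finset.mul_sum]
    congr 1
    exact Finset.sum_congr rfl fun j _ => by ring
  rw [partialFourierSum, ← mul_assoc, mul_one_div_cancel pi_ne_zero, one_mul]
  simp only [hexp]
  rw [intervalIntegral.integral_add ((hf _ _).mul_const _)
      (by
        simpa only [Finset.sum_fn] using IntervalIntegrable.sum (Finset.Icc 1 n)
          fun j _ => ((hc j).const_mul (cos (j * x))).add ((hs j).const_mul (sin (j * x)))),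
    intervalIntegral.integral_finsetSum
      fun j _ => ((hc j).const_mul _).add ((hs j).const_mul _)]
  rw [intervalIntegral.integral_mul_const]
  congr 1
  · ring
  · refine Finset.sum_congr rfl fun j _ => ?_
    rw [intervalIntegral.integral_add ((hc j).const_mul _) ((hs j).const_mul _),
      intervalIntegral.integral_const_mul, intervalIntegral.integral_const_mul]

lemma integral_comp_sub_mul_dirichletTail (hper : Function.Periodic f (2 * π))
    (hf : ∀ a b : ℝ, IntervalIntegrable f volume a b) (n : ℕ) (x : ℝ) :
    ∫ u in (0 : ℝ)..(2 * π), f (x - u) * dirichletTail n u =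
      (π - x) / 2 * (∫ y in (0 : ℝ)..(2 * π), f y) +
      ((∫ y in (0 : ℝ)..x, y * f y) - ∫ y in (0 : ℝ)..(x - 2 * π), y * f y) / 2 -
      ∑ j ∈ Finset.Icc 1 n, (sin (j * x) * (∫ y in (0 : ℝ)..(2 * π), f y * cos (j * y)) -
        cos (j * x) * ∫ y in (0 : ℝ)..(2 * π), f y * sin (j * y)) / j := by
  have hc (j : ℕ) (a b : ℝ) : IntervalIntegrable (fun y => f y * cos (j * y)) volume a b :=
    (hf _ _).mul_continuousOn (by fun_prop)
  have hs (j : ℕ) (a b : ℝ) : IntervalIntegrable (fun y => f y * sin (j * y)) volume a b :=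
    (hf _ _).mul_continuousOn (by fun_prop)
  have hid (a b : ℝ) : IntervalIntegrable (fun y => y * f y) volume a b :=
    (hf _ _).continuousOn_mul (by fun_prop)
  have hosc (j : ℕ) : IntervalIntegrable (fun y => (sin (j * x) * (f y * cos (j * y)) -
      cos (j * x) * (f y * sin (j * y))) / j) volume (x - 2 * π) x :=
    (((hc j _ _).const_mul _).sub ((hs j _ _).const_mul _)).div_const _
  have hexp (y : ℝ) : f y * dirichletTail n (x - y) = ((π - x) / 2 * f y + y * f y / 2) -
      ∑ j ∈ Finset.Icc 1 n,
        (sin (j * x) * (f y * cos (j * y)) - cos (j * x) * (f y * sin (j * y))) / j := by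
    simp only [dirichletTail, mul_sub, sin_sub, Finset.mul_sum]
    congr 1
    · ring
    · exact Finset.sum_congr rfl fun j _ => by ring
  have hsubst := intervalIntegral.integral_comp_sub_left
    (fun y => f y * dirichletTail n (x - y)) (a := 0) (b := 2 * π) x
  simp only [sub_sub_cancel, sub_zero, hexp] at hsubst
  rw [hsubst, intervalIntegral.integral_sub
      (((hf _ _).const_mul _).add ((hid _ _).div_const _))
      (by
        simpa only [Finset.sum_fn] using IntervalIntegrable.sum (Finset.Icc 1 n)
          fun j _ => hosc j),
    intervalIntegral.integral_add ((hf _ _).const_mul _) ((hid _ _).div_const _),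
    intervalIntegral.integral_finsetSum fun j _ => hosc j,
    intervalIntegral.integral_const_mul, intervalIntegral.integral_div,
    integral_sub_two_pi_eq hper, intervalIntegral.integral_interval_sub_left (hid _ _) (hid _ _)]
  congr 1
  refine Finset.sum_congr rfl fun j _ => ?_
  rw [intervalIntegral.integral_div, intervalIntegral.integral_sub ((hc j _ _).const_mul _)
    ((hs j _ _).const_mul _), intervalIntegral.integral_const_mul,
    intervalIntegral.integral_const_mul, integral_sub_two_pi_eq (periodic_mul_cos hper j),
    integral_sub_two_pi_eq (periodic_mul_sin hper j)]

lemma continuous_integral_comp_sub_mul_dirichletTail (hper : Function.Periodic f (2 * π))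
    (hf : ∀ a b : ℝ, IntervalIntegrable f volume a b) (n : ℕ) :
    Continuous fun x => ∫ u in (0 : ℝ)..(2 * π), f (x - u) * dirichletTail n u := by
  have hid (a b : ℝ) : IntervalIntegrable (fun y => y * f y) volume a b :=
    (hf _ _).continuousOn_mul (by fun_prop)
  have hG : Continuous fun x => ∫ y in (0 : ℝ)..x, y * f y :=
    intervalIntegral.continuous_primitive hid 0
  have hG' : Continuous fun x => ∫ y in (0 : ℝ)..(x - 2 * π), y * f y :=
    hG.comp (continuous_sub_right (2 * π))
  simp only [integral_comp_sub_mul_dirichletTail hper hf]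
  fun_prop

lemma ae_hasDerivAt_integral_comp_sub_mul_dirichletTail (hper : Function.Periodic f (2 * π))
    (hf : ∀ a b : ℝ, IntervalIntegrable f volume a b) :
    ∀ᵐ x, ∀ n : ℕ, HasDerivAt (fun x => ∫ u in (0 : ℝ)..(2 * π), f (x - u) * dirichletTail n u)
      (π * (f x - partialFourierSum f n x)) x := by
  have hid : LocallyIntegrable (fun y => y * f y) volume :=
    locallyIntegrable_of_intervalIntegrable fun a b => (hf _ _).continuousOn_mul (by fun_prop)
  have hderiv := LocallyIntegrable.ae_hasDerivAt_integral hid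
  have hderiv' := (measurePreserving_sub_right volume (2 * π)).quasiMeasurePreserving.ae hderiv
  filter_upwards [hderiv, hderiv'] with x hx hx' n
  simp only [integral_comp_sub_mul_dirichletTail hper hf]
  have hG := hx 0
  have hG' := (hx' 0).comp_sub_const x (2 * π)
  have hfx : f (x - 2 * π) = f x := hper.sub_eq x
  have hsum : HasDerivAt (fun x : ℝ => ∑ j ∈ Finset.Icc 1 n,
      (sin (j * x) * (∫ y in (0 : ℝ)..(2 * π), f y * cos (j * y)) -
        cos (j * x) * ∫ y in (0 : ℝ)..(2 * π), f y * sin (j * y)) / j)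
      (∑ j ∈ Finset.Icc 1 n, (cos (j * x) * (∫ y in (0 : ℝ)..(2 * π), f y * cos (j * y)) +
        sin (j * x) * ∫ y in (0 : ℝ)..(2 * π), f y * sin (j * y))) x := by
    refine HasDerivAt.fun_sum fun j hj => ?_
    have hj0 : (j : ℝ) ≠ 0 := by
      have := (Finset.mem_Icc.mp hj).1
      positivity
    have hmul : HasDerivAt (fun x : ℝ => (j : ℝ) * x) j x := by
      simpa using (hasDerivAt_id x).const_mul (j : ℝ)
    refine (((hmul.sin.mul_const _).fun_sub (hmul.cos.mul_const _)).div_const _).congr_deriv ?_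
    field_simp
    ring
  have hlin : HasDerivAt (fun x : ℝ => (π - x) / 2) (-1 / 2) x :=
    ((hasDerivAt_id x).const_sub π).div_const 2
  refine (((hlin.mul_const _).fun_add ((hG.fun_sub hG').div_const 2)).fun_sub hsum).congr_deriv ?_
  rw [mul_sub, pi_mul_partialFourierSum hf, hfx]
  ring

lemma lintegral_translate_sub_le_s16 (hper : Function.Periodic f (2 * π))
    (hf : ∀ a b : ℝ, IntervalIntegrable f volume a b) {h B : ℝ}
    (hB : ∫ x in (0 : ℝ)..(2 * π), |f (x + h) - f x| ≤ B) (u : ℝ) :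
    ∫⁻ x in Set.Ioc 0 (2 * π), ‖f (x + h - u) - f (x - u)‖ₑ ≤ ENNReal.ofReal B := by
  have hg (a b : ℝ) : IntervalIntegrable (fun x => f (x + h) - f x) volume a b := by
    refine IntervalIntegrable.sub ?_ (hf a b)
    simpa using (hf (a + h) (b + h)).comp_add_right h
  have hgper : Function.Periodic (fun x => |f (x + h) - f x|) (2 * π) := fun x => by
    simp only [show x + 2 * π + h = x + h + 2 * π by ring, hper (x + h), hper x]
  have hgu : IntervalIntegrable (fun x => f (x + h - u) - f (x - u)) volume 0 (2 * π) := by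
    have := (hg (0 - u) (2 * π - u)).comp_sub_right u
    simpa [sub_add_eq_add_sub] using this
  have hπ : (0 : ℝ) ≤ 2 * π := by positivity
  rw [← ofReal_integral_norm_eq_lintegral_enorm
    ((intervalIntegrable_iff_integrableOn_Ioc_of_le hπ).mp hgu),
    ← intervalIntegral.integral_of_le hπ]
  refine ENNReal.ofReal_le_ofReal (le_trans (le_of_eq ?_) hB)
  have hsubst := intervalIntegral.integral_comp_sub_right (fun x => |f (x + h) - f x|)
    (a := 0) (b := 2 * π) u
  have hshift := hgper.intervalIntegral_add_eq (0 - u) 0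
  rw [show 0 - u + 2 * π = 2 * π - u by ring, zero_add] at hshift
  rw [← hshift, ← hsubst]
  simp only [norm_eq_abs, sub_add_eq_add_sub]

lemma lintegral_enorm_sub_convolution_le (hper : Function.Periodic f (2 * π))
    (hf : ∀ a b : ℝ, IntervalIntegrable f volume a b) {E : ℝ → ℝ} (hE : Continuous E) {h B : ℝ}
    (hB : ∫ x in (0 : ℝ)..(2 * π), |f (x + h) - f x| ≤ B) :
    ∫⁻ x in Set.Ioc 0 (2 * π), ‖(∫ u in (0 : ℝ)..(2 * π), f (x + h - u) * E u) -
        ∫ u in (0 : ℝ)..(2 * π), f (x - u) * E u‖ₑ ≤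
      ENNReal.ofReal (B * ∫ u in (0 : ℝ)..(2 * π), |E u|) := by
  have hπ : (0 : ℝ) ≤ 2 * π := by positivity
  have hB0 : 0 ≤ B := (intervalIntegral.integral_nonneg hπ fun _ _ => abs_nonneg _).trans hB
  have hmeas : AEStronglyMeasurable f volume :=
    (locallyIntegrable_of_intervalIntegrable hf).aestronglyMeasurable
  set μ : Measure ℝ := volume.restrict (Set.Ioc 0 (2 * π)) with hμ
  have hpoint (x : ℝ) : ‖(∫ u in (0 : ℝ)..(2 * π), f (x + h - u) * E u) -
        ∫ u in (0 : ℝ)..(2 * π), f (x - u) * E u‖ₑ ≤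
      ∫⁻ u, ‖f (x + h - u) - f (x - u)‖ₑ * ‖E u‖ₑ ∂μ := by
    rw [← intervalIntegral.integral_sub
      ((intervalIntegrable_comp_const_sub hf _ _ _).mul_continuousOn hE.continuousOn)
      ((intervalIntegrable_comp_const_sub hf _ _ _).mul_continuousOn hE.continuousOn),
      intervalIntegral.integral_of_le hπ]
    refine (enorm_integral_le_lintegral_enorm _).trans (le_of_eq ?_)
    simp only [← sub_mul, enorm_mul, hμ]
  have hae : AEMeasurable
      (Function.uncurry fun x u => ‖f (x + h - u) - f (x - u)‖ₑ * ‖E u‖ₑ) (μ.prod μ) := by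
    have hac : μ.prod μ ≪ volume.prod volume :=
      Measure.AbsolutelyContinuous.prod Measure.absolutelyContinuous_restrict
        Measure.absolutelyContinuous_restrict
    have h1 : AEStronglyMeasurable (fun p : ℝ × ℝ => f (p.1 - p.2)) (volume.prod volume) :=
      hmeas.comp_quasiMeasurePreserving (quasiMeasurePreserving_sub volume volume)
    have hmeas' : AEStronglyMeasurable (fun y => f (y + h)) volume :=
      hmeas.comp_quasiMeasurePreserving
        (measurePreserving_add_right volume h).quasiMeasurePreserving
    have h2 : AEStronglyMeasurable (fun p : ℝ × ℝ => f (p.1 - p.2 + h)) (volume.prod volume) :=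
      hmeas'.comp_quasiMeasurePreserving (quasiMeasurePreserving_sub volume volume)
    simp only [sub_add_eq_add_sub] at h2
    exact ((h2.sub h1).mono_ac hac).enorm.mul
      (hE.measurable.comp measurable_snd).enorm.aemeasurable
  calc ∫⁻ x in Set.Ioc 0 (2 * π), ‖(∫ u in (0 : ℝ)..(2 * π), f (x + h - u) * E u) -
        ∫ u in (0 : ℝ)..(2 * π), f (x - u) * E u‖ₑ
      ≤ ∫⁻ x, ∫⁻ u, ‖f (x + h - u) - f (x - u)‖ₑ * ‖E u‖ₑ ∂μ ∂μ := lintegral_mono hpoint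
    _ = ∫⁻ u, ∫⁻ x, ‖f (x + h - u) - f (x - u)‖ₑ * ‖E u‖ₑ ∂μ ∂μ := lintegral_lintegral_swap hae
    _ ≤ ∫⁻ u, ENNReal.ofReal B * ‖E u‖ₑ ∂μ := by
        refine lintegral_mono fun u => ?_
        rw [lintegral_mul_const' _ _ enorm_ne_top]
        gcongr
        exact lintegral_translate_sub_le_s16 hper hf hB u
    _ = ENNReal.ofReal (B * ∫ u in (0 : ℝ)..(2 * π), |E u|) := by
        rw [lintegral_const_mul' _ _ ENNReal.ofReal_ne_top, ENNReal.ofReal_mul hB0,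
          intervalIntegral.integral_of_le hπ]
        congr 1
        exact (ofReal_integral_norm_eq_lintegral_enorm
          ((intervalIntegrable_iff_integrableOn_Ioc_of_le hπ).mp
            (hE.intervalIntegrable 0 (2 * π)))).symm

/-- If the difference quotients of `Φ` are bounded by `B` in `L¹`, then so is its derivative. -/
lemma integral_abs_le_of_hasDerivAt {s : Set ℝ} {Φ r : ℝ → ℝ} {B : ℝ} (hB : 0 ≤ B)
    (hΦ : Continuous Φ) (hderiv : ∀ᵐ x ∂volume.restrict s, HasDerivAt Φ (r x) x)
    (hquot : ∀ h, 0 < h → ∫⁻ x in s, ‖Φ (x + h) - Φ x‖ₑ ≤ ENNReal.ofReal (h * B)) :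
    ∫ x in s, |r x| ≤ B := by
  set h : ℕ → ℝ := fun m => 1 / ((m : ℝ) + 1)
  have hpos (m) : 0 < h m := by positivity
  have hlim : Filter.Tendsto h Filter.atTop (nhdsWithin 0 {0}ᶜ) :=
    tendsto_nhdsWithin_iff.mpr
      ⟨tendsto_one_div_add_atTop_nhds_zero_nat, Filter.Eventually.of_forall fun m => (hpos m).ne'⟩
  set q : ℕ → ℝ → ENNReal := fun m x => ‖(h m)⁻¹ • (Φ (x + h m) - Φ x)‖ₑ with hq
  have hqmeas (m) : Measurable (q m) := by
    have : Continuous fun x => (h m)⁻¹ • (Φ (x + h m) - Φ x) := by fun_prop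
    exact this.measurable.enorm
  have hqle (m) : ∫⁻ x in s, q m x ≤ ENNReal.ofReal B := by
    simp only [hq, enorm_smul]
    rw [lintegral_const_mul' _ _ enorm_ne_top]
    calc _ ≤ ENNReal.ofReal (h m)⁻¹ * ENNReal.ofReal (h m * B) := by
          rw [Real.enorm_of_nonneg (inv_pos.mpr (hpos m)).le]
          gcongr
          exact hquot _ (hpos m)
      _ = ENNReal.ofReal B := by
          rw [← ENNReal.ofReal_mul (inv_pos.mpr (hpos m)).le, inv_mul_cancel_left₀ (hpos m).ne']
  have hfatou : ∫⁻ x in s, ‖r x‖ₑ ≤ ENNReal.ofReal B := by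
    calc ∫⁻ x in s, ‖r x‖ₑ = ∫⁻ x in s, Filter.liminf (fun m => q m x) Filter.atTop := by
          refine lintegral_congr_ae ?_
          filter_upwards [hderiv] with x hx
          exact ((hx.tendsto_slope_zero.comp hlim).enorm.liminf_eq).symm
      _ ≤ Filter.liminf (fun m => ∫⁻ x in s, q m x) Filter.atTop := lintegral_liminf_le hqmeas
      _ ≤ ENNReal.ofReal B :=
          Filter.liminf_le_of_frequently_le' (Filter.Frequently.of_forall hqle)
  have hnorm := norm_integral_le_lintegral_norm (μ := volume.restrict s) fun x => |r x|
  simp only [norm_abs_eq_norm, ofReal_norm] at hnorm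
  exact (le_abs_self _).trans (hnorm.trans (ENNReal.toReal_le_of_le_ofReal hB hfatou))

lemma rieszMeans_sub_eq {w : ℕ → ℝ} (hw : ∀ k, 0 < w k) (n : ℕ) (x : ℝ) :
    f x - rieszMeans w f n x = (1 / ∑ k ∈ Finset.range (n + 1), w k) *
      ∑ k ∈ Finset.range (n + 1), w k * (f x - partialFourierSum f k x) := by
  have hP : 0 < ∑ k ∈ Finset.range (n + 1), w k :=
    Finset.sum_pos (fun k _ => hw k) Finset.nonempty_range_add_one
  simp only [rieszMeans, mul_sub, Finset.sum_sub_distrib, ← Finset.sum_mul]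
  field_simp

lemma integral_comp_sub_mul_rieszTail (hf : ∀ a b : ℝ, IntervalIntegrable f volume a b)
    (w : ℕ → ℝ) (n : ℕ) (x : ℝ) :
    ∫ u in (0 : ℝ)..(2 * π), f (x - u) * rieszTail w n u =
      (1 / ∑ k ∈ Finset.range (n + 1), w k) * ∑ k ∈ Finset.range (n + 1),
        w k * ∫ u in (0 : ℝ)..(2 * π), f (x - u) * dirichletTail k u := by
  have hint (k : ℕ) : IntervalIntegrable (fun u => f (x - u) * dirichletTail k u) volume
      0 (2 * π) :=
    (intervalIntegrable_comp_const_sub hf _ _ _).mul_continuousOn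
      (continuous_dirichletTail k).continuousOn
  have hexp (u : ℝ) : f (x - u) * rieszTail w n u = (1 / ∑ k ∈ Finset.range (n + 1), w k) *
      ∑ k ∈ Finset.range (n + 1), w k * (f (x - u) * dirichletTail k u) := by
    rw [rieszTail, mul_left_comm, Finset.mul_sum]
    congr 1
    exact Finset.sum_congr rfl fun k _ => by ring
  simp only [hexp]
  rw [intervalIntegral.integral_const_mul,
    intervalIntegral.integral_finsetSum fun k _ => (hint k).const_mul _]
  simp only [intervalIntegral.integral_const_mul]

lemma integral_abs_rieszMeans_sub_le (hper : Function.Periodic f (2 * π))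
    (hf : ∀ a b : ℝ, IntervalIntegrable f volume a b) {C : ℝ} (hC : 0 ≤ C)
    (hlip : ∀ h, 0 < h → ∫ x in (0 : ℝ)..(2 * π), |f (x + h) - f x| ≤ h * C)
    {w : ℕ → ℝ} (hw : ∀ k, 0 < w k) (n : ℕ) :
    π * ∫ x in (0 : ℝ)..(2 * π), |rieszMeans w f n x - f x| ≤
      C * ∫ u in (0 : ℝ)..(2 * π), |rieszTail w n u| := by
  have hπ : (0 : ℝ) ≤ 2 * π := by positivity
  have hE : 0 ≤ ∫ u in (0 : ℝ)..(2 * π), |rieszTail w n u| :=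
    intervalIntegral.integral_nonneg hπ fun _ _ => abs_nonneg _
  have hcont : Continuous fun x => ∫ u in (0 : ℝ)..(2 * π), f (x - u) * rieszTail w n u := by
    have := continuous_integral_comp_sub_mul_dirichletTail hper hf
    simp only [integral_comp_sub_mul_rieszTail hf]
    fun_prop
  have hderiv : ∀ᵐ x, HasDerivAt (fun x => ∫ u in (0 : ℝ)..(2 * π), f (x - u) * rieszTail w n u)
      (π * (f x - rieszMeans w f n x)) x := by
    filter_upwards [ae_hasDerivAt_integral_comp_sub_mul_dirichletTail hper hf] with x hx
    simp only [integral_comp_sub_mul_rieszTail hf]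
    refine ((HasDerivAt.fun_sum fun k _ => (hx k).const_mul (w k)).const_mul _).congr_deriv ?_
    rw [rieszMeans_sub_eq hw]
    simp only [Finset.mul_sum]
    exact Finset.sum_congr rfl fun k _ => by ring
  have h := integral_abs_le_of_hasDerivAt (mul_nonneg hC hE) hcont
    (ae_restrict_of_ae (s := Set.Ioc 0 (2 * π)) hderiv) fun h hh => by
      rw [← mul_assoc]
      exact lintegral_enorm_sub_convolution_le hper hf (continuous_rieszTail w n) (hlip h hh)
  rw [← intervalIntegral.integral_of_le hπ] at h
  simpa only [abs_mul, abs_of_pos pi_pos, intervalIntegral.integral_const_mul,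
    abs_sub_comm (f _)] using h

end Convolution

lemma lpNorm_one (f : ℝ → ℝ) :
    _root_.lpNorm 1 f = (1 / (2 * π)) * ∫ x in (0 : ℝ)..(2 * π), |f x| := by
  simp [_root_.lpNorm]

lemma integral_abs_translate_sub_le_of_lipClass {f : ℝ → ℝ} (hper : Function.Periodic f (2 * π))
    (hf : ∀ a b : ℝ, IntervalIntegrable f volume a b) {C : ℝ}
    (hC : ∀ δ : ℝ, 0 < δ → intModulus 1 f δ ≤ C * δ ^ (1 : ℝ)) {h : ℝ} (hh : 0 < h) :
    ∫ x in (0 : ℝ)..(2 * π), |f (x + h) - f x| ≤ h * (2 * π * C) := by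
  have hπ : (0 : ℝ) < 2 * π := by positivity
  have htrans (t : ℝ) : IntervalIntegrable (fun x => f (x + t)) volume 0 (2 * π) := by
    simpa using (hf (0 + t) (2 * π + t)).comp_add_right t
  have hbdd : BddAbove {y : ℝ | ∃ t : ℝ, 0 < |t| ∧ |t| ≤ h ∧
      y = ((1 / (2 * π)) * ∫ x in (0 : ℝ)..(2 * π), |f (x + t) - f x| ^ (1 : ℝ)) ^
        (1 / (1 : ℝ))} := by
    refine ⟨(1 / (2 * π)) * (2 * ∫ x in (0 : ℝ)..(2 * π), |f x|), ?_⟩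
    rintro y ⟨t, -, -, rfl⟩
    simp only [rpow_one, div_one]
    gcongr
    have hshift : ∫ x in (0 : ℝ)..(2 * π), |f (x + t)| = ∫ x in (0 : ℝ)..(2 * π), |f x| := by
      have hp : Function.Periodic (fun x => |f x|) (2 * π) := fun x => by simp only [hper x]
      rw [intervalIntegral.integral_comp_add_right (fun x => |f x|) t]
      have := hp.intervalIntegral_add_eq t 0
      rwa [zero_add, add_comm t, ← zero_add t, ← add_assoc, add_zero] at this
    calc ∫ x in (0 : ℝ)..(2 * π), |f (x + t) - f x|
        ≤ ∫ x in (0 : ℝ)..(2 * π), (|f (x + t)| + |f x|) :=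
          intervalIntegral.integral_mono_on hπ.le ((htrans t).sub (hf _ _)).abs
            ((htrans t).abs.add (hf _ _).abs) fun x _ => abs_sub _ _
      _ = 2 * ∫ x in (0 : ℝ)..(2 * π), |f x| := by
          rw [intervalIntegral.integral_add (htrans t).abs (hf _ _).abs, hshift]
          ring
  have hle := (le_csSup hbdd ⟨h, abs_pos.mpr hh.ne', (abs_of_pos hh).le, rfl⟩).trans (hC h hh)
  simp only [rpow_one, div_one] at hle
  rw [one_div, inv_mul_le_iff₀ hπ] at hle
  linarith

/-- Corollary 1 (vi): if `f ∈ Lip(1,1)`, the weights `(p_k)` are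
positive, for some `β > 0` the sequence `((k+1)^{-β} p_k)` belongs to `HBVS`, and
`(n+1)p_n = O(P_n)`, then `‖R_n(f) - f‖_{L^1} = O(n^{-1})`. -/
theorem riesz_approx_HBVS (f : ℝ → ℝ) (hf : LipClass 1 1 f)
    (w : ℕ → ℝ) (hw : ∀ k, 0 < w k)
    (β : ℝ) (hβ : 0 < β)
    (hHBVS : ∃ K : ℝ, ∀ m : ℕ,
      ∑ k ∈ Finset.range m,
        |((k : ℝ) + 1) ^ (-β) * w k - ((k : ℝ) + 2) ^ (-β) * w (k + 1)| ≤
          K * (((m : ℝ) + 1) ^ (-β) * w m))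
    (hO : ∃ C : ℝ, ∀ n : ℕ,
      ((n : ℝ) + 1) * w n ≤ C * ∑ k ∈ Finset.range (n + 1), w k) :
    ∃ C : ℝ, ∀ n : ℕ, 1 ≤ n →
      lpNorm 1 (fun x => rieszMeans w f n x - f x) ≤ C / (n : ℝ) := by
  obtain ⟨hper, hint, -, A, hA, hmod⟩ := hf
  obtain ⟨K, hK⟩ := hHBVS
  obtain ⟨B, hB⟩ := hO
  obtain ⟨D, hD, hTail⟩ := exists_integral_abs_rieszTail_le hw hβ hK hB
  have hfint := intervalIntegrable_of_periodic hper hint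
  refine ⟨A / π * D, fun n hn => ?_⟩
  have hn0 : (0 : ℝ) < n := by exact_mod_cast hn
  have hmain := integral_abs_rieszMeans_sub_le hper hfint (by positivity)
    (fun h hh => integral_abs_translate_sub_le_of_lipClass hper hfint hmod hh) hw n
  have hπ := pi_pos
  rw [lpNorm_one, one_div, inv_mul_le_iff₀ (by positivity)]
  rw [← le_div_iff₀' hπ] at hmain
  calc _ ≤ 2 * π * A * (∫ u in (0 : ℝ)..(2 * π), |rieszTail w n u|) / π := hmain
    _ ≤ 2 * π * A * (D / (n : ℝ)) / π := by
        gcongr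
        exact (hTail n).trans (by gcongr; linarith)
    _ = 2 * π * (A / π * D / n) := by ring
end
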